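/- arXiv:1711.08274 — 3 statements merged into one kernel-verified Lean document; each statement's English description precedes it below -/
import Mathlib

section
/- Let α ∈ (0,1) and 1 < p ≤ q < ∞ with 1/q + 1/p' = α, let 𝒮 be an η-sparse collection of dyadic cubes in ℝⁿ, and let ω be a weight on ℝⁿ with [ω]_{A_{pq}} < ∞. Then there is a constant C depending only on n, p, q, α, η such that for all f ∈ L^p_{ω^p}: ‖A^{2,α}_𝒮 f‖_{L^q_{ω^q}} ≤ C · [ω]_{A_{pq}}^{max( (p'/q)·α, α − 1/2 )} · ‖f‖_{L^p_{ω^p}}. -/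
open MeasureTheory ENNReal Set

noncomputable section

/-- An axis-parallel (closed) cube in ℝⁿ with corner `corner` and side length `side > 0`. -/
structure Cube (n : ℕ) where
  corner : Fin n → ℝ
  side : ℝ
  side_pos : 0 < side

namespace Cube

/-- The set of points of the cube. -/
def carrier {n : ℕ} (Q : Cube n) : Set (Fin n → ℝ) :=
  {x | ∀ i, Q.corner i ≤ x i ∧ x i ≤ Q.corner i + Q.side}

/-- The volume `|Q|` of the cube. -/
def vol {n : ℕ} (Q : Cube n) : ℝ := Q.side ^ n

/-- `Q` is a cube of the standard dyadic grid: `Q = 2^{-j}([0,1]^n + m)`. -/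
def IsDyadic {n : ℕ} (Q : Cube n) : Prop :=
  ∃ (j : ℤ) (m : Fin n → ℤ),
    Q.side = (2 : ℝ) ^ (-j) ∧ ∀ i, Q.corner i = (m i : ℝ) * (2 : ℝ) ^ (-j)

end Cube

/-- `η`-sparseness of a collection of cubes: there are pairwise disjoint measurable
subsets `E Q ⊆ Q` with `|E Q| ≥ η |Q|`. -/
def IsSparse {n : ℕ} (η : ℝ) (S : Set (Cube n)) : Prop :=
  ∃ E : Cube n → Set (Fin n → ℝ),
    (∀ Q ∈ S, MeasurableSet (E Q)) ∧ (∀ Q ∈ S, E Q ⊆ Q.carrier) ∧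
    (S.Pairwise (fun Q Q' => Disjoint (E Q) (E Q'))) ∧
    (∀ Q ∈ S, ENNReal.ofReal (η * Q.vol) ≤ volume (E Q))

/-- A weight: a nonnegative locally integrable function on ℝⁿ. -/
def IsWeight {n : ℕ} (w : (Fin n → ℝ) → ℝ) : Prop :=
  MeasureTheory.LocallyIntegrable w volume ∧ ∀ x, 0 ≤ w x

/-- `ω(Q) = ∫_Q ω`. -/
def wMass {n : ℕ} (w : (Fin n → ℝ) → ℝ) (Q : Cube n) : ℝ≥0∞ :=
  ∫⁻ x in Q.carrier, ENNReal.ofReal (w x)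

/-- The weighted `L^s` (quasi)norm `‖f‖_{L^s_w} = (∫ |f|^s w)^{1/s}`, valued in `ℝ≥0∞`. -/
def wNorm {n : ℕ} (s : ℝ) (w f : (Fin n → ℝ) → ℝ) : ℝ≥0∞ :=
  (∫⁻ x, ENNReal.ofReal (|f x| ^ s) * ENNReal.ofReal (w x)) ^ (1 / s)

/-- The weighted `L^s` (quasi)norm of an `ℝ≥0∞`-valued function. -/
def eNorm {n : ℕ} (s : ℝ) (w : (Fin n → ℝ) → ℝ) (g : (Fin n → ℝ) → ℝ≥0∞) : ℝ≥0∞ :=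
  (∫⁻ x, g x ^ s * ENNReal.ofReal (w x)) ^ (1 / s)

/-- `Σ_{Q ∈ D} g(Q) 1_Q`. -/
def cubeSum {n : ℕ} (D : Set (Cube n)) (g : Cube n → ℝ≥0∞) (x : Fin n → ℝ) : ℝ≥0∞ :=
  ∑' Q : D, Q.1.carrier.indicator (fun _ => g Q.1) x

/-- The sparse operator `A^{r,α}_S f = (Σ_{Q∈S} (|Q|^{-α} ∫_Q f)^r 1_Q)^{1/r}`
(for nonnegative `f`; negative values are truncated). -/
def sparseOp {n : ℕ} (S : Set (Cube n)) (r α : ℝ) (f : (Fin n → ℝ) → ℝ)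
    (x : Fin n → ℝ) : ℝ≥0∞ :=
  (cubeSum S
      (fun Q => ((ENNReal.ofReal Q.vol) ^ (-α) * ∫⁻ y in Q.carrier, ENNReal.ofReal (f y)) ^ r)
      x) ^ (1 / r)

/-- The Hardy–Littlewood maximal function over axis-parallel cubes. -/
def maximal {n : ℕ} (w : (Fin n → ℝ) → ℝ) (x : Fin n → ℝ) : ℝ≥0∞ :=
  ⨆ (Q : Cube n) (_ : x ∈ Q.carrier),
    (ENNReal.ofReal Q.vol)⁻¹ * ∫⁻ y in Q.carrier, ENNReal.ofReal |w y|

/-- The Fujii–Wilson `A∞`-characteristic `[w]_{A∞} = sup_Q ω(Q)⁻¹ ∫_Q M(1_Q ω)`. -/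
def AinfChar {n : ℕ} (w : (Fin n → ℝ) → ℝ) : ℝ≥0∞ :=
  ⨆ Q : Cube n, (wMass w Q)⁻¹ * ∫⁻ x in Q.carrier, maximal (Q.carrier.indicator w) x

/-- The two-weight characteristic
`[ω,σ]_{A^α_{pq}(S)} = sup_{Q∈S} |Q|^{-α} ω(Q)^{1/q} σ(Q)^{1/p'}` (here `1/p' = 1 - 1/p`). -/
def twoWeightChar {n : ℕ} (p q α : ℝ) (S : Set (Cube n)) (w σ' : (Fin n → ℝ) → ℝ) : ℝ≥0∞ :=
  ⨆ Q ∈ S, (ENNReal.ofReal Q.vol) ^ (-α) * wMass w Q ^ (1 / q) * wMass σ' Q ^ (1 - 1 / p)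

/-- The one-weight characteristic
`[w]_{A_{pq}} = sup_Q (|Q|⁻¹ ∫_Q w^q)(|Q|⁻¹ ∫_Q w^{-p'})^{q/p'}`, `p' = p/(p-1)`. -/
def ApqChar {n : ℕ} (p q : ℝ) (w : (Fin n → ℝ) → ℝ) : ℝ≥0∞ :=
  ⨆ Q : Cube n,
    ((ENNReal.ofReal Q.vol)⁻¹ * ∫⁻ x in Q.carrier, (ENNReal.ofReal (w x)) ^ q) *
      ((ENNReal.ofReal Q.vol)⁻¹ *
          ∫⁻ x in Q.carrier, (ENNReal.ofReal (w x)) ^ (-(p / (p - 1)))) ^ (q / (p / (p - 1)))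

/-- The testing constant `𝒯`. -/
def testT {n : ℕ} (p q r α : ℝ) (S : Set (Cube n)) (w σ' : (Fin n → ℝ) → ℝ) : ℝ≥0∞ :=
  ⨆ R ∈ S,
    wMass σ' R ^ (-(r / p)) *
      eNorm (q / r) w
        (cubeSum {Q | Q ∈ S ∧ Q.carrier ⊆ R.carrier}
          (fun Q => (ENNReal.ofReal Q.vol) ^ (-(α * r)) * wMass σ' Q ^ r))

/-- The testing constant `𝒯*`; here `1/(q/r)' = 1 - r/q` and `(p/r)' = (p/r)/((p/r)-1)`. -/
def testTstar {n : ℕ} (p q r α : ℝ) (S : Set (Cube n)) (w σ' : (Fin n → ℝ) → ℝ) : ℝ≥0∞ :=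
  ⨆ R ∈ S,
    wMass w R ^ (-(1 - r / q)) *
      eNorm ((p / r) / (p / r - 1)) σ'
        (cubeSum {Q | Q ∈ S ∧ Q.carrier ⊆ R.carrier}
          (fun Q => (ENNReal.ofReal Q.vol) ^ (-(α * r)) * wMass σ' Q ^ (r - 1) * wMass w Q))

/-- The operator (quasi)norm of `A^{r,α}_S(·σ) : L^p_σ → L^q_ω`, i.e. the least constant `K`
with `‖A^{r,α}_S(fσ)‖_{L^q_ω} ≤ K ‖f‖_{L^p_σ}` for all `f`. -/
def sparseOpNorm {n : ℕ} (p q r α : ℝ) (S : Set (Cube n)) (w σ' : (Fin n → ℝ) → ℝ) : ℝ≥0∞ :=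
  sInf {K : ℝ≥0∞ | ∀ f : (Fin n → ℝ) → ℝ, Measurable f →
    eNorm q w (sparseOp S r α (fun y => f y * σ' y)) ≤ K * wNorm p σ' f}

/-- One-sided geometric sums over finite sets of integers bounded above. -/
lemma sum_two_rpow_le {ι : Type*} {c : ℝ} (hc : 0 < c) (t : ℝ) (F : Finset ι) (k : ι → ℤ)
    (hk : Set.InjOn k F) (h : ∀ i ∈ F, (k i : ℝ) ≤ t) :
    ∑ i ∈ F, (2 : ℝ) ^ (c * k i) ≤ (1 - (2 : ℝ) ^ (-c))⁻¹ * 2 ^ (c * t) := by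
  have hr0 : (0 : ℝ) ≤ 2 ^ (-c) := by positivity
  have hr1 : (2 : ℝ) ^ (-c) < 1 := Real.rpow_lt_one_of_one_lt_of_neg (by norm_num) (by linarith)
  have hle : ∀ i ∈ F, k i ≤ ⌊t⌋ := fun i hi => Int.le_floor.2 (h i hi)
  have hinj : Set.InjOn (fun i => (⌊t⌋ - k i).toNat) F := by
    intro i hi j hj hij
    apply hk hi hj
    have h1 := hle i hi
    have h2 := hle j hj
    simp only at hij
    omega
  have hterm : ∀ i ∈ F, (2 : ℝ) ^ (c * k i) =
      2 ^ (c * (⌊t⌋ : ℝ)) * ((2 : ℝ) ^ (-c)) ^ ((⌊t⌋ - k i).toNat) := by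
    intro i hi
    have h1 : (((⌊t⌋ - k i).toNat : ℕ) : ℝ) = (⌊t⌋ : ℝ) - k i := by
      have h2 : (((⌊t⌋ - k i).toNat : ℕ) : ℤ) = ⌊t⌋ - k i :=
        Int.toNat_of_nonneg (by have := hle i hi; omega)
      exact_mod_cast h2
    rw [← Real.rpow_natCast, h1, ← Real.rpow_mul (by norm_num), ← Real.rpow_add (by norm_num)]
    congr 1; ring
  rw [Finset.sum_congr rfl hterm, ← Finset.mul_sum, mul_comm]
  refine mul_le_mul ?_ ?_ (by positivity) (inv_nonneg.2 (by linarith))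
  · have h1 := Finset.sum_image (s := F) (f := fun n : ℕ => ((2 : ℝ) ^ (-c)) ^ n) hinj
    rw [← h1, ← tsum_geometric_of_lt_one hr0 hr1]
    exact (summable_geometric_of_lt_one hr0 hr1).sum_le_tsum _ (fun _ _ => by positivity)
  · exact Real.rpow_le_rpow_of_exponent_le (by norm_num)
      (mul_le_mul_of_nonneg_left (Int.floor_le t) hc.le)

/-- Two-sided geometric sums. -/
lemma sum_two_rpow_min_le {c₁ c₂ : ℝ} (h1 : 0 < c₁) (h12 : c₁ < c₂) (t : ℝ) (K : Finset ℤ) :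
    ∑ k ∈ K, (2 : ℝ) ^ (-c₁ * k) * (min 1 ((2 : ℝ) ^ ((k : ℝ) - t))) ^ c₂ ≤
      ((1 - (2 : ℝ) ^ (-(c₂ - c₁)))⁻¹ + (1 - (2 : ℝ) ^ (-c₁))⁻¹) * 2 ^ (-c₁ * t) := by
  classical
  rw [← Finset.sum_filter_add_sum_filter_not K (fun k : ℤ => (k : ℝ) ≤ t), add_mul]
  refine add_le_add ?_ ?_
  · calc _ ≤ ∑ k ∈ K.filter (fun k : ℤ => (k : ℝ) ≤ t),
          2 ^ (-c₂ * t) * (2 : ℝ) ^ ((c₂ - c₁) * k) := by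
          refine Finset.sum_le_sum fun k _ => ?_
          calc (2 : ℝ) ^ (-c₁ * k) * (min 1 ((2 : ℝ) ^ ((k : ℝ) - t))) ^ c₂
              ≤ (2 : ℝ) ^ (-c₁ * k) * ((2 : ℝ) ^ ((k : ℝ) - t)) ^ c₂ := by
                refine mul_le_mul_of_nonneg_left ?_ (by positivity)
                exact Real.rpow_le_rpow (by positivity) (min_le_right _ _) (by linarith)
            _ = _ := by
                rw [← Real.rpow_mul (by norm_num), ← Real.rpow_add (by norm_num),
                  ← Real.rpow_add (by norm_num)]
                congr 1; ring
      _ ≤ 2 ^ (-c₂ * t) * ((1 - (2 : ℝ) ^ (-(c₂ - c₁)))⁻¹ * 2 ^ ((c₂ - c₁) * t)) := by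
          rw [← Finset.mul_sum]
          gcongr
          exact sum_two_rpow_le (by linarith) t _ (fun k => k) (fun _ _ _ _ h => h)
            (fun k hk => (Finset.mem_filter.1 hk).2)
      _ = _ := by
          rw [mul_left_comm, ← Real.rpow_add (by norm_num)]
          congr 2; ring
  · calc _ ≤ ∑ k ∈ K.filter (fun k : ℤ => ¬ (k : ℝ) ≤ t), (2 : ℝ) ^ (c₁ * ((-k : ℤ) : ℝ)) := by
          refine Finset.sum_le_sum fun k _ => ?_
          calc (2 : ℝ) ^ (-c₁ * k) * (min 1 ((2 : ℝ) ^ ((k : ℝ) - t))) ^ c₂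
              ≤ (2 : ℝ) ^ (-c₁ * k) * 1 := by
                gcongr
                exact Real.rpow_le_one (by positivity) (min_le_left _ _) (by linarith)
            _ = _ := by rw [mul_one]; congr 1; push_cast; ring
      _ ≤ (1 - (2 : ℝ) ^ (-c₁))⁻¹ * 2 ^ (c₁ * (-t)) := by
          refine sum_two_rpow_le h1 (-t) _ (fun k => -k) (fun _ _ _ _ h => neg_injective h) ?_
          intro k hk
          have := (Finset.mem_filter.1 hk).2
          push_cast
          linarith
      _ = _ := by ring_nf

lemma inv_one_sub_two_rpow_pos {c : ℝ} (hc : 0 < c) : 0 < (1 - (2 : ℝ) ^ (-c))⁻¹ := by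
  have hr1 : (2 : ℝ) ^ (-c) < 1 := Real.rpow_lt_one_of_one_lt_of_neg (by norm_num) (by linarith)
  exact inv_pos.2 (by linarith)

/-- Comparison of `ℓ²` and `ℓᵖ` sums with at most `N` terms. -/
lemma sum_sq_le_rpow {ι : Type*} {p : ℝ} (hp : 1 < p) {N : ℝ} (F : Finset ι)
    (hN : (F.card : ℝ) ≤ N) (b : ι → ℝ) (hb : ∀ i ∈ F, 0 ≤ b i) :
    ∑ i ∈ F, b i ^ (2 : ℝ) ≤ N ^ (max (1 - 2 / p) 0) * (∑ i ∈ F, b i ^ p) ^ (2 / p) := by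
  have hp0 : 0 < p := by linarith
  have hS : 0 ≤ ∑ i ∈ F, b i ^ p := Finset.sum_nonneg fun i hi => Real.rpow_nonneg (hb i hi) _
  have hpow : ∀ i ∈ F, b i ^ (2 : ℝ) = (b i ^ p) ^ (2 / p) := by
    intro i hi
    rw [← Real.rpow_mul (hb i hi)]
    congr 1; field_simp
  rw [Finset.sum_congr rfl hpow]
  have hpos : ∀ i ∈ F, 0 ≤ b i ^ p := fun i hi => Real.rpow_nonneg (hb i hi) _
  rcases le_total p 2 with h | h
  · have h1 : 1 ≤ 2 / p := by rw [le_div_iff₀ hp0]; linarith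
    rw [max_eq_right (by linarith), Real.rpow_zero, one_mul]
    by_cases h0 : ∑ i ∈ F, b i ^ p = 0
    · have h00 : ∀ i ∈ F, b i ^ p = 0 := (Finset.sum_eq_zero_iff_of_nonneg hpos).1 h0
      rw [h0, Finset.sum_eq_zero (fun i hi => by rw [h00 i hi, Real.zero_rpow (by linarith)]),
        Real.zero_rpow (by linarith)]
    · have hS' : 0 < ∑ i ∈ F, b i ^ p := lt_of_le_of_ne hS (Ne.symm h0)
      set B := ∑ i ∈ F, b i ^ p with hB
      calc ∑ i ∈ F, (b i ^ p) ^ (2 / p)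
          ≤ ∑ i ∈ F, (b i ^ p) * B ^ (2 / p - 1) := by
            refine Finset.sum_le_sum fun i hi => ?_
            have hle : b i ^ p ≤ B := Finset.single_le_sum (f := fun i => b i ^ p) hpos hi
            rcases (hpos i hi).eq_or_lt with h' | h'
            · rw [← h', Real.zero_rpow (by linarith), zero_mul]
            · calc (b i ^ p) ^ (2 / p) = (b i ^ p) * (b i ^ p) ^ (2 / p - 1) := by
                    rw [Real.rpow_sub h', Real.rpow_one]; field_simp
                _ ≤ _ := by
                    gcongr
        _ = B ^ (2 / p) := by
            rw [← Finset.sum_mul, Real.rpow_sub hS', Real.rpow_one]; field_simp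
            exact hB.symm
  · have h1 : 1 ≤ p / 2 := by linarith
    rw [max_eq_left (by rw [sub_nonneg, div_le_one hp0]; exact h)]
    by_cases h2 : p = 2
    · subst h2
      simp
    have h2' : 2 < p := lt_of_le_of_ne h (Ne.symm h2)
    have hconj : (p / (p - 2)).HolderConjugate (p / 2) := by
      rw [Real.holderConjugate_iff]
      constructor
      · rw [lt_div_iff₀ (by linarith)]; linarith
      · field_simp; ring
    have key := Real.inner_le_Lp_mul_Lq_of_nonneg F (f := fun _ => (1 : ℝ))
      (g := fun i => (b i ^ p) ^ (2 / p)) hconj (fun _ _ => zero_le_one)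
      (fun i hi => Real.rpow_nonneg (hpos i hi) _)
    simp only [one_mul, Real.one_rpow, Finset.sum_const, nsmul_eq_mul, mul_one] at key
    have e1 : 1 / (p / (p - 2)) = 1 - 2 / p := by
      field_simp
    have e2 : 1 / (p / 2) = 2 / p := by field_simp
    have e3 : ∀ i ∈ F, ((b i ^ p) ^ (2 / p)) ^ (p / 2) = b i ^ p := by
      intro i hi
      rw [← Real.rpow_mul (hpos i hi)]
      have : 2 / p * (p / 2) = 1 := by field_simp
      rw [this, Real.rpow_one]
    rw [e1, e2, Finset.sum_congr rfl e3] at key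
    refine key.trans ?_
    gcongr
    rw [sub_nonneg, div_le_one hp0]; exact h

lemma exists_two_rpow_eq {x : ℝ} (hx : 0 < x) : ∃ y : ℝ, x = (2 : ℝ) ^ y :=
  ⟨Real.logb 2 x, (Real.rpow_logb (by norm_num) (by norm_num) hx).symm⟩

/-- A discrete Hedberg-type inequality: a weighted `ℓ²` sum over a finite family which is graded by
two integers `a` and `k` is controlled by a weighted `ℓᵖ` sum, provided each graded piece has
bounded `ℓᵖ` sum and cardinality at most `M a`. -/
lemma hedberg_sum {ι : Type*} {p q : ℝ} (hp : 1 < p) (hpq : p < q) :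
    ∃ C : ℝ, 0 < C ∧ ∀ (T : Finset ι) (a k : ι → ℤ) (b : ι → ℝ) (M : ℤ → ℝ) (H A : ℝ),
      0 < H → (∀ i, 1 ≤ M i) → (∀ P ∈ T, 0 < b P) → (∀ P ∈ T, (a P : ℝ) ≤ A) →
      (∀ i j, ((T.filter (fun P => a P = i ∧ k P = j)).card : ℝ) ≤ M i) →
      (∀ i j, ∑ P ∈ T.filter (fun P => a P = i ∧ k P = j), b P ^ p ≤ H) →
      (∑ P ∈ T, (2 : ℝ) ^ (2 / q * ((a P : ℝ) - k P)) * b P ^ (2 : ℝ)) ^ (q / 2) ≤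
        C * ∑ P ∈ T, (2 : ℝ) ^ ((A - a P) / 2 + a P - k P) *
          M (a P) ^ (q / 2 * max (1 - 2 / p) 0) * H ^ (q / p - 1) * b P ^ p := by
  classical
  have hp0 : 0 < p := by linarith
  have hq0 : 0 < q := by linarith
  have hc1 : 0 < 2 / q := by positivity
  have hc12 : 2 / q < 2 / p := by gcongr
  have hK1 : 0 < (1 - (2 : ℝ) ^ (-(2 / p - 2 / q)))⁻¹ + (1 - (2 : ℝ) ^ (-(2 / q)))⁻¹ :=
    add_pos (inv_one_sub_two_rpow_pos (by linarith)) (inv_one_sub_two_rpow_pos hc1)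
  set K₁ := (1 - (2 : ℝ) ^ (-(2 / p - 2 / q)))⁻¹ + (1 - (2 : ℝ) ^ (-(2 / q)))⁻¹ with hK1d
  have hK2 : 0 < (1 - (2 : ℝ) ^ (-(1 / q)))⁻¹ := inv_one_sub_two_rpow_pos (by positivity)
  set K₂ := (1 - (2 : ℝ) ^ (-(1 / q)))⁻¹ with hK2d
  refine ⟨(K₁ * K₂) ^ (q / 2), by positivity, ?_⟩
  intro T a k b M H A hH hM hb ha hcard hsum
  set e := max (1 - 2 / p) 0 with he
  have he0 : 0 ≤ e := le_max_right _ _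
  rcases T.eq_empty_or_nonempty with hT | hT
  · subst hT
    simp [Real.zero_rpow (show q / 2 ≠ 0 by positivity)]
  set θ : ι → ℝ := fun P => (2 : ℝ) ^ ((A - a P) / 2 + a P - k P) *
          M (a P) ^ (q / 2 * e) * H ^ (q / p - 1) * b P ^ p with hθ
  have hM0 : ∀ i, 0 < M i := fun i => lt_of_lt_of_le one_pos (hM i)
  have hθpos : ∀ P ∈ T, 0 < θ P := by
    intro P hP
    have := hb P hP
    have := hM0 (a P)
    simp only [hθ]
    positivity
  set Ω := ∑ P ∈ T, θ P with hΩ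
  have hΩ0 : 0 < Ω := Finset.sum_pos hθpos hT
  have main : ∑ P ∈ T, (2 : ℝ) ^ (2 / q * ((a P : ℝ) - k P)) * b P ^ (2 : ℝ)
      ≤ (K₁ * K₂) * Ω ^ (2 / q) := by
    obtain ⟨o, ho⟩ := exists_two_rpow_eq hΩ0
    obtain ⟨h, hh⟩ := exists_two_rpow_eq hH
    have hstep : ∀ i, ∑ P ∈ T.filter (fun P => a P = i),
        (2 : ℝ) ^ (2 / q * ((a P : ℝ) - k P)) * b P ^ (2 : ℝ) ≤
        K₁ * Ω ^ (2 / q) * 2 ^ (- (1 / q) * A) * 2 ^ (1 / q * (i : ℝ)) := by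
      intro i
      obtain ⟨m, hm⟩ := exists_two_rpow_eq (hM0 i)
      set t : ℝ := h - (o - ((A - i) / 2 + i + (q / 2 * e) * m + h * (q / p - 1))) with ht
      have hfib : ∀ j, ∑ P ∈ T.filter (fun P => a P = i ∧ k P = j),
          (2 : ℝ) ^ (2 / q * ((a P : ℝ) - k P)) * b P ^ (2 : ℝ) ≤
          (2 ^ (2 / q * (i : ℝ)) * 2 ^ (m * e) * 2 ^ (h * (2 / p))) *
            (2 ^ (-(2 / q) * (j : ℝ)) * (min 1 ((2 : ℝ) ^ ((j : ℝ) - t))) ^ (2 / p)) := by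
        intro j
        set F := ∑ P ∈ T.filter (fun P => a P = i ∧ k P = j), b P ^ p with hF
        have hF0 : 0 ≤ F := Finset.sum_nonneg fun P hP =>
          Real.rpow_nonneg (hb P (Finset.mem_filter.1 hP).1).le _
        have hF2 : F ≤ H * min 1 ((2 : ℝ) ^ ((j : ℝ) - t)) := by
          rw [mul_min_of_nonneg _ _ hH.le, mul_one]
          refine le_min (hsum i j) ?_
          have h1 : (2 : ℝ) ^ ((A - i) / 2 + i - j) *
              M i ^ (q / 2 * e) * H ^ (q / p - 1) * F ≤ Ω := by
            rw [hF, Finset.mul_sum]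
            calc _ = ∑ P ∈ T.filter (fun P => a P = i ∧ k P = j), θ P := by
                  refine Finset.sum_congr rfl fun P hP => ?_
                  obtain ⟨_, h1, h2⟩ := Finset.mem_filter.1 hP
                  simp only [hθ, h1, h2]
              _ ≤ Ω := Finset.sum_le_sum_of_subset_of_nonneg (Finset.filter_subset _ _)
                  (fun P hP _ => (hθpos P hP).le)
          rw [hm, hh, ho, ← Real.rpow_mul (by norm_num), ← Real.rpow_mul (by norm_num),
            ← Real.rpow_add (by norm_num), ← Real.rpow_add (by norm_num)] at h1
          rw [← le_div_iff₀' (by positivity), ← Real.rpow_sub (by norm_num)] at h1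
          refine h1.trans (le_of_eq ?_)
          rw [hh, ← Real.rpow_add (by norm_num)]
          congr 1
          rw [ht]; ring
        calc ∑ P ∈ T.filter (fun P => a P = i ∧ k P = j),
              (2 : ℝ) ^ (2 / q * ((a P : ℝ) - k P)) * b P ^ (2 : ℝ)
            = 2 ^ (2 / q * ((i : ℝ) - j)) *
                ∑ P ∈ T.filter (fun P => a P = i ∧ k P = j), b P ^ (2 : ℝ) := by
              rw [Finset.mul_sum]
              refine Finset.sum_congr rfl fun P hP => ?_
              obtain ⟨_, h1, h2⟩ := Finset.mem_filter.1 hP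
              rw [h1, h2]
          _ ≤ 2 ^ (2 / q * ((i : ℝ) - j)) * (M i ^ e * F ^ (2 / p)) := by
              gcongr
              exact sum_sq_le_rpow hp _ (hcard i j) b
                (fun P hP => (hb P (Finset.mem_filter.1 hP).1).le)
          _ ≤ 2 ^ (2 / q * ((i : ℝ) - j)) *
                (M i ^ e * (H * min 1 ((2 : ℝ) ^ ((j : ℝ) - t))) ^ (2 / p)) := by
              have := hM0 i
              gcongr
          _ = _ := by
              rw [Real.mul_rpow hH.le (by positivity), hm, hh, ← Real.rpow_mul (by norm_num),
                ← Real.rpow_mul (by norm_num), mul_sub, sub_eq_add_neg,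
                Real.rpow_add (by norm_num), ← neg_mul]
              ring
      calc _ = ∑ j ∈ T.image k, ∑ P ∈ T.filter (fun P => a P = i ∧ k P = j),
              (2 : ℝ) ^ (2 / q * ((a P : ℝ) - k P)) * b P ^ (2 : ℝ) := by
            rw [← Finset.sum_fiberwise_of_maps_to (t := T.image k) (g := k)
              (fun P hP => Finset.mem_image_of_mem _ (Finset.mem_filter.1 hP).1)]
            simp only [Finset.filter_filter]
        _ ≤ ∑ j ∈ T.image k, (2 ^ (2 / q * (i : ℝ)) * 2 ^ (m * e) * 2 ^ (h * (2 / p))) *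
            (2 ^ (-(2 / q) * (j : ℝ)) * (min 1 ((2 : ℝ) ^ ((j : ℝ) - t))) ^ (2 / p)) :=
            Finset.sum_le_sum fun j _ => hfib j
        _ ≤ (2 ^ (2 / q * (i : ℝ)) * 2 ^ (m * e) * 2 ^ (h * (2 / p))) *
            (K₁ * 2 ^ (-(2 / q) * t)) := by
            rw [← Finset.mul_sum]
            exact mul_le_mul_of_nonneg_left (sum_two_rpow_min_le hc1 hc12 t _) (by positivity)
        _ = _ := by
            rw [ho, ← Real.rpow_mul (by norm_num), mul_left_comm, mul_assoc K₁, mul_assoc K₁]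
            congr 1
            simp only [← Real.rpow_add (show (0 : ℝ) < 2 by norm_num)]
            congr 1
            rw [ht]; field_simp; ring
    calc _ = ∑ i ∈ T.image a, ∑ P ∈ T.filter (fun P => a P = i),
              (2 : ℝ) ^ (2 / q * ((a P : ℝ) - k P)) * b P ^ (2 : ℝ) :=
            (Finset.sum_fiberwise_of_maps_to (g := a)
              (fun P hP => Finset.mem_image_of_mem _ hP) _).symm
      _ ≤ ∑ i ∈ T.image a, K₁ * Ω ^ (2 / q) * 2 ^ (- (1 / q) * A) * 2 ^ (1 / q * (i : ℝ)) :=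
            Finset.sum_le_sum fun i _ => hstep i
      _ ≤ K₁ * Ω ^ (2 / q) * 2 ^ (- (1 / q) * A) * (K₂ * 2 ^ (1 / q * A)) := by
            rw [← Finset.mul_sum]
            refine mul_le_mul_of_nonneg_left ?_ (by positivity)
            refine sum_two_rpow_le (by positivity) A _ (fun i => i) (fun _ _ _ _ h => h) ?_
            intro i hi
            obtain ⟨P, hP, rfl⟩ := Finset.mem_image.1 hi
            exact ha P hP
      _ = _ := by
            have : (2 : ℝ) ^ (- (1 / q) * A) * 2 ^ (1 / q * A) = 1 := by
              rw [← Real.rpow_add (by norm_num), neg_mul, neg_add_cancel, Real.rpow_zero]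
            linear_combination K₁ * Ω ^ (2 / q) * K₂ * this
  calc _ ≤ ((K₁ * K₂) * Ω ^ (2 / q)) ^ (q / 2) := by
        refine Real.rpow_le_rpow (Finset.sum_nonneg fun P hP => ?_) main (by positivity)
        have := hb P hP
        positivity
    _ = _ := by
        rw [Real.mul_rpow (by positivity) (by positivity), ← Real.rpow_mul hΩ0.le]
        have : 2 / q * (q / 2) = 1 := by field_simp
        rw [this, Real.rpow_one]

/-- A finite family of sets with the nestedness of dyadic cubes of scale `sc`. -/
structure IsNestedFamily {ι X : Type*} (S : Finset ι) (D : ι → Set X) (sc : ι → ℤ) : Prop where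
  subset : ∀ P ∈ S, ∀ Q ∈ S, sc P ≤ sc Q → (D P ∩ D Q).Nonempty → D P ⊆ D Q
  inj : ∀ P ∈ S, ∀ Q ∈ S, (D P ∩ D Q).Nonempty → sc P = sc Q → P = Q
  nonempty : ∀ P ∈ S, (D P).Nonempty

/-- `P` has the largest scale among the members of `S` that contain it and share its grade `g`. -/
def IsTopMember {ι X G : Type*} (S : Finset ι) (D : ι → Set X) (sc : ι → ℤ) (g : ι → G) (P : ι) : Prop :=
  ∀ Q ∈ S, D P ⊆ D Q → g Q = g P → sc Q ≤ sc P

open Classical in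
/-- A sum over the members of a nested family containing `x` is controlled by the sum over the
top members of each grade, if `s` decays geometrically in each grade. -/
lemma sum_le_sum_top {ι X G : Type*} {p K γ : ℝ} (hp : 0 < p) (hK : 0 < K) (hγ : 0 < γ)
    (S : Finset ι) (D : ι → Set X) (sc : ι → ℤ) (hS : IsNestedFamily S D sc) (g : ι → G)
    (c s : ι → ℝ) (hs : ∀ P ∈ S, 0 < s P) (hc : ∀ P ∈ S, 0 ≤ c P)
    (hcg : ∀ P ∈ S, ∀ Q ∈ S, g P = g Q → c P = c Q)
    (hdecay : ∀ P ∈ S, ∀ Q ∈ S, D Q ⊆ D P → g Q = g P → sc Q ≤ sc P →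
      s Q ≤ K * 2 ^ (γ * ((sc Q : ℝ) - sc P)) * s P) (x : X) :
    ∑ Q ∈ S.filter (fun Q => x ∈ D Q), c Q * s Q ^ (2 / p) ≤
      K ^ (2 / p) * (1 - (2 : ℝ) ^ (-(2 * γ / p)))⁻¹ *
        ∑ P ∈ S.filter (fun P => x ∈ D P ∧ IsTopMember S D sc g P), c P * s P ^ (2 / p) := by
  set T := S.filter (fun Q => x ∈ D Q) with hT
  have hexists : ∀ Q ∈ T, ∃ P ∈ S.filter (fun P => x ∈ D P ∧ IsTopMember S D sc g P),
      g P = g Q ∧ sc Q ≤ sc P := by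
    intro Q hQ
    obtain ⟨P, hP, hmax⟩ := Finset.exists_max_image (T.filter (fun P => g P = g Q)) sc
      ⟨Q, Finset.mem_filter.2 ⟨hQ, rfl⟩⟩
    obtain ⟨hPT, hPg⟩ := Finset.mem_filter.1 hP
    obtain ⟨hPS, hxP⟩ := Finset.mem_filter.1 hPT
    refine ⟨P, Finset.mem_filter.2 ⟨hPS, hxP, ?_⟩, hPg, hmax Q (Finset.mem_filter.2 ⟨hQ, rfl⟩)⟩
    intro R hR hPR hRg
    exact hmax R (Finset.mem_filter.2 ⟨Finset.mem_filter.2 ⟨hR, hPR hxP⟩, hRg.trans hPg⟩)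
  choose! π hπmem hπg hπsc using hexists
  rw [← Finset.sum_fiberwise_of_maps_to hπmem, Finset.mul_sum]
  refine Finset.sum_le_sum fun P hP => ?_
  obtain ⟨hPS, hxP, -⟩ := Finset.mem_filter.1 hP
  have hsP := hs P hPS
  have hcP := hc P hPS
  calc ∑ Q ∈ T.filter (fun Q => π Q = P), c Q * s Q ^ (2 / p)
      ≤ ∑ Q ∈ T.filter (fun Q => π Q = P), (c P * K ^ (2 / p) * s P ^ (2 / p) *
          2 ^ (-(2 * γ / p) * (sc P : ℝ))) * 2 ^ (2 * γ / p * (sc Q : ℝ)) := by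
        refine Finset.sum_le_sum fun Q hQ => ?_
        obtain ⟨hQT, rfl⟩ := Finset.mem_filter.1 hQ
        obtain ⟨hQS, hxQ⟩ := Finset.mem_filter.1 hQT
        have hsub := hS.subset Q hQS _ hPS (hπsc Q hQT) ⟨x, hxQ, hxP⟩
        have h1 := hdecay _ hPS Q hQS hsub (hπg Q hQT).symm (hπsc Q hQT)
        have hsQ := hs Q hQS
        calc c Q * s Q ^ (2 / p)
            ≤ c (π Q) * (K * 2 ^ (γ * ((sc Q : ℝ) - sc (π Q))) * s (π Q)) ^ (2 / p) := by
              rw [hcg _ hPS Q hQS (hπg Q hQT)] at *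
              gcongr
          _ = _ := by
              rw [Real.mul_rpow (by positivity) hsP.le, Real.mul_rpow hK.le (by positivity),
                ← Real.rpow_mul (by norm_num)]
              have : (2 : ℝ) ^ (γ * ((sc Q : ℝ) - sc (π Q)) * (2 / p)) =
                  2 ^ (-(2 * γ / p) * (sc (π Q) : ℝ)) * 2 ^ (2 * γ / p * (sc Q : ℝ)) := by
                rw [← Real.rpow_add (by norm_num)]
                congr 1
                field_simp
                ring
              rw [this]; ring
    _ ≤ (c P * K ^ (2 / p) * s P ^ (2 / p) * 2 ^ (-(2 * γ / p) * (sc P : ℝ))) *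
          ((1 - (2 : ℝ) ^ (-(2 * γ / p)))⁻¹ * 2 ^ (2 * γ / p * (sc P : ℝ))) := by
        rw [← Finset.mul_sum]
        refine mul_le_mul_of_nonneg_left ?_ (by positivity)
        refine sum_two_rpow_le (by positivity) _ _ sc ?_ ?_
        · intro Q hQ R hR hQR
          obtain ⟨hQS, hxQ⟩ := Finset.mem_filter.1 (Finset.mem_filter.1 hQ).1
          obtain ⟨hRS, hxR⟩ := Finset.mem_filter.1 (Finset.mem_filter.1 hR).1
          exact hS.inj Q hQS R hRS ⟨x, hxQ, hxR⟩ hQR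
        · intro Q hQ
          obtain ⟨hQT, rfl⟩ := Finset.mem_filter.1 hQ
          exact_mod_cast hπsc Q hQT
    _ = _ := by
        have : (2 : ℝ) ^ (-(2 * γ / p) * (sc P : ℝ)) * 2 ^ (2 * γ / p * (sc P : ℝ)) = 1 := by
          rw [← Real.rpow_add (by norm_num), neg_mul, neg_add_cancel, Real.rpow_zero]
        linear_combination c P * K ^ (2 / p) * s P ^ (2 / p) *
          (1 - (2 : ℝ) ^ (-(2 * γ / p)))⁻¹ * this

open Classical in
/-- Pointwise control of a weighted square function over a nested family graded by `(a, k, l)`. -/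
lemma pointwise_bound {ι X : Type*} {p q K γ : ℝ} (hp : 1 < p) (hpq : p < q) (hK : 0 < K)
    (hγ : 0 < γ) :
    ∃ C : ℝ, 0 < C ∧ ∀ (S : Finset ι) (D : ι → Set X) (sc : ι → ℤ), IsNestedFamily S D sc →
      ∀ (a k l : ι → ℤ) (s b : ι → ℝ) (M : ℤ → ℝ) (H A : ℝ), (∀ P ∈ S, 0 < s P) →
      (∀ P ∈ S, b P = 2 ^ (l P : ℝ) * s P ^ (1 / p)) →
      (∀ P ∈ S, ∀ Q ∈ S, D Q ⊆ D P → a Q = a P → k Q = k P → sc Q ≤ sc P →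
        s Q ≤ K * 2 ^ (γ * ((sc Q : ℝ) - sc P)) * s P) →
      0 < H → (∀ i, 1 ≤ M i) → (∀ P ∈ S, (a P : ℝ) ≤ A) →
      (∀ x i j, ((S.filter (fun P => x ∈ D P ∧ a P = i ∧ k P = j)).card : ℝ) ≤ M i) →
      (∀ P ∈ S, b P ^ p ≤ H) →
      (∀ i, ∑ P ∈ S.filter (fun P => IsTopMember S D sc (fun P => (a P, k P, l P)) P ∧
        ¬ IsTopMember S D sc (fun P => (a P, k P)) P ∧ a P = i), b P ^ p ≤ H) →
      ∀ x, (∑ P ∈ S.filter (fun P => x ∈ D P),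
          (2 : ℝ) ^ (2 / q * ((a P : ℝ) - k P)) * b P ^ (2 : ℝ)) ^ (q / 2) ≤
        C * ∑ P ∈ S.filter (fun P => x ∈ D P), (2 : ℝ) ^ ((A - a P) / 2 + a P - k P) *
          (if IsTopMember S D sc (fun P => (a P, k P, l P)) P ∧
            ¬ IsTopMember S D sc (fun P => (a P, k P)) P then
            M (a P) ^ (q / 2 * max (1 - 2 / p) 0) else 1) * H ^ (q / p - 1) * b P ^ p := by
  have hp0 : 0 < p := by linarith
  have hq0 : 0 < q := by linarith
  obtain ⟨C, hC, hh⟩ := hedberg_sum (ι := ι) hp hpq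
  have hG : 0 < (1 - (2 : ℝ) ^ (-(2 * γ / p)))⁻¹ := inv_one_sub_two_rpow_pos (by positivity)
  set G := (1 - (2 : ℝ) ^ (-(2 * γ / p)))⁻¹ with hGd
  refine ⟨(K ^ (2 / p) * G) ^ (q / 2) * (2 ^ (q / 2) * C), by positivity, ?_⟩
  intro S D sc hS a k l s b M H A hs hb hdecay hH hM hA hcard hbH hsum x
  set g : ι → ℤ × ℤ × ℤ := fun P => (a P, k P, l P) with hg
  set g' : ι → ℤ × ℤ := fun P => (a P, k P) with hg'
  have hbpos : ∀ P ∈ S, 0 < b P := by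
    intro P hP
    have := hs P hP
    rw [hb P hP]; positivity
  have hM0 : ∀ i, 0 < M i := fun i => lt_of_lt_of_le one_pos (hM i)
  have hb2 : ∀ P ∈ S, (2 : ℝ) ^ (2 / q * ((a P : ℝ) - k P)) * b P ^ (2 : ℝ) =
      ((2 : ℝ) ^ (2 / q * ((a P : ℝ) - k P)) * 2 ^ ((l P : ℝ) * 2)) * s P ^ (2 / p) := by
    intro P hP
    rw [hb P hP, Real.mul_rpow (by positivity) (Real.rpow_nonneg (hs P hP).le _),
      ← Real.rpow_mul (by norm_num), ← Real.rpow_mul (hs P hP).le, mul_assoc]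
    congr 3; ring
  set t : ι → ℝ := fun P => (2 : ℝ) ^ (2 / q * ((a P : ℝ) - k P)) * b P ^ (2 : ℝ) with htd
  have htpos : ∀ P ∈ S, 0 < t P := by
    intro P hP
    have := hbpos P hP
    simp only [htd]; positivity
  set T₁ := S.filter (fun P => x ∈ D P ∧ IsTopMember S D sc g' P) with hT1
  set T₂ := S.filter (fun P => x ∈ D P ∧ IsTopMember S D sc g P ∧ ¬ IsTopMember S D sc g' P) with hT2
  have hdisj : Disjoint T₁ T₂ := by
    rw [Finset.disjoint_left]
    intro P h1 h2
    exact (Finset.mem_filter.1 h2).2.2.2 (Finset.mem_filter.1 h1).2.2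
  set T := S.filter (fun P => x ∈ D P) with hT
  have hsub1 : T₁ ⊆ T := Finset.monotone_filter_right _ fun P _ h => h.1
  have hsub2 : T₂ ⊆ T := Finset.monotone_filter_right _ fun P _ h => h.1
  have hTS : ∀ P ∈ T, P ∈ S := fun P hP => (Finset.mem_filter.1 hP).1
  have hstep1 : ∑ P ∈ T, t P ≤ K ^ (2 / p) * G * (∑ P ∈ T₁, t P + ∑ P ∈ T₂, t P) := by
    have h1 := sum_le_sum_top hp0 hK hγ S D sc hS g
      (fun P => (2 : ℝ) ^ (2 / q * ((a P : ℝ) - k P)) * 2 ^ ((l P : ℝ) * 2)) s hs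
      (fun P _ => by positivity)
      (by
        intro P _ Q _ h
        simp only [hg, Prod.mk.injEq] at h
        simp only [h.1, h.2.1, h.2.2])
      (by
        intro P hP Q hQ hQP h hsc
        simp only [hg, Prod.mk.injEq] at h
        exact hdecay P hP Q hQ hQP h.1 h.2.1 hsc) x
    rw [← Finset.sum_congr rfl (fun P hP => hb2 P (hTS P hP)),
      ← Finset.sum_congr rfl (fun P hP => hb2 P (Finset.mem_filter.1 hP).1)] at h1
    refine h1.trans ?_
    refine mul_le_mul_of_nonneg_left ?_ (by positivity)
    rw [← Finset.sum_union hdisj]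
    refine Finset.sum_le_sum_of_subset_of_nonneg ?_ ?_
    · intro P hP
      obtain ⟨h1, h2, h3⟩ := Finset.mem_filter.1 hP
      by_cases h4 : IsTopMember S D sc g' P
      · exact Finset.mem_union_left _ (Finset.mem_filter.2 ⟨h1, h2, h4⟩)
      · exact Finset.mem_union_right _ (Finset.mem_filter.2 ⟨h1, h2, h3, h4⟩)
    · intro P hP _
      refine (htpos P ?_).le
      rcases Finset.mem_union.1 hP with h | h
      · exact (Finset.mem_filter.1 h).1
      · exact (Finset.mem_filter.1 h).1
  have hone : ∀ i j, (T₁.filter (fun P => a P = i ∧ k P = j)).card ≤ 1 := by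
    intro i j
    rw [Finset.card_le_one]
    intro P hP Q hQ
    obtain ⟨hP1, hPi, hPj⟩ := Finset.mem_filter.1 hP
    obtain ⟨hQ1, hQi, hQj⟩ := Finset.mem_filter.1 hQ
    obtain ⟨hPS, hxP, hPt⟩ := Finset.mem_filter.1 hP1
    obtain ⟨hQS, hxQ, hQt⟩ := Finset.mem_filter.1 hQ1
    have hgPQ : g' P = g' Q := by simp only [hg', hPi, hPj, hQi, hQj]
    rcases le_total (sc P) (sc Q) with h | h
    · exact hS.inj P hPS Q hQS ⟨x, hxP, hxQ⟩ (le_antisymm h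
        (hPt Q hQS (hS.subset P hPS Q hQS h ⟨x, hxP, hxQ⟩) hgPQ.symm))
    · exact hS.inj P hPS Q hQS ⟨x, hxP, hxQ⟩ (le_antisymm
        (hQt P hPS (hS.subset Q hQS P hPS h ⟨x, hxQ, hxP⟩) hgPQ) h)
  have hI := hh T₁ a k b (fun _ => 1) H A hH (fun _ => le_rfl)
    (fun P hP => hbpos P (hTS P (hsub1 hP))) (fun P hP => hA P (hTS P (hsub1 hP)))
    (fun i j => by exact_mod_cast hone i j)
    (by
      intro i j
      rcases (T₁.filter (fun P => a P = i ∧ k P = j)).eq_empty_or_nonempty with h | ⟨P, hP⟩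
      · rw [h, Finset.sum_empty]; exact hH.le
      · have : T₁.filter (fun P => a P = i ∧ k P = j) = {P} :=
          Finset.eq_singleton_iff_unique_mem.2
            ⟨hP, fun Q hQ => Finset.card_le_one.1 (hone i j) Q hQ P hP⟩
        rw [this, Finset.sum_singleton]
        exact hbH P (hTS P (hsub1 (Finset.mem_filter.1 hP).1)))
  have hII := hh T₂ a k b M H A hH hM
    (fun P hP => hbpos P (hTS P (hsub2 hP))) (fun P hP => hA P (hTS P (hsub2 hP)))
    (fun i j => by
      refine le_trans ?_ (hcard x i j)
      exact_mod_cast Finset.card_le_card (fun P hP => by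
        obtain ⟨h1, h2⟩ := Finset.mem_filter.1 hP
        obtain ⟨h3, h4, -⟩ := Finset.mem_filter.1 h1
        exact Finset.mem_filter.2 ⟨h3, h4, h2⟩))
    (fun i j => by
      refine le_trans ?_ (hsum i)
      refine Finset.sum_le_sum_of_subset_of_nonneg ?_ ?_
      · intro P hP
        obtain ⟨h1, h2⟩ := Finset.mem_filter.1 hP
        obtain ⟨h3, h4, h5, h6⟩ := Finset.mem_filter.1 h1
        exact Finset.mem_filter.2 ⟨h3, h5, h6, h2.1⟩
      · intro P hP _
        exact Real.rpow_nonneg (hbpos P (Finset.mem_filter.1 hP).1).le _)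
  have hn1 : 0 ≤ ∑ P ∈ T₁, t P := Finset.sum_nonneg fun P hP => (htpos P (hTS P (hsub1 hP))).le
  have hn2 : 0 ≤ ∑ P ∈ T₂, t P := Finset.sum_nonneg fun P hP => (htpos P (hTS P (hsub2 hP))).le
  have hn : 0 ≤ ∑ P ∈ T, t P := Finset.sum_nonneg fun P hP => (htpos P (hTS P hP)).le
  have hadd : ∀ y z : ℝ, 0 ≤ y → 0 ≤ z → (y + z) ^ (q / 2) ≤
      2 ^ (q / 2) * (y ^ (q / 2) + z ^ (q / 2)) := by
    intro y z hy hz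
    have hq2 : 0 ≤ q / 2 := by positivity
    have h1 : y + z ≤ 2 * max y z := by
      rcases le_total y z with h | h
      · rw [max_eq_right h]; linarith
      · rw [max_eq_left h]; linarith
    calc (y + z) ^ (q / 2) ≤ (2 * max y z) ^ (q / 2) := by gcongr
      _ = 2 ^ (q / 2) * (max y z) ^ (q / 2) :=
          Real.mul_rpow (by norm_num) (le_max_of_le_left hy)
      _ ≤ _ := by
          gcongr
          have h2 := Real.rpow_nonneg hy (q / 2)
          have h3 := Real.rpow_nonneg hz (q / 2)
          rcases max_choice y z with h | h <;> rw [h] <;> linarith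
  set θ : ι → ℝ := fun P => (2 : ℝ) ^ ((A - a P) / 2 + a P - k P) *
          (if IsTopMember S D sc g P ∧ ¬ IsTopMember S D sc g' P then
            M (a P) ^ (q / 2 * max (1 - 2 / p) 0) else 1) * H ^ (q / p - 1) * b P ^ p with hθ
  have hθpos : ∀ P ∈ S, 0 ≤ θ P := by
    intro P hP
    have := hbpos P hP
    have := hM0 (a P)
    simp only [hθ]
    split_ifs <;> positivity
  calc (∑ P ∈ T, t P) ^ (q / 2)
      ≤ (K ^ (2 / p) * G * (∑ P ∈ T₁, t P + ∑ P ∈ T₂, t P)) ^ (q / 2) := by gcongr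
    _ = (K ^ (2 / p) * G) ^ (q / 2) * (∑ P ∈ T₁, t P + ∑ P ∈ T₂, t P) ^ (q / 2) :=
        Real.mul_rpow (by positivity) (by positivity)
    _ ≤ (K ^ (2 / p) * G) ^ (q / 2) * (2 ^ (q / 2) *
          ((∑ P ∈ T₁, t P) ^ (q / 2) + (∑ P ∈ T₂, t P) ^ (q / 2))) := by
        gcongr
        exact hadd _ _ hn1 hn2
    _ ≤ (K ^ (2 / p) * G) ^ (q / 2) * (2 ^ (q / 2) * (C * ∑ P ∈ T₁, θ P + C * ∑ P ∈ T₂, θ P)) := by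
        gcongr
        · refine hI.trans (le_of_eq ?_)
          congr 1
          refine Finset.sum_congr rfl fun P hP => ?_
          have : ¬ (IsTopMember S D sc g P ∧ ¬ IsTopMember S D sc g' P) :=
            fun h => h.2 (Finset.mem_filter.1 hP).2.2
          simp only [hθ, if_neg this, Real.one_rpow]
        · refine hII.trans (le_of_eq ?_)
          congr 1
          refine Finset.sum_congr rfl fun P hP => ?_
          simp only [hθ, if_pos (Finset.mem_filter.1 hP).2.2]
    _ ≤ (K ^ (2 / p) * G) ^ (q / 2) * (2 ^ (q / 2) * (C * ∑ P ∈ T, θ P)) := by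
        rw [← mul_add, ← Finset.sum_union hdisj]
        gcongr
        · exact fun P hP _ => hθpos P (hTS P hP)
        · exact Finset.union_subset hsub1 hsub2
    _ = _ := by ring

/-- The part of a nested family whose averages of `u` exceed `2 ^ j` satisfies the restricted
weak-type bound of the dyadic maximal function. -/
lemma two_rpow_mul_measure_biUnion_le {ι X : Type*} [MeasurableSpace X] (σ : Measure X)
    (S : Finset ι) (D : ι → Set X) (sc : ι → ℤ) (hS : IsNestedFamily S D sc)
    (hD : ∀ P ∈ S, MeasurableSet (D P)) (hσ : ∀ P ∈ S, σ (D P) ≠ ∞) (u : X → ℝ≥0∞)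
    (hu : Measurable u) (j : ℝ) (hj : ∀ P ∈ S, (2 : ℝ≥0∞) ^ j * σ (D P) ≤ ∫⁻ x in D P, u x ∂σ) :
    (2 : ℝ≥0∞) ^ (j - 1) * σ (⋃ P ∈ S, D P) ≤
      ∫⁻ x, {x | (2 : ℝ≥0∞) ^ (j - 1) ≤ u x}.indicator u x ∂σ := by
  classical
  set T := S.filter (fun P => ∀ Q ∈ S, D P ⊆ D Q → sc Q ≤ sc P) with hT
  have hTS : ∀ P ∈ T, P ∈ S := fun P hP => (Finset.mem_filter.1 hP).1
  have hcover : (⋃ P ∈ S, D P) ⊆ ⋃ P ∈ T, D P := by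
    intro x hx
    simp only [mem_iUnion, exists_prop] at hx ⊢
    obtain ⟨Q, hQ, hxQ⟩ := hx
    obtain ⟨P, hP, hmax⟩ := Finset.exists_max_image (S.filter (fun P => x ∈ D P)) sc
      ⟨Q, Finset.mem_filter.2 ⟨hQ, hxQ⟩⟩
    obtain ⟨hPS, hxP⟩ := Finset.mem_filter.1 hP
    exact ⟨P, Finset.mem_filter.2 ⟨hPS, fun R hR hPR =>
      hmax R (Finset.mem_filter.2 ⟨hR, hPR hxP⟩)⟩, hxP⟩
  have hdisj : (T : Set ι).PairwiseDisjoint D := by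
    intro P hP Q hQ hPQ
    obtain ⟨hPS, hPm⟩ := Finset.mem_filter.1 hP
    obtain ⟨hQS, hQm⟩ := Finset.mem_filter.1 hQ
    by_contra hne
    have hne' : (D P ∩ D Q).Nonempty := Set.not_disjoint_iff_nonempty_inter.1 hne
    rcases le_total (sc P) (sc Q) with h | h
    · exact hPQ (hS.inj P hPS Q hQS hne' (le_antisymm h
        (hPm Q hQS (hS.subset P hPS Q hQS h hne'))))
    · exact hPQ (hS.inj P hPS Q hQS hne' (le_antisymm
        (hQm P hPS (hS.subset Q hQS P hPS h (inter_comm _ _ ▸ hne'))) h))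
  set v : X → ℝ≥0∞ := {x | (2 : ℝ≥0∞) ^ (j - 1) ≤ u x}.indicator u with hv
  have hvm : Measurable v := hu.indicator (measurableSet_le measurable_const hu)
  have huv : ∀ x, u x ≤ v x + 2 ^ (j - 1) := by
    intro x
    by_cases hx : (2 : ℝ≥0∞) ^ (j - 1) ≤ u x
    · have : v x = u x := Set.indicator_of_mem (s := {x | (2 : ℝ≥0∞) ^ (j - 1) ≤ u x}) hx u
      rw [this]; exact le_self_add
    · exact (not_le.1 hx).le.trans le_add_self
  have hone : ∀ P ∈ T, (2 : ℝ≥0∞) ^ (j - 1) * σ (D P) ≤ ∫⁻ x in D P, v x ∂σ := by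
    intro P hP
    have h1 := hj P (hTS P hP)
    have h2 : ∫⁻ x in D P, u x ∂σ ≤ ∫⁻ x in D P, v x ∂σ + 2 ^ (j - 1) * σ (D P) := by
      refine (lintegral_mono huv).trans ?_
      rw [lintegral_add_left hvm, setLIntegral_const]
    have h3 : (2 : ℝ≥0∞) ^ j = 2 ^ (j - 1) + 2 ^ (j - 1) := by
      rw [← two_mul]
      nth_rw 2 [← ENNReal.rpow_one 2]
      rw [← ENNReal.rpow_add _ _ (by norm_num) (by norm_num)]
      congr 1; ring
    rw [h3, add_mul] at h1
    have hfin : (2 : ℝ≥0∞) ^ (j - 1) * σ (D P) ≠ ∞ :=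
      ENNReal.mul_ne_top (ENNReal.rpow_ne_top_of_ne_zero (by norm_num) (by norm_num))
        (hσ P (hTS P hP))
    exact (ENNReal.add_le_add_iff_right hfin).1 (h1.trans h2)
  calc (2 : ℝ≥0∞) ^ (j - 1) * σ (⋃ P ∈ S, D P)
      ≤ 2 ^ (j - 1) * ∑ P ∈ T, σ (D P) := by
        gcongr
        exact (measure_mono hcover).trans (measure_biUnion_finset_le T D)
    _ ≤ ∑ P ∈ T, ∫⁻ x in D P, v x ∂σ := by
        rw [Finset.mul_sum]
        exact Finset.sum_le_sum hone
    _ = ∫⁻ x in ⋃ P ∈ T, D P, v x ∂σ :=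
        (lintegral_biUnion_finset hdisj (fun P hP => hD P (hTS P hP)) v).symm
    _ ≤ ∫⁻ x, v x ∂σ := setLIntegral_le_lintegral _ _

/-- A pointwise geometric sum in the layer-cake proof of the maximal inequality. -/
lemma sum_two_rpow_mul_indicator_le {p : ℝ} (hp : 1 < p) (L : Finset ℤ) (y : ℝ≥0∞) :
    ∑ j ∈ L, (2 : ℝ≥0∞) ^ ((j : ℝ) * (p - 1)) * {y : ℝ≥0∞ | 2 ^ ((j : ℝ) - 1) ≤ y}.indicator id y ≤
      ENNReal.ofReal ((1 - (2 : ℝ) ^ (-(p - 1)))⁻¹ * 2 ^ (p - 1)) * y ^ p := by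
  classical
  have hG : 0 < (1 - (2 : ℝ) ^ (-(p - 1)))⁻¹ := inv_one_sub_two_rpow_pos (by linarith)
  rcases eq_or_ne y ∞ with rfl | hy
  · rw [ENNReal.top_rpow_of_pos (by linarith), ENNReal.mul_top]
    · exact le_top
    · exact (ENNReal.ofReal_pos.2 (by positivity)).ne'
  rcases eq_or_ne y 0 with rfl | hy0
  · refine le_of_eq_of_le (Finset.sum_eq_zero fun j _ => ?_) zero_le
    by_cases h : (0 : ℝ≥0∞) ∈ {y : ℝ≥0∞ | 2 ^ ((j : ℝ) - 1) ≤ y}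
    · rw [Set.indicator_of_mem h]; simp
    · rw [Set.indicator_of_notMem h, mul_zero]
  set z := y.toReal with hz
  have hz0 : 0 < z := ENNReal.toReal_pos hy0 hy
  have hyz : y = ENNReal.ofReal z := (ENNReal.ofReal_toReal hy).symm
  obtain ⟨t, ht⟩ := exists_two_rpow_eq hz0
  have h2 : ∀ r : ℝ, (2 : ℝ≥0∞) ^ r = ENNReal.ofReal (2 ^ r) := by
    intro r
    rw [← ENNReal.ofReal_rpow_of_pos (by norm_num)]; norm_num
  calc ∑ j ∈ L, (2 : ℝ≥0∞) ^ ((j : ℝ) * (p - 1)) *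
          {y : ℝ≥0∞ | 2 ^ ((j : ℝ) - 1) ≤ y}.indicator id y
      ≤ ∑ j ∈ L.filter (fun j : ℤ => (j : ℝ) ≤ t + 1), ENNReal.ofReal (2 ^ ((p - 1) * j) * z) := by
        rw [Finset.sum_filter]
        refine Finset.sum_le_sum fun j _ => ?_
        by_cases h : y ∈ {y : ℝ≥0∞ | 2 ^ ((j : ℝ) - 1) ≤ y}
        · have h' : (2 : ℝ) ^ ((j : ℝ) - 1) ≤ 2 ^ t := by
            have := h
            rw [Set.mem_ofPred_eq, hyz, h2, ENNReal.ofReal_le_ofReal_iff hz0.le, ht] at this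
            exact this
          have h'' : (j : ℝ) ≤ t + 1 := by
            have := (Real.rpow_le_rpow_left_iff (by norm_num)).1 h'
            linarith
          rw [Set.indicator_of_mem h, if_pos h'', h2, id, ENNReal.ofReal_mul (by positivity),
            ← hyz, mul_comm (p - 1)]
        · rw [Set.indicator_of_notMem h, mul_zero]; exact zero_le
    _ = ENNReal.ofReal ((∑ j ∈ L.filter (fun j : ℤ => (j : ℝ) ≤ t + 1),
          (2 : ℝ) ^ ((p - 1) * (j : ℝ))) * z) := by
        rw [← ENNReal.ofReal_sum_of_nonneg (fun j _ => by positivity), Finset.sum_mul]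
    _ ≤ ENNReal.ofReal ((1 - (2 : ℝ) ^ (-(p - 1)))⁻¹ * 2 ^ ((p - 1) * (t + 1)) * z) := by
        refine ENNReal.ofReal_le_ofReal (mul_le_mul_of_nonneg_right ?_ hz0.le)
        exact sum_two_rpow_le (by linarith) _ _ (fun j => j) (fun i _ j _ h => h)
          (fun j hj => (Finset.mem_filter.1 hj).2)
    _ = _ := by
        rw [hyz, ENNReal.ofReal_rpow_of_pos hz0, ← ENNReal.ofReal_mul (by positivity)]
        congr 1
        have : z ^ p = 2 ^ ((p - 1) * t) * z := by
          rw [ht, ← Real.rpow_mul (by norm_num), ← Real.rpow_add (by norm_num)]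
          congr 1; ring
        rw [this, mul_add, mul_one, Real.rpow_add (by norm_num)]
        ring

/-- A discrete form of the `Lᵖ`-boundedness of the dyadic maximal function. -/
lemma sum_two_rpow_mul_measure_le {ι X : Type*} [MeasurableSpace X] {p : ℝ} (hp : 1 < p)
    (σ : Measure X) (S : Finset ι) (D : ι → Set X) (sc : ι → ℤ) (hS : IsNestedFamily S D sc)
    (hD : ∀ P ∈ S, MeasurableSet (D P)) (hσ : ∀ P ∈ S, σ (D P) ≠ ∞) (u : X → ℝ≥0∞)
    (hu : Measurable u) (l : ι → ℤ)
    (hl : ∀ P ∈ S, ∃ Q ∈ S, D P ⊆ D Q ∧ (2 : ℝ≥0∞) ^ (l P : ℝ) * σ (D Q) ≤ ∫⁻ x in D Q, u x ∂σ)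
    (T : Finset ι) (hT : T ⊆ S) (F : ι → Set X) (hF : ∀ P ∈ T, MeasurableSet (F P))
    (hFD : ∀ P ∈ T, F P ⊆ D P)
    (hdisj : ∀ P ∈ T, ∀ Q ∈ T, P ≠ Q → l P = l Q → Disjoint (F P) (F Q)) :
    ∑ P ∈ T, (2 : ℝ≥0∞) ^ ((l P : ℝ) * p) * σ (F P) ≤
      ENNReal.ofReal (2 * ((1 - (2 : ℝ) ^ (-(p - 1)))⁻¹ * 2 ^ (p - 1))) * ∫⁻ x, u x ^ p ∂σ := by
  classical
  set O : ℤ → Finset ι := fun j =>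
    S.filter (fun Q => (2 : ℝ≥0∞) ^ (j : ℝ) * σ (D Q) ≤ ∫⁻ x in D Q, u x ∂σ) with hO
  have hOS : ∀ j, ∀ Q ∈ O j, Q ∈ S := fun j Q hQ => (Finset.mem_filter.1 hQ).1
  have hOn : ∀ j, IsNestedFamily (O j) D sc := fun j =>
    ⟨fun P hP Q hQ => hS.subset P (hOS j P hP) Q (hOS j Q hQ),
      fun P hP Q hQ => hS.inj P (hOS j P hP) Q (hOS j Q hQ), fun P hP => hS.nonempty P (hOS j P hP)⟩
  have hweak : ∀ j : ℤ, (2 : ℝ≥0∞) ^ ((j : ℝ) - 1) * σ (⋃ P ∈ O j, D P) ≤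
      ∫⁻ x, {x | (2 : ℝ≥0∞) ^ ((j : ℝ) - 1) ≤ u x}.indicator u x ∂σ := fun j =>
    two_rpow_mul_measure_biUnion_le σ (O j) D sc (hOn j) (fun P hP => hD P (hOS j P hP))
      (fun P hP => hσ P (hOS j P hP)) u hu j (fun P hP => (Finset.mem_filter.1 hP).2)
  have hind : ∀ (j : ℤ) x, {x | (2 : ℝ≥0∞) ^ ((j : ℝ) - 1) ≤ u x}.indicator u x =
      {y : ℝ≥0∞ | 2 ^ ((j : ℝ) - 1) ≤ y}.indicator id (u x) := fun j x => rfl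
  have hlevel : ∀ j : ℤ, ∑ P ∈ T.filter (fun P => l P = j), σ (F P) ≤ σ (⋃ P ∈ O j, D P) := by
    intro j
    rw [← measure_biUnion_finset]
    · refine measure_mono (iUnion₂_subset fun P hP => ?_)
      obtain ⟨hPT, rfl⟩ := Finset.mem_filter.1 hP
      obtain ⟨Q, hQ, hPQ, hQl⟩ := hl P (hT hPT)
      exact ((hFD P hPT).trans hPQ).trans
        (subset_biUnion_of_mem (u := D) (Finset.mem_coe.2 (Finset.mem_filter.2 ⟨hQ, hQl⟩)))
    · intro P hP Q hQ hPQ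
      obtain ⟨hPT, hPj⟩ := Finset.mem_filter.1 hP
      obtain ⟨hQT, hQj⟩ := Finset.mem_filter.1 hQ
      exact hdisj P hPT Q hQT hPQ (hPj.trans hQj.symm)
    · exact fun P hP => hF P (Finset.mem_filter.1 hP).1
  have h2 : ∀ j : ℤ, (2 : ℝ≥0∞) ^ ((j : ℝ) * p) =
      2 * (2 ^ ((j : ℝ) * (p - 1)) * 2 ^ ((j : ℝ) - 1)) := by
    intro j
    nth_rw 2 [← ENNReal.rpow_one 2]
    rw [← ENNReal.rpow_add _ _ (by norm_num) (by norm_num),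
      ← ENNReal.rpow_add _ _ (by norm_num) (by norm_num)]
    congr 1; ring
  calc ∑ P ∈ T, (2 : ℝ≥0∞) ^ ((l P : ℝ) * p) * σ (F P)
      = ∑ j ∈ T.image l, ∑ P ∈ T.filter (fun P => l P = j), (2 : ℝ≥0∞) ^ ((l P : ℝ) * p) * σ (F P) :=
        (Finset.sum_fiberwise_of_maps_to (fun P hP => Finset.mem_image_of_mem l hP) _).symm
    _ ≤ ∑ j ∈ T.image l, 2 * (2 ^ ((j : ℝ) * (p - 1)) *
          ∫⁻ x, {y : ℝ≥0∞ | 2 ^ ((j : ℝ) - 1) ≤ y}.indicator id (u x) ∂σ) := by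
        refine Finset.sum_le_sum fun j _ => ?_
        calc _ = ∑ P ∈ T.filter (fun P => l P = j), (2 : ℝ≥0∞) ^ ((j : ℝ) * p) * σ (F P) :=
              Finset.sum_congr rfl fun P hP => by rw [(Finset.mem_filter.1 hP).2]
          _ ≤ (2 : ℝ≥0∞) ^ ((j : ℝ) * p) * σ (⋃ P ∈ O j, D P) := by
              rw [← Finset.mul_sum]
              gcongr
              exact hlevel j
          _ ≤ _ := by
              rw [h2, mul_assoc, mul_assoc]
              gcongr
              exact hweak j
    _ = 2 * ∫⁻ x, ∑ j ∈ T.image l, 2 ^ ((j : ℝ) * (p - 1)) *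
          {y : ℝ≥0∞ | 2 ^ ((j : ℝ) - 1) ≤ y}.indicator id (u x) ∂σ := by
        have hm : ∀ j : ℤ, Measurable fun x =>
            {y : ℝ≥0∞ | 2 ^ ((j : ℝ) - 1) ≤ y}.indicator id (u x) := fun j =>
          (measurable_id.indicator measurableSet_Ici).comp hu
        rw [lintegral_finsetSum _ fun j _ => (hm j).const_mul _, Finset.mul_sum]
        refine Finset.sum_congr rfl fun j _ => ?_
        rw [lintegral_const_mul _ (hm j)]
    _ ≤ 2 * ∫⁻ x, ENNReal.ofReal ((1 - (2 : ℝ) ^ (-(p - 1)))⁻¹ * 2 ^ (p - 1)) * u x ^ p ∂σ := by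
        gcongr with x
        exact sum_two_rpow_mul_indicator_le hp _ _
    _ = _ := by
        rw [lintegral_const_mul _ (hu.pow_const p), ← mul_assoc,
          ENNReal.ofReal_mul (p := 2) (by norm_num)]
        norm_num

/-- Members of a nested family which are top in their `(a, k, l)`-grade but not in their
`(a, k)`-grade are disjoint when they share `a` and `l`. -/
lemma disjoint_of_isTopMember {ι X : Type*} (S : Finset ι) (D : ι → Set X) (sc : ι → ℤ)
    (hS : IsNestedFamily S D sc) (a k l : ι → ℤ)
    (hk : ∀ P ∈ S, ∀ Q ∈ S, D P ⊆ D Q → k P ≤ k Q) (hl : ∀ P ∈ S, ∀ Q ∈ S, D P ⊆ D Q → l Q ≤ l P)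
    {P Q : ι} (hP : P ∈ S) (hQ : Q ∈ S) (hPQ : P ≠ Q) (ha : a P = a Q) (hlPQ : l P = l Q)
    (hP1 : IsTopMember S D sc (fun P => (a P, k P, l P)) P)
    (hP2 : ¬ IsTopMember S D sc (fun P => (a P, k P)) P)
    (hQ1 : IsTopMember S D sc (fun P => (a P, k P, l P)) Q)
    (hQ2 : ¬ IsTopMember S D sc (fun P => (a P, k P)) Q) : Disjoint (D P) (D Q) := by
  by_contra hne
  have hne' : (D P ∩ D Q).Nonempty := Set.not_disjoint_iff_nonempty_inter.1 hne
  clear hne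
  wlog h : sc P ≤ sc Q generalizing P Q
  · exact this hQ hP hPQ.symm ha.symm hlPQ.symm hQ1 hQ2 hP1 hP2 (inter_comm _ _ ▸ hne')
      (le_of_not_ge h)
  have hsub := hS.subset P hP Q hQ h hne'
  rcases (hk P hP Q hQ hsub).eq_or_lt with hkk | hkk
  · exact hPQ (hS.inj P hP Q hQ hne' (le_antisymm h (hP1 Q hQ hsub (by simp [ha, hkk, hlPQ]))))
  · simp only [IsTopMember, not_forall, not_le] at hP2
    obtain ⟨R, hR, hPR, hRg, hRsc⟩ := hP2
    simp only [Prod.mk.injEq] at hRg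
    have hlR : l R ≠ l P := by
      intro hlR
      exact absurd (hP1 R hR hPR (by simp [hRg.1, hRg.2, hlR])) (not_le.2 hRsc)
    have hlR' : l R < l P := lt_of_le_of_ne (hl P hP R hR hPR) hlR
    obtain ⟨x, hx⟩ := hS.nonempty P hP
    rcases le_total (sc Q) (sc R) with h' | h'
    · have := hk Q hQ R hR (hS.subset Q hQ R hR h' ⟨x, hsub hx, hPR hx⟩)
      omega
    · have := hl R hR Q hQ (hS.subset R hR Q hQ h' ⟨x, hPR hx, hsub hx⟩)
      omega

/-- The largest value of `m` among the members of a nested family containing a given one. -/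
lemma exists_max_over_supersets {ι X : Type*} (S : Finset ι) (D : ι → Set X) (m : ι → ℤ) :
    ∃ l : ι → ℤ, (∀ P ∈ S, m P ≤ l P) ∧ (∀ P ∈ S, ∃ Q ∈ S, D P ⊆ D Q ∧ l P = m Q) ∧
      ∀ P ∈ S, ∀ Q ∈ S, D P ⊆ D Q → l Q ≤ l P := by
  classical
  have h : ∀ P ∈ S, ∃ Q ∈ S, D P ⊆ D Q ∧ ∀ R ∈ S, D P ⊆ D R → m R ≤ m Q := by
    intro P hP
    obtain ⟨Q, hQ, hmax⟩ := Finset.exists_max_image (S.filter (fun Q => D P ⊆ D Q)) m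
      ⟨P, Finset.mem_filter.2 ⟨hP, Subset.rfl⟩⟩
    obtain ⟨hQS, hPQ⟩ := Finset.mem_filter.1 hQ
    exact ⟨Q, hQS, hPQ, fun R hR hPR => hmax R (Finset.mem_filter.2 ⟨hR, hPR⟩)⟩
  choose! f hfS hfsub hfmax using h
  exact ⟨fun P => m (f P), fun P hP => hfmax P hP P hP Subset.rfl,
    fun P hP => ⟨f P, hfS P hP, hfsub P hP, rfl⟩,
    fun P hP Q hQ hPQ => hfmax P hP _ (hfS Q hQ) (hPQ.trans (hfsub Q hQ))⟩

open Classical in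
/-- Summation over the grades `a ≤ t`. -/
lemma sum_grades_le {ι : Type*} {ρ e c₁ c₂ H t : ℝ} (hρ : 0 < ρ) (he : 0 ≤ e) (hc₁ : 0 ≤ c₁)
    (hc₂ : 0 ≤ c₂) (hH : 0 ≤ H) (S : Finset ι) (a k : ι → ℤ) (B w : ι → ℝ) (Z : ι → Prop)
    (hB : ∀ P ∈ S, 0 ≤ B P) (hw : ∀ P ∈ S, w P ≤ 2 ^ ((k P : ℝ) + 1)) (ha : ∀ P ∈ S, (a P : ℝ) ≤ t)
    (h1 : ∀ i : ℤ, ∑ P ∈ S.filter (fun P => a P = i), B P ≤ c₁ * 2 ^ (ρ * (i : ℝ)) * H)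
    (h2 : ∀ i : ℤ, ∑ P ∈ S.filter (fun P => Z P ∧ a P = i), B P ≤ H) :
    ∑ P ∈ S, (2 : ℝ) ^ ((t - a P) / 2 + a P - k P) *
        (if Z P then (max 1 (c₂ * 2 ^ (a P : ℝ))) ^ e else 1) * B P * w P ≤
      2 * H * (c₁ * (1 - (2 : ℝ) ^ (-(1 / 2 + ρ)))⁻¹ * 2 ^ (t * (1 + ρ)) +
        (1 - (2 : ℝ) ^ (-(1 / 2 : ℝ)))⁻¹ * 2 ^ t +
        c₂ ^ e * (1 - (2 : ℝ) ^ (-(1 / 2 + e)))⁻¹ * 2 ^ (t * (1 + e))) := by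
  have hgeo : ∀ c : ℝ, 0 < c → ∑ i ∈ S.image a, (2 : ℝ) ^ (c * (i : ℝ)) ≤
      (1 - (2 : ℝ) ^ (-c))⁻¹ * 2 ^ (c * t) := by
    intro c hc
    refine sum_two_rpow_le hc t _ (fun i => i) (fun i _ j _ h => h) fun i hi => ?_
    obtain ⟨P, hP, rfl⟩ := Finset.mem_image.1 hi
    exact ha P hP
  have hM : ∀ i : ℤ, (max 1 (c₂ * 2 ^ (i : ℝ))) ^ e ≤ 1 + c₂ ^ e * (2 : ℝ) ^ (e * (i : ℝ)) := by
    intro i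
    have h3 : (c₂ * 2 ^ (i : ℝ)) ^ e = c₂ ^ e * (2 : ℝ) ^ (e * (i : ℝ)) := by
      rw [Real.mul_rpow hc₂ (by positivity), ← Real.rpow_mul (by norm_num), mul_comm e]
    have h4 : 0 ≤ c₂ ^ e * (2 : ℝ) ^ (e * (i : ℝ)) := by positivity
    rcases max_choice 1 (c₂ * 2 ^ (i : ℝ)) with h | h <;> rw [h]
    · rw [Real.one_rpow]; linarith
    · rw [h3]; linarith
  have hM0 : ∀ i : ℤ, 0 ≤ (max 1 (c₂ * 2 ^ (i : ℝ))) ^ e := fun i =>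
    Real.rpow_nonneg (le_max_of_le_left one_pos.le) _
  set N : ι → ℝ := fun P => if Z P then (max 1 (c₂ * 2 ^ (a P : ℝ))) ^ e else 1 with hN
  have hN0 : ∀ P, 0 ≤ N P := by
    intro P
    simp only [hN]
    split_ifs
    · exact hM0 _
    · exact one_pos.le
  calc ∑ P ∈ S, (2 : ℝ) ^ ((t - a P) / 2 + a P - k P) * N P * B P * w P
      ≤ ∑ P ∈ S, 2 * 2 ^ (t / 2) * (2 ^ ((1 / 2 : ℝ) * a P) * (N P * B P)) := by
        refine Finset.sum_le_sum fun P hP => ?_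
        calc _ ≤ (2 : ℝ) ^ ((t - a P) / 2 + a P - k P) * N P * B P * 2 ^ ((k P : ℝ) + 1) := by
              have := hB P hP
              have := hN0 P
              gcongr
              exact hw P hP
          _ = ((2 : ℝ) ^ ((t - a P) / 2 + a P - k P) * 2 ^ ((k P : ℝ) + 1)) * (N P * B P) := by ring
          _ = _ := by
              have : (2 : ℝ) ^ ((t - a P) / 2 + a P - k P) * 2 ^ ((k P : ℝ) + 1) =
                  2 ^ (1 : ℝ) * 2 ^ (t / 2) * 2 ^ ((1 / 2 : ℝ) * a P) := by
                rw [← Real.rpow_add (by norm_num), ← Real.rpow_add (by norm_num),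
                  ← Real.rpow_add (by norm_num)]
                congr 1; ring
              rw [this, Real.rpow_one]; ring
    _ = 2 * 2 ^ (t / 2) * ∑ i ∈ S.image a, 2 ^ ((1 / 2 : ℝ) * i) *
          ∑ P ∈ S.filter (fun P => a P = i), N P * B P := by
        rw [← Finset.mul_sum, ← Finset.sum_fiberwise_of_maps_to
          (fun P hP => Finset.mem_image_of_mem a hP)]
        congr 1
        refine Finset.sum_congr rfl fun i _ => ?_
        rw [Finset.mul_sum]
        refine Finset.sum_congr rfl fun P hP => ?_
        rw [(Finset.mem_filter.1 hP).2]
    _ ≤ 2 * 2 ^ (t / 2) * ∑ i ∈ S.image a, 2 ^ ((1 / 2 : ℝ) * i) *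
          (c₁ * 2 ^ (ρ * (i : ℝ)) * H + (1 + c₂ ^ e * (2 : ℝ) ^ (e * (i : ℝ))) * H) := by
        gcongr with i hi
        calc ∑ P ∈ S.filter (fun P => a P = i), N P * B P
            ≤ ∑ P ∈ S.filter (fun P => a P = i), (B P +
                if Z P then (max 1 (c₂ * 2 ^ (i : ℝ))) ^ e * B P else 0) := by
              refine Finset.sum_le_sum fun P hP => ?_
              obtain ⟨hPS, rfl⟩ := Finset.mem_filter.1 hP
              have := hB P hPS
              simp only [hN]
              split_ifs <;> linarith
          _ = ∑ P ∈ S.filter (fun P => a P = i), B P + (max 1 (c₂ * 2 ^ (i : ℝ))) ^ e *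
                ∑ P ∈ S.filter (fun P => Z P ∧ a P = i), B P := by
              rw [Finset.sum_add_distrib, ← Finset.sum_filter, Finset.filter_filter,
                ← Finset.mul_sum]
              simp only [and_comm]
          _ ≤ _ := by
              have := hM i
              have h5 := h2 i
              have h6 : 0 ≤ ∑ P ∈ S.filter (fun P => Z P ∧ a P = i), B P :=
                Finset.sum_nonneg fun P hP => hB P (Finset.mem_filter.1 hP).1
              gcongr
              exact h1 i
    _ = 2 * H * 2 ^ (t / 2) * (c₁ * ∑ i ∈ S.image a, (2 : ℝ) ^ ((1 / 2 + ρ) * (i : ℝ)) +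
          ∑ i ∈ S.image a, (2 : ℝ) ^ ((1 / 2 : ℝ) * (i : ℝ)) +
          c₂ ^ e * ∑ i ∈ S.image a, (2 : ℝ) ^ ((1 / 2 + e) * (i : ℝ))) := by
        simp only [add_mul (1 / 2 : ℝ), Real.rpow_add two_pos, Finset.mul_sum,
          ← Finset.sum_add_distrib]
        refine Finset.sum_congr rfl fun i _ => ?_
        ring
    _ ≤ 2 * H * 2 ^ (t / 2) * (c₁ * ((1 - (2 : ℝ) ^ (-(1 / 2 + ρ)))⁻¹ * 2 ^ ((1 / 2 + ρ) * t)) +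
          (1 - (2 : ℝ) ^ (-(1 / 2 : ℝ)))⁻¹ * 2 ^ ((1 / 2 : ℝ) * t) +
          c₂ ^ e * ((1 - (2 : ℝ) ^ (-(1 / 2 + e)))⁻¹ * 2 ^ ((1 / 2 + e) * t))) := by
        gcongr
        · exact hgeo _ (by positivity)
        · exact hgeo _ (by norm_num)
        · exact hgeo _ (by positivity)
    _ = _ := by
        have e1 : (2 : ℝ) ^ (t * (1 + ρ)) = 2 ^ (t / 2) * 2 ^ ((1 / 2 + ρ) * t) := by
          rw [← Real.rpow_add (by norm_num)]; congr 1; ring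
        have e2 : (2 : ℝ) ^ t = 2 ^ (t / 2) * 2 ^ ((1 / 2 : ℝ) * t) := by
          rw [← Real.rpow_add (by norm_num)]; congr 1; ring
        have e3 : (2 : ℝ) ^ (t * (1 + e)) = 2 ^ (t / 2) * 2 ^ ((1 / 2 + e) * t) := by
          rw [← Real.rpow_add (by norm_num)]; congr 1; ring
        rw [e1, e2, e3]; ring

/-- Nested members with disjoint massive portions through a common point are few. -/
lemma card_mul_le_of_nested {ι X : Type*} [MeasurableSpace X] (W : Measure X) (T : Finset ι)
    (D E : ι → Set X) (sc : ι → ℤ) (hT : IsNestedFamily T D sc) (x : X) (hx : ∀ P ∈ T, x ∈ D P)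
    (hE : ∀ P ∈ T, MeasurableSet (E P)) (hED : ∀ P ∈ T, E P ⊆ D P)
    (hdisj : ∀ P ∈ T, ∀ Q ∈ T, P ≠ Q → Disjoint (E P) (E Q)) {c c' : ℝ≥0∞}
    (hc : ∀ P ∈ T, c ≤ W (E P)) (hc' : ∀ P ∈ T, W (D P) ≤ c') : T.card * c ≤ c' := by
  rcases T.eq_empty_or_nonempty with rfl | hne
  · simp
  obtain ⟨P₀, hP₀, hmax⟩ := Finset.exists_max_image T sc hne
  calc T.card * c = ∑ _P ∈ T, c := by rw [Finset.sum_const, nsmul_eq_mul]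
    _ ≤ ∑ P ∈ T, W (E P) := Finset.sum_le_sum hc
    _ = W (⋃ P ∈ T, E P) :=
        (measure_biUnion_finset (fun P hP Q hQ hPQ => hdisj P hP Q hQ hPQ) hE).symm
    _ ≤ W (D P₀) := measure_mono (iUnion₂_subset fun P hP =>
        (hED P hP).trans (hT.subset P hP P₀ hP₀ (hmax P hP) ⟨x, hx P hP, hx P₀ hP₀⟩))
    _ ≤ c' := hc' P₀ hP₀

lemma two_rpow_logb {x : ℝ} (hx : 0 < x) : (2 : ℝ) ^ Real.logb 2 x = x :=
  Real.rpow_logb (by norm_num) (by norm_num) hx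

set_option maxHeartbeats 1000000 in
/-- The main estimate for finite nested families, when all integrals are nonzero. -/
lemma lintegral_square_function_le_of_ne_zero {ι X : Type*} [MeasurableSpace X] {p q α β d η e : ℝ} (hp : 1 < p) (hpq : p < q)
    (hβ : 0 < β) (hαβ : α * q = 1 + β) (hd : 0 < d) (hη : 0 < η)
    (hβq : β = q - q / p) (he1 : 1 + 1 / β ≤ e) (he2 : 1 + q / 2 * max (1 - 2 / p) 0 ≤ e) :
    ∃ C : ℝ, 0 < C ∧ ∀ (σ W : Measure X) (S : Finset ι)
      (D E : ι → Set X) (sc : ι → ℤ) (u : X → ℝ≥0∞) (A : ℝ), IsNestedFamily S D sc →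
      (∀ P ∈ S, MeasurableSet (D P)) → (∀ P ∈ S, MeasurableSet (E P)) → (∀ P ∈ S, E P ⊆ D P) →
      (∀ P ∈ S, ∀ Q ∈ S, P ≠ Q → Disjoint (E P) (E Q)) →
      (∀ P ∈ S, σ (D P) ≠ 0) → (∀ P ∈ S, σ (D P) ≠ ∞) →
      (∀ P ∈ S, W (D P) ≠ 0) → (∀ P ∈ S, W (D P) ≠ ∞) →
      (∀ P ∈ S, ENNReal.ofReal (η * 2 ^ (d * sc P)) ^ (1 + β) ≤ W (E P) * σ (E P) ^ β) →
      (∀ P ∈ S, W (D P) * σ (D P) ^ β ≤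
        ENNReal.ofReal A * ENNReal.ofReal (2 ^ (d * sc P)) ^ (1 + β)) →
      1 ≤ A → Measurable u → (∫⁻ x, u x ^ p ∂σ) ≠ ∞ → (∫⁻ x, u x ^ p ∂σ) ≠ 0 →
      (∀ P ∈ S, ∫⁻ x in D P, u x ∂σ ≠ 0) → (∀ P ∈ S, ∫⁻ x in D P, u x ∂σ ≠ ∞) →
      ∫⁻ x, (∑ P ∈ S, (D P).indicator (fun _ =>
          (ENNReal.ofReal (2 ^ (d * sc P)) ^ (-α) * ∫⁻ y in D P, u y ∂σ) ^ (2 : ℝ)) x) ^ (q / 2) ∂W ≤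
        ENNReal.ofReal C * ENNReal.ofReal A ^ e * (∫⁻ x, u x ^ p ∂σ) ^ (q / p) := by
  classical
  have hp0 : 0 < p := by linarith
  have hq0 : 0 < q := by linarith
  have hp1 : 0 < p - 1 := by linarith
  obtain ⟨lη, hlη⟩ := exists_two_rpow_eq hη
  set e₀ := q / 2 * max (1 - 2 / p) 0 with he₀
  have he₀0 : 0 ≤ e₀ := mul_nonneg (by positivity) (le_max_right _ _)
  set C₀ : ℝ := 2 * ((1 - (2 : ℝ) ^ (-(p - 1)))⁻¹ * 2 ^ (p - 1)) with hC₀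
  have hC₀pos : 0 < C₀ := by
    have := inv_one_sub_two_rpow_pos hp1
    positivity
  set c₁ : ℝ := 2 ^ ((1 - (1 + β) * lη) / β) with hc₁
  set c₂ : ℝ := 2 ^ (2 - (1 + β) * lη) with hc₂
  obtain ⟨C₁, hC₁, hpt⟩ := pointwise_bound (ι := ι) (X := X) hp hpq
    (show (0 : ℝ) < 2 ^ (2 / β) by positivity) (show 0 < d * (1 + β) / β by positivity)
  set G : ℝ := c₁ * (1 - (2 : ℝ) ^ (-(1 / 2 + 1 / β)))⁻¹ + (1 - (2 : ℝ) ^ (-(1 / 2 : ℝ)))⁻¹ +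
    c₂ ^ e₀ * (1 - (2 : ℝ) ^ (-(1 / 2 + e₀)))⁻¹ with hG
  have hGpos : 0 < G := by
    have h1 := inv_one_sub_two_rpow_pos (show 0 < 1 / 2 + 1 / β by positivity)
    have h2 := inv_one_sub_two_rpow_pos (show (0 : ℝ) < 1 / 2 by norm_num)
    have h3 := inv_one_sub_two_rpow_pos (show 0 < 1 / 2 + e₀ by positivity)
    positivity
  set c₀ : ℝ := 2 ^ (2 + 2 / q) with hc₀
  refine ⟨c₀ ^ (q / 2) * C₁ * (2 * C₀ ^ (q / p) * G), by positivity, ?_⟩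
  intro σ W S D E sc u A hS hD hE hED hEdisj hσ0 hσ hW0 hW hlow hupp hA hu hU hU0 hy0 hy
  have hA0 : 0 < A := by linarith
  set t := Real.logb 2 A with ht
  have hAt : A = 2 ^ t := (two_rpow_logb hA0).symm
  have ht0 : 0 ≤ t := Real.logb_nonneg (by norm_num) hA
  set U := (∫⁻ x, u x ^ p ∂σ).toReal with hUd
  have hUpos : 0 < U := ENNReal.toReal_pos hU0 hU
  have hUof : ∫⁻ x, u x ^ p ∂σ = ENNReal.ofReal U := (ENNReal.ofReal_toReal hU).symm
  set H := C₀ * U with hH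
  have hHpos : 0 < H := by positivity
  set s : ι → ℝ := fun P => (σ (D P)).toReal with hs
  set w : ι → ℝ := fun P => (W (D P)).toReal with hw
  set y : ι → ℝ := fun P => (∫⁻ x in D P, u x ∂σ).toReal with hyd
  have hspos : ∀ P ∈ S, 0 < s P := fun P hP => ENNReal.toReal_pos (hσ0 P hP) (hσ P hP)
  have hwpos : ∀ P ∈ S, 0 < w P := fun P hP => ENNReal.toReal_pos (hW0 P hP) (hW P hP)
  have hypos : ∀ P ∈ S, 0 < y P := fun P hP => ENNReal.toReal_pos (hy0 P hP) (hy P hP)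
  have hsof : ∀ P ∈ S, σ (D P) = ENNReal.ofReal (s P) := fun P hP =>
    (ENNReal.ofReal_toReal (hσ P hP)).symm
  have hwof : ∀ P ∈ S, W (D P) = ENNReal.ofReal (w P) := fun P hP =>
    (ENNReal.ofReal_toReal (hW P hP)).symm
  have hyof : ∀ P ∈ S, ∫⁻ x in D P, u x ∂σ = ENNReal.ofReal (y P) := fun P hP =>
    (ENNReal.ofReal_toReal (hy P hP)).symm
  set ls : ι → ℝ := fun P => Real.logb 2 (s P) with hls
  set lw : ι → ℝ := fun P => Real.logb 2 (w P) with hlw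
  set ly : ι → ℝ := fun P => Real.logb 2 (y P) with hly
  have hs2 : ∀ P ∈ S, s P = 2 ^ ls P := fun P hP => (two_rpow_logb (hspos P hP)).symm
  have hw2 : ∀ P ∈ S, w P = 2 ^ lw P := fun P hP => (two_rpow_logb (hwpos P hP)).symm
  have hy2 : ∀ P ∈ S, y P = 2 ^ ly P := fun P hP => (two_rpow_logb (hypos P hP)).symm
  -- the masses of the portions `E P`
  have hEmass : ∀ P ∈ S, ∃ lwE lsE : ℝ, W (E P) = ENNReal.ofReal (2 ^ lwE) ∧
      (σ (E P)).toReal = 2 ^ lsE ∧ lwE ≤ lw P ∧ lsE ≤ ls P ∧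
      (1 + β) * (lη + d * sc P) ≤ lwE + β * lsE := by
    intro P hP
    have hWE : W (E P) ≠ ∞ := ne_top_of_le_ne_top (hW P hP) (measure_mono (hED P hP))
    have hσE : σ (E P) ≠ ∞ := ne_top_of_le_ne_top (hσ P hP) (measure_mono (hED P hP))
    have h1 := hlow P hP
    have hl : (ENNReal.ofReal (η * 2 ^ (d * sc P))) ^ (1 + β) =
        ENNReal.ofReal (2 ^ ((1 + β) * (lη + d * sc P))) := by
      rw [hlη, ← Real.rpow_add (by norm_num), ENNReal.ofReal_rpow_of_pos (by positivity),
        ← Real.rpow_mul (by norm_num), mul_comm (1 + β)]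
    rw [hl] at h1
    have hpos : 0 < W (E P) * σ (E P) ^ β :=
      lt_of_lt_of_le (ENNReal.ofReal_pos.2 (by positivity)) h1
    have hWE0 : W (E P) ≠ 0 := fun h => by simp [h] at hpos
    have hσE0 : σ (E P) ≠ 0 := fun h => by simp [h, ENNReal.zero_rpow_of_pos hβ] at hpos
    have hWp := ENNReal.toReal_pos hWE0 hWE
    have hσp := ENNReal.toReal_pos hσE0 hσE
    refine ⟨Real.logb 2 (W (E P)).toReal, Real.logb 2 (σ (E P)).toReal, ?_, ?_, ?_, ?_, ?_⟩
    · rw [two_rpow_logb hWp, ENNReal.ofReal_toReal hWE]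
    · rw [two_rpow_logb hσp]
    · exact Real.logb_le_logb_of_le (by norm_num) hWp
        (ENNReal.toReal_mono (hW P hP) (measure_mono (hED P hP)))
    · exact Real.logb_le_logb_of_le (by norm_num) hσp
        (ENNReal.toReal_mono (hσ P hP) (measure_mono (hED P hP)))
    · rw [← ENNReal.ofReal_toReal hWE, ← ENNReal.ofReal_toReal hσE, ← two_rpow_logb hWp,
        ← two_rpow_logb hσp, ENNReal.ofReal_rpow_of_pos (by positivity),
        ← ENNReal.ofReal_mul (by positivity), ← Real.rpow_mul (by norm_num),
        ← Real.rpow_add (by norm_num), ENNReal.ofReal_le_ofReal_iff (by positivity),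
        Real.rpow_le_rpow_left_iff (by norm_num)] at h1
      linarith
  -- the grades
  set a : ι → ℤ := fun P => ⌊lw P + β * ls P - (1 + β) * (d * sc P)⌋ with ha
  set k : ι → ℤ := fun P => ⌊lw P⌋ with hk
  obtain ⟨l, hml, hlsup, hlanti⟩ := exists_max_over_supersets S D (fun P => ⌊ly P - ls P⌋)
  have ha1 : ∀ P, (a P : ℝ) ≤ lw P + β * ls P - (1 + β) * (d * sc P) := fun P => Int.floor_le _
  have ha2 : ∀ P, lw P + β * ls P - (1 + β) * (d * sc P) < a P + 1 := fun P =>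
    Int.lt_floor_add_one _
  have hk1 : ∀ P, (k P : ℝ) ≤ lw P := fun P => Int.floor_le _
  have hk2 : ∀ P, lw P < k P + 1 := fun P => Int.lt_floor_add_one _
  have hl2 : ∀ P ∈ S, ly P - ls P < l P + 1 := by
    intro P hP
    refine (Int.lt_floor_add_one _).trans_le ?_
    have := hml P hP
    gcongr
  have hat : ∀ P ∈ S, (a P : ℝ) ≤ t := by
    intro P hP
    refine (ha1 P).trans ?_
    have h1 := hupp P hP
    rw [hsof P hP, hwof P hP, hs2 P hP, hw2 P hP, hAt, ENNReal.ofReal_rpow_of_pos (by positivity),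
      ENNReal.ofReal_rpow_of_pos (by positivity), ← ENNReal.ofReal_mul (by positivity),
      ← ENNReal.ofReal_mul (by positivity), ← Real.rpow_mul (by norm_num),
      ← Real.rpow_mul (by norm_num), ← Real.rpow_add (by norm_num), ← Real.rpow_add (by norm_num),
      ENNReal.ofReal_le_ofReal_iff (by positivity), Real.rpow_le_rpow_left_iff (by norm_num)] at h1
    linarith
  have hkmono : ∀ P ∈ S, ∀ Q ∈ S, D P ⊆ D Q → k P ≤ k Q := fun P hP Q hQ h =>
    Int.floor_le_floor (Real.logb_le_logb_of_le (by norm_num) (hwpos P hP)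
      (ENNReal.toReal_mono (hW Q hQ) (measure_mono h)))
  set b : ι → ℝ := fun P => 2 ^ (l P : ℝ) * s P ^ (1 / p) with hb
  have hbpos : ∀ P ∈ S, 0 < b P := by
    intro P hP
    have := hspos P hP
    simp only [hb]
    positivity
  have hbp : ∀ P ∈ S, b P ^ p = 2 ^ ((l P : ℝ) * p) * s P := by
    intro P hP
    have := hspos P hP
    simp only [hb]
    rw [Real.mul_rpow (by positivity) (by positivity), ← Real.rpow_mul (by norm_num),
      ← Real.rpow_mul this.le, one_div_mul_cancel hp0.ne', Real.rpow_one]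
  have hkey : ∀ (T : Finset ι), T ⊆ S → ∀ F : ι → Set X, (∀ P ∈ T, MeasurableSet (F P)) →
      (∀ P ∈ T, F P ⊆ D P) → (∀ P ∈ T, ∀ Q ∈ T, P ≠ Q → l P = l Q → Disjoint (F P) (F Q)) →
      ∑ P ∈ T, (2 : ℝ) ^ ((l P : ℝ) * p) * (σ (F P)).toReal ≤ H := by
    intro T hT F hF hFD hFdisj
    have h1 := sum_two_rpow_mul_measure_le hp σ S D sc hS hD hσ u hu l ?_ T hT F hF hFD hFdisj
    · have h2 : ∑ P ∈ T, (2 : ℝ≥0∞) ^ ((l P : ℝ) * p) * σ (F P) =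
          ENNReal.ofReal (∑ P ∈ T, (2 : ℝ) ^ ((l P : ℝ) * p) * (σ (F P)).toReal) := by
        rw [ENNReal.ofReal_sum_of_nonneg fun P _ => by positivity]
        refine Finset.sum_congr rfl fun P hP => ?_
        rw [ENNReal.ofReal_mul (by positivity), ← ENNReal.ofReal_rpow_of_pos (by norm_num),
          ENNReal.ofReal_toReal (ne_top_of_le_ne_top (hσ P (hT hP)) (measure_mono (hFD P hP)))]
        norm_num
      rw [h2, hUof, ← ENNReal.ofReal_mul hC₀pos.le,
        ENNReal.ofReal_le_ofReal_iff (by positivity)] at h1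
      exact h1
    · intro P hP
      obtain ⟨Q, hQ, hPQ, hlQ⟩ := hlsup P hP
      refine ⟨Q, hQ, hPQ, ?_⟩
      have h2 : (l P : ℝ) ≤ ly Q - ls Q := by rw [hlQ]; exact Int.floor_le _
      have h3 : (2 : ℝ≥0∞) ^ (l P : ℝ) = ENNReal.ofReal (2 ^ (l P : ℝ)) := by
        rw [← ENNReal.ofReal_rpow_of_pos (by norm_num)]; norm_num
      rw [hsof Q hQ, hyof Q hQ, h3, ← ENNReal.ofReal_mul (by positivity), hs2 Q hQ, hy2 Q hQ,
        ← Real.rpow_add (by norm_num)]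
      refine ENNReal.ofReal_le_ofReal (Real.rpow_le_rpow_of_exponent_le (by norm_num) (by linarith))
  have hbH : ∀ P ∈ S, b P ^ p ≤ H := by
    intro P hP
    have := hkey {P} (Finset.singleton_subset_iff.2 hP) D
      (fun Q hQ => hD Q (Finset.mem_singleton.1 hQ ▸ hP)) (fun _ _ => Subset.rfl)
      (fun Q hQ R hR hQR => absurd
        ((Finset.mem_singleton.1 hQ).trans (Finset.mem_singleton.1 hR).symm) hQR)
    rw [Finset.sum_singleton] at this
    rw [hbp P hP]
    exact this
  have hsum1 : ∀ i : ℤ, ∑ P ∈ S.filter (fun P => a P = i), b P ^ p ≤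
      c₁ * 2 ^ (1 / β * (i : ℝ)) * H := by
    intro i
    have h1 := hkey (S.filter (fun P => a P = i)) (Finset.filter_subset _ _) E
      (fun P hP => hE P (Finset.mem_filter.1 hP).1) (fun P hP => hED P (Finset.mem_filter.1 hP).1)
      (fun P hP Q hQ hPQ _ => hEdisj P (Finset.mem_filter.1 hP).1 Q (Finset.mem_filter.1 hQ).1 hPQ)
    refine le_trans ?_ (mul_le_mul_of_nonneg_left h1 (by positivity))
    rw [Finset.mul_sum]
    refine Finset.sum_le_sum fun P hP => ?_
    obtain ⟨hPS, rfl⟩ := Finset.mem_filter.1 hP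
    obtain ⟨lwE, lsE, -, h3, h4, -, h6⟩ := hEmass P hPS
    rw [hbp P hPS, h3, hs2 P hPS, hc₁, ← Real.rpow_add (by norm_num), ← Real.rpow_add (by norm_num),
      ← Real.rpow_add (by norm_num), ← Real.rpow_add (by norm_num),
      Real.rpow_le_rpow_left_iff (by norm_num)]
    have h7 := ha2 P
    have h8 : ls P ≤ (1 - (1 + β) * lη) / β + 1 / β * a P + lsE := by
      have : (1 - (1 + β) * lη) / β + 1 / β * a P + lsE =
          (1 - (1 + β) * lη + a P + β * lsE) / β := by field_simp
      rw [this, le_div_iff₀ hβ]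
      linarith
    linarith
  have hsum2 : ∀ i : ℤ, ∑ P ∈ S.filter (fun P =>
      IsTopMember S D sc (fun P => (a P, k P, l P)) P ∧
        ¬ IsTopMember S D sc (fun P => (a P, k P)) P ∧ a P = i), b P ^ p ≤ H := by
    intro i
    refine le_of_eq_of_le (Finset.sum_congr rfl fun P hP => hbp P (Finset.mem_filter.1 hP).1)
      (hkey _ (Finset.filter_subset _ _) D (fun P hP => hD P (Finset.mem_filter.1 hP).1)
        (fun _ _ => Subset.rfl) ?_)
    intro P hP Q hQ hPQ hlPQ
    obtain ⟨hPS, hP1, hP2, hPi⟩ := Finset.mem_filter.1 hP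
    obtain ⟨hQS, hQ1, hQ2, hQi⟩ := Finset.mem_filter.1 hQ
    exact disjoint_of_isTopMember S D sc hS a k l hkmono hlanti hPS hQS hPQ (hPi.trans hQi.symm)
      hlPQ hP1 hP2 hQ1 hQ2
  have hcard : ∀ x i j, ((S.filter (fun P => x ∈ D P ∧ a P = i ∧ k P = j)).card : ℝ) ≤
      max 1 (c₂ * 2 ^ (i : ℝ)) := by
    intro x i j
    refine le_max_of_le_right ?_
    set T := S.filter (fun P => x ∈ D P ∧ a P = i ∧ k P = j) with hT
    have hTS : ∀ P ∈ T, P ∈ S := fun P hP => (Finset.mem_filter.1 hP).1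
    have h1 := card_mul_le_of_nested W T D E sc
      ⟨fun P hP Q hQ => hS.subset P (hTS P hP) Q (hTS Q hQ),
        fun P hP Q hQ => hS.inj P (hTS P hP) Q (hTS Q hQ), fun P hP => hS.nonempty P (hTS P hP)⟩ x
      (fun P hP => (Finset.mem_filter.1 hP).2.1) (fun P hP => hE P (hTS P hP))
      (fun P hP => hED P (hTS P hP))
      (fun P hP Q hQ hPQ => hEdisj P (hTS P hP) Q (hTS Q hQ) hPQ)
      (c := ENNReal.ofReal (2 ^ ((1 + β) * lη + j - i - 1))) (c' := ENNReal.ofReal (2 ^ ((j : ℝ) + 1)))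
      (by
        intro P hP
        obtain ⟨hPS, -, rfl, rfl⟩ := Finset.mem_filter.1 hP
        obtain ⟨lwE, lsE, h2, -, -, h5, h6⟩ := hEmass P hPS
        rw [h2]
        refine ENNReal.ofReal_le_ofReal (Real.rpow_le_rpow_of_exponent_le (by norm_num) ?_)
        have := ha2 P
        have := hk1 P
        have := mul_le_mul_of_nonneg_left h5 hβ.le
        linarith)
      (by
        intro P hP
        obtain ⟨hPS, -, rfl, rfl⟩ := Finset.mem_filter.1 hP
        rw [hwof P hPS, hw2 P hPS]
        exact ENNReal.ofReal_le_ofReal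
          (Real.rpow_le_rpow_of_exponent_le (by norm_num) (hk2 P).le))
    rw [← ENNReal.ofReal_natCast, ← ENNReal.ofReal_mul (Nat.cast_nonneg _),
      ENNReal.ofReal_le_ofReal_iff (by positivity)] at h1
    have h2 : (2 : ℝ) ^ ((j : ℝ) + 1) = c₂ * 2 ^ (i : ℝ) * 2 ^ ((1 + β) * lη + j - i - 1) := by
      rw [hc₂, ← Real.rpow_add (by norm_num), ← Real.rpow_add (by norm_num)]
      congr 1; ring
    rw [h2] at h1
    exact le_of_mul_le_mul_right h1 (by positivity)
  have hdecay : ∀ P ∈ S, ∀ Q ∈ S, D Q ⊆ D P → a Q = a P → k Q = k P → sc Q ≤ sc P →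
      s Q ≤ 2 ^ (2 / β) * 2 ^ (d * (1 + β) / β * ((sc Q : ℝ) - sc P)) * s P := by
    intro P hP Q hQ _ haQ hkQ _
    rw [hs2 P hP, hs2 Q hQ, ← Real.rpow_add (by norm_num), ← Real.rpow_add (by norm_num),
      Real.rpow_le_rpow_left_iff (by norm_num)]
    have h1 := ha1 Q
    have h2 := ha2 Q
    have h3 := ha1 P
    have h4 := ha2 P
    have h5 := hk1 Q
    have h6 := hk2 Q
    have h7 := hk1 P
    have h8 := hk2 P
    rw [haQ] at h1 h2
    rw [hkQ] at h5 h6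
    have : 2 / β + d * (1 + β) / β * ((sc Q : ℝ) - sc P) + ls P =
        (2 + d * (1 + β) * ((sc Q : ℝ) - sc P) + β * ls P) / β := by 
      field_simp
    rw [this, le_div_iff₀ hβ]
    linarith
  have hterm : ∀ P ∈ S, ((2 : ℝ) ^ (d * sc P)) ^ (-α) * y P ≤
      2 ^ (1 + 1 / q) * (2 ^ (1 / q * ((a P : ℝ) - k P)) * b P) := by
    intro P hP
    have h1 : b P = 2 ^ ((l P : ℝ) + ls P * (1 / p)) := by
      simp only [hb]
      rw [hs2 P hP, ← Real.rpow_mul (by norm_num), ← Real.rpow_add (by norm_num)]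
    rw [h1, hy2 P hP, ← Real.rpow_mul (by norm_num), ← Real.rpow_add (by norm_num),
      ← Real.rpow_add (by norm_num), ← Real.rpow_add (by norm_num),
      Real.rpow_le_rpow_left_iff (by norm_num)]
    have h2 := hl2 P hP
    have h3 : β * ls P - (1 + β) * (d * sc P) - 1 ≤ (a P : ℝ) - k P := by
      have := ha2 P
      have := hk1 P
      linarith
    have h4 := mul_le_mul_of_nonneg_left h3 (show 0 ≤ 1 / q by positivity)
    have h5 : 1 / q * (β * ls P - (1 + β) * (d * sc P) - 1) =
        (1 - 1 / p) * ls P - α * (d * sc P) - 1 / q := by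
      have h6 : 1 / q * (1 + β) = α := by rw [← hαβ]; field_simp
      have h7 : 1 / q * β = 1 - 1 / p := by rw [hβq]; field_simp
      linear_combination ls P * h7 - d * sc P * h6
    linarith
  have hptx := hpt S D sc hS a k l s b (fun i => max 1 (c₂ * 2 ^ (i : ℝ))) H t hspos
    (fun P _ => rfl) hdecay hHpos (fun i => le_max_left _ _) hat hcard hbH hsum2
  set N : ι → ℝ := fun P => if IsTopMember S D sc (fun P => (a P, k P, l P)) P ∧
    ¬ IsTopMember S D sc (fun P => (a P, k P)) P then (max 1 (c₂ * 2 ^ (a P : ℝ))) ^ e₀ else 1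
    with hN
  have hN0 : ∀ P, 0 ≤ N P := by
    intro P
    simp only [hN]
    split_ifs
    · exact Real.rpow_nonneg (le_max_of_le_left one_pos.le) _
    · exact one_pos.le
  set θ : ι → ℝ := fun P => (2 : ℝ) ^ ((t - a P) / 2 + a P - k P) * N P * H ^ (q / p - 1) * b P ^ p
    with hθ
  have hθ0 : ∀ P ∈ S, 0 ≤ θ P := by
    intro P hP
    have := hbpos P hP
    have := hN0 P
    simp only [hθ]
    positivity
  have hsum : ∑ P ∈ S, θ P * w P ≤ 2 * C₀ ^ (q / p) * G * A ^ e * U ^ (q / p) := by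
    have h1 := sum_grades_le (show 0 < 1 / β by positivity) he₀0 (show 0 ≤ c₁ by positivity)
      (show 0 ≤ c₂ by positivity) hHpos.le S a k (fun P => b P ^ p) w
      (fun P => IsTopMember S D sc (fun P => (a P, k P, l P)) P ∧
        ¬ IsTopMember S D sc (fun P => (a P, k P)) P)
      (fun P hP => Real.rpow_nonneg (hbpos P hP).le _)
      (fun P hP => by
        rw [hw2 P hP]
        exact Real.rpow_le_rpow_of_exponent_le (by norm_num) (hk2 P).le)
      hat hsum1 (fun i => by simpa only [and_assoc] using hsum2 i)
    have hAe : A ^ e = 2 ^ (t * e) := by rw [hAt, ← Real.rpow_mul (by norm_num)]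
    have hexp : ∀ r : ℝ, r ≤ e → (2 : ℝ) ^ (t * r) ≤ A ^ e := by
      intro r hr
      rw [hAe]
      exact Real.rpow_le_rpow_of_exponent_le (by norm_num) (mul_le_mul_of_nonneg_left hr ht0)
    have hG1 := inv_one_sub_two_rpow_pos (show 0 < 1 / 2 + 1 / β by positivity)
    have hG2 := inv_one_sub_two_rpow_pos (show (0 : ℝ) < 1 / 2 by norm_num)
    have hG3 := inv_one_sub_two_rpow_pos (show 0 < 1 / 2 + e₀ by positivity)
    calc ∑ P ∈ S, θ P * w P = H ^ (q / p - 1) *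
          ∑ P ∈ S, (2 : ℝ) ^ ((t - a P) / 2 + a P - k P) * N P * b P ^ p * w P := by
          rw [Finset.mul_sum]
          refine Finset.sum_congr rfl fun P _ => ?_
          simp only [hθ]; ring
      _ ≤ H ^ (q / p - 1) * (2 * H * (c₁ * (1 - (2 : ℝ) ^ (-(1 / 2 + 1 / β)))⁻¹ *
            2 ^ (t * (1 + 1 / β)) + (1 - (2 : ℝ) ^ (-(1 / 2 : ℝ)))⁻¹ * 2 ^ t +
            c₂ ^ e₀ * (1 - (2 : ℝ) ^ (-(1 / 2 + e₀)))⁻¹ * 2 ^ (t * (1 + e₀)))) := by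
          refine mul_le_mul_of_nonneg_left (le_of_eq_of_le ?_ h1) (by positivity)
          congr!
      _ ≤ H ^ (q / p - 1) * (2 * H * (c₁ * (1 - (2 : ℝ) ^ (-(1 / 2 + 1 / β)))⁻¹ *
            A ^ e + (1 - (2 : ℝ) ^ (-(1 / 2 : ℝ)))⁻¹ * A ^ e +
            c₂ ^ e₀ * (1 - (2 : ℝ) ^ (-(1 / 2 + e₀)))⁻¹ * A ^ e)) := by
          gcongr
          · exact hexp _ he1
          · simpa using hexp 1 (by linarith)
          · exact hexp _ he2
      _ = _ := by
          have h2 : H ^ (q / p - 1) * H = C₀ ^ (q / p) * U ^ (q / p) := by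
            rw [← Real.mul_rpow hC₀pos.le hUpos.le, ← hH]
            nth_rw 2 [← Real.rpow_one H]
            rw [← Real.rpow_add hHpos, sub_add_cancel]
          rw [hG]
          linear_combination 2 * (c₁ * (1 - (2 : ℝ) ^ (-(1 / 2 + 1 / β)))⁻¹ +
            (1 - (2 : ℝ) ^ (-(1 / 2 : ℝ)))⁻¹ + c₂ ^ e₀ * (1 - (2 : ℝ) ^ (-(1 / 2 + e₀)))⁻¹) *
            A ^ e * h2
  have hpoint : ∀ x, (∑ P ∈ S, (D P).indicator (fun _ =>
      (ENNReal.ofReal (2 ^ (d * sc P)) ^ (-α) * ∫⁻ y in D P, u y ∂σ) ^ (2 : ℝ)) x) ^ (q / 2) ≤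
      ∑ P ∈ S, (D P).indicator (fun _ => ENNReal.ofReal (c₀ ^ (q / 2) * C₁ * θ P)) x := by
    intro x
    have hc₀sq : c₀ = (2 ^ (1 + 1 / q)) ^ (2 : ℝ) := by
      rw [hc₀, ← Real.rpow_mul (by norm_num)]; congr 1; ring
    have h1 : ∀ P ∈ S, (ENNReal.ofReal (2 ^ (d * sc P)) ^ (-α) * ∫⁻ y in D P, u y ∂σ) ^ (2 : ℝ) ≤
        ENNReal.ofReal (c₀ * (2 ^ (2 / q * ((a P : ℝ) - k P)) * b P ^ (2 : ℝ))) := by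
      intro P hP
      have h2 := hypos P hP
      have h3 := hbpos P hP
      rw [hyof P hP, ENNReal.ofReal_rpow_of_pos (by positivity),
        ← ENNReal.ofReal_mul (by positivity), ENNReal.ofReal_rpow_of_pos (by positivity)]
      refine ENNReal.ofReal_le_ofReal ?_
      have h4 : (2 : ℝ) ^ (2 / q * ((a P : ℝ) - k P)) =
          (2 ^ (1 / q * ((a P : ℝ) - k P))) ^ (2 : ℝ) := by
        rw [← Real.rpow_mul (by norm_num)]; congr 1; ring
      rw [hc₀sq, h4, ← Real.mul_rpow (by positivity) h3.le,
        ← Real.mul_rpow (by positivity) (by positivity)]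
      exact Real.rpow_le_rpow (by positivity) (hterm P hP) (by norm_num)
    simp only [Set.indicator_apply]
    rw [← Finset.sum_filter, ← Finset.sum_filter]
    have h5 : ∀ P ∈ S.filter (fun P => x ∈ D P), P ∈ S := fun P hP => (Finset.mem_filter.1 hP).1
    have h6 : ∀ P ∈ S.filter (fun P => x ∈ D P),
        0 ≤ (2 : ℝ) ^ (2 / q * ((a P : ℝ) - k P)) * b P ^ (2 : ℝ) := by
      intro P hP
      have := hbpos P (h5 P hP)
      positivity
    have h7 := Finset.sum_nonneg h6
    have hc₀pos : 0 < c₀ := by positivity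
    calc _ ≤ (∑ P ∈ S.filter (fun P => x ∈ D P),
          ENNReal.ofReal (c₀ * (2 ^ (2 / q * ((a P : ℝ) - k P)) * b P ^ (2 : ℝ)))) ^ (q / 2) := by
          gcongr with P hP
          exact h1 P (h5 P hP)
      _ = ENNReal.ofReal (c₀ ^ (q / 2) * (∑ P ∈ S.filter (fun P => x ∈ D P),
          2 ^ (2 / q * ((a P : ℝ) - k P)) * b P ^ (2 : ℝ)) ^ (q / 2)) := by
          rw [← ENNReal.ofReal_sum_of_nonneg (fun P hP => mul_nonneg hc₀pos.le (h6 P hP)),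
            ← Finset.mul_sum, ENNReal.ofReal_rpow_of_nonneg (by positivity) (by positivity),
            Real.mul_rpow hc₀pos.le h7]
      _ ≤ ENNReal.ofReal (c₀ ^ (q / 2) * (C₁ * ∑ P ∈ S.filter (fun P => x ∈ D P), θ P)) := by
          refine ENNReal.ofReal_le_ofReal ?_
          gcongr
          exact hptx x
      _ = _ := by
          rw [← mul_assoc, Finset.mul_sum, ENNReal.ofReal_sum_of_nonneg]
          intro P hP
          have := hθ0 P (h5 P hP)
          positivity
  calc _ ≤ ∫⁻ x, ∑ P ∈ S,
        (D P).indicator (fun _ => ENNReal.ofReal (c₀ ^ (q / 2) * C₁ * θ P)) x ∂W :=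
        lintegral_mono hpoint
    _ = ∑ P ∈ S, ENNReal.ofReal (c₀ ^ (q / 2) * C₁ * θ P) * W (D P) := by
        rw [lintegral_finsetSum' _ fun P hP => (measurable_const.indicator (hD P hP)).aemeasurable]
        exact Finset.sum_congr rfl fun P hP => lintegral_indicator_const (hD P hP) _
    _ = ENNReal.ofReal (c₀ ^ (q / 2) * C₁ * ∑ P ∈ S, θ P * w P) := by
        have h1 : ∀ P ∈ S, 0 ≤ c₀ ^ (q / 2) * C₁ * (θ P * w P) := by
          intro P hP
          have := hθ0 P hP
          have := hwpos P hP
          positivity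
        rw [Finset.mul_sum, ENNReal.ofReal_sum_of_nonneg h1]
        refine Finset.sum_congr rfl fun P hP => ?_
        have := hθ0 P hP
        rw [hwof P hP, ← ENNReal.ofReal_mul (by positivity), mul_assoc]
    _ ≤ ENNReal.ofReal (c₀ ^ (q / 2) * C₁ * (2 * C₀ ^ (q / p) * G * A ^ e * U ^ (q / p))) := by
        refine ENNReal.ofReal_le_ofReal ?_
        gcongr
    _ = _ := by
        rw [hUof, ENNReal.ofReal_rpow_of_pos hA0, ENNReal.ofReal_rpow_of_pos hUpos,
          ← ENNReal.ofReal_mul (by positivity), ← ENNReal.ofReal_mul (by positivity)]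
        congr 1; ring

/-- The main estimate for finite nested families. -/
lemma lintegral_square_function_le {ι X : Type*} [MeasurableSpace X] {p q α β d η e : ℝ}
    (hp : 1 < p) (hpq : p < q) (hβ : 0 < β) (hαβ : α * q = 1 + β) (hd : 0 < d) (hη : 0 < η)
    (hβq : β = q - q / p) (he1 : 1 + 1 / β ≤ e) (he2 : 1 + q / 2 * max (1 - 2 / p) 0 ≤ e) :
    ∃ C : ℝ, 0 < C ∧ ∀ (σ W : Measure X) (S : Finset ι)
      (D E : ι → Set X) (sc : ι → ℤ) (u : X → ℝ≥0∞) (A : ℝ), IsNestedFamily S D sc →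
      (∀ P ∈ S, MeasurableSet (D P)) → (∀ P ∈ S, MeasurableSet (E P)) → (∀ P ∈ S, E P ⊆ D P) →
      (∀ P ∈ S, ∀ Q ∈ S, P ≠ Q → Disjoint (E P) (E Q)) →
      (∀ P ∈ S, σ (D P) ≠ 0) → (∀ P ∈ S, σ (D P) ≠ ∞) →
      (∀ P ∈ S, W (D P) ≠ 0) → (∀ P ∈ S, W (D P) ≠ ∞) →
      (∀ P ∈ S, ENNReal.ofReal (η * 2 ^ (d * sc P)) ^ (1 + β) ≤ W (E P) * σ (E P) ^ β) →
      (∀ P ∈ S, W (D P) * σ (D P) ^ β ≤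
        ENNReal.ofReal A * ENNReal.ofReal (2 ^ (d * sc P)) ^ (1 + β)) →
      1 ≤ A → Measurable u →
      ∫⁻ x, (∑ P ∈ S, (D P).indicator (fun _ =>
          (ENNReal.ofReal (2 ^ (d * sc P)) ^ (-α) * ∫⁻ y in D P, u y ∂σ) ^ (2 : ℝ)) x) ^ (q / 2) ∂W ≤
        ENNReal.ofReal C * ENNReal.ofReal A ^ e * (∫⁻ x, u x ^ p ∂σ) ^ (q / p) := by
  classical
  have hp0 : 0 < p := by linarith
  have hq0 : 0 < q := by linarith
  obtain ⟨C, hC, h⟩ := lintegral_square_function_le_of_ne_zero (ι := ι) (X := X) hp hpq hβ hαβ hd hη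
    hβq he1 he2
  refine ⟨C, hC, ?_⟩
  intro σ W S D E sc u A hS hD hE hED hEdisj hσ0 hσ hW0 hW hlow hupp hA hu
  rcases eq_or_ne (∫⁻ x, u x ^ p ∂σ) ∞ with hU | hU
  · rw [hU, ENNReal.top_rpow_of_pos (by positivity), ENNReal.mul_top]
    · exact le_top
    · refine mul_ne_zero (ENNReal.ofReal_pos.2 hC).ne' ?_
      rw [ENNReal.ofReal_rpow_of_pos (by linarith)]
      exact (ENNReal.ofReal_pos.2 (by positivity)).ne'
  set T := S.filter (fun P => ∫⁻ x in D P, u x ∂σ ≠ 0) with hT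
  have hTS : ∀ P ∈ T, P ∈ S := fun P hP => (Finset.mem_filter.1 hP).1
  have hsum : ∀ x, ∑ P ∈ S, (D P).indicator (fun _ =>
      (ENNReal.ofReal (2 ^ (d * sc P)) ^ (-α) * ∫⁻ y in D P, u y ∂σ) ^ (2 : ℝ)) x =
      ∑ P ∈ T, (D P).indicator (fun _ =>
      (ENNReal.ofReal (2 ^ (d * sc P)) ^ (-α) * ∫⁻ y in D P, u y ∂σ) ^ (2 : ℝ)) x := by
    intro x
    refine (Finset.sum_subset (Finset.filter_subset _ _) fun P hP hPT => ?_).symm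
    have h0 : ∫⁻ x in D P, u x ∂σ = 0 := by
      by_contra hne
      exact hPT (Finset.mem_filter.2 ⟨hP, hne⟩)
    rw [h0, mul_zero, ENNReal.zero_rpow_of_pos two_pos, indicator_zero]
  simp only [hsum]
  rcases T.eq_empty_or_nonempty with hTe | ⟨P₀, hP₀⟩
  · simp only [hTe, Finset.sum_empty]
    rw [ENNReal.zero_rpow_of_pos (by positivity), lintegral_zero]
    exact zero_le
  have hU0 : ∫⁻ x, u x ^ p ∂σ ≠ 0 := by
    intro h0
    rw [lintegral_eq_zero_iff (hu.pow_const p)] at h0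
    refine (Finset.mem_filter.1 hP₀).2 ?_
    rw [lintegral_eq_zero_iff hu]
    refine ae_restrict_of_ae ?_
    filter_upwards [h0] with x hx
    have hx' : u x ^ p = 0 := hx
    exact (ENNReal.rpow_eq_zero_iff_of_pos hp0).1 hx'
  have hfin : ∀ P ∈ S, ∫⁻ x in D P, u x ∂σ ≠ ∞ := by
    intro P hP
    have hle : ∀ x, u x ≤ 1 + u x ^ p := by
      intro x
      rcases le_total (u x) 1 with h1 | h1
      · exact h1.trans le_self_add
      · refine le_trans ?_ le_add_self
        nth_rw 1 [← ENNReal.rpow_one (u x)]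
        exact ENNReal.rpow_le_rpow_of_exponent_le h1 hp.le
    refine ne_top_of_le_ne_top (b := σ (D P) + ∫⁻ x, u x ^ p ∂σ)
      (ENNReal.add_ne_top.2 ⟨hσ P hP, hU⟩) ?_
    calc ∫⁻ x in D P, u x ∂σ ≤ ∫⁻ x in D P, (1 + u x ^ p) ∂σ := lintegral_mono hle
      _ = σ (D P) + ∫⁻ x in D P, u x ^ p ∂σ := by
        rw [lintegral_add_left measurable_const, setLIntegral_const, one_mul]
      _ ≤ _ := by gcongr; exact Measure.restrict_le_self
  exact h σ W T D E sc u A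
    ⟨fun P hP Q hQ => hS.subset P (hTS P hP) Q (hTS Q hQ),
      fun P hP Q hQ => hS.inj P (hTS P hP) Q (hTS Q hQ), fun P hP => hS.nonempty P (hTS P hP)⟩
    (fun P hP => hD P (hTS P hP)) (fun P hP => hE P (hTS P hP)) (fun P hP => hED P (hTS P hP))
    (fun P hP Q hQ => hEdisj P (hTS P hP) Q (hTS Q hQ)) (fun P hP => hσ0 P (hTS P hP))
    (fun P hP => hσ P (hTS P hP)) (fun P hP => hW0 P (hTS P hP)) (fun P hP => hW P (hTS P hP))
    (fun P hP => hlow P (hTS P hP)) (fun P hP => hupp P (hTS P hP)) hA hu hU hU0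
    (fun P hP => (Finset.mem_filter.1 hP).2) (fun P hP => hfin P (hTS P hP))

namespace Cube

variable {n : ℕ}

/-- The half-open cube with the same corner and side length. -/
def halfOpen (Q : Cube n) : Set (Fin n → ℝ) :=
  Set.pi univ fun i => Ico (Q.corner i) (Q.corner i + Q.side)

/-- The integer `k` with `Q.side = 2 ^ k` for a dyadic cube. -/
def scale (Q : Cube n) : ℤ := Int.log 2 Q.side

lemma mem_halfOpen {Q : Cube n} {x : Fin n → ℝ} :
    x ∈ Q.halfOpen ↔ ∀ i, Q.corner i ≤ x i ∧ x i < Q.corner i + Q.side := by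
  simp [halfOpen]

lemma carrier_eq_Icc (Q : Cube n) :
    Q.carrier = Icc Q.corner (fun i => Q.corner i + Q.side) := by
  ext x
  simp [carrier, Pi.le_def, forall_and]

lemma measurableSet_carrier (Q : Cube n) : MeasurableSet Q.carrier := by
  rw [carrier_eq_Icc]; exact measurableSet_Icc

lemma measurableSet_halfOpen (Q : Cube n) : MeasurableSet Q.halfOpen :=
  MeasurableSet.univ_pi fun _ => measurableSet_Ico

lemma halfOpen_ae_eq_carrier (Q : Cube n) : Q.halfOpen =ᵐ[volume] Q.carrier := by
  rw [carrier_eq_Icc, volume_pi]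
  exact Measure.univ_pi_Ico_ae_eq_Icc

lemma vol_pos (Q : Cube n) : 0 < Q.vol := pow_pos Q.side_pos n

lemma volume_carrier (Q : Cube n) : volume Q.carrier = ENNReal.ofReal Q.vol := by
  rw [carrier_eq_Icc, Real.volume_Icc_pi, vol]
  simp [ENNReal.ofReal_pow Q.side_pos.le]

lemma halfOpen_nonempty (Q : Cube n) : Q.halfOpen.Nonempty :=
  ⟨Q.corner, mem_halfOpen.2 fun i => ⟨le_rfl, by linarith [Q.side_pos]⟩⟩

lemma IsDyadic.side_eq {Q : Cube n} (hQ : Q.IsDyadic) : Q.side = (2 : ℝ) ^ Q.scale := by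
  obtain ⟨j, m, hs, -⟩ := hQ
  rw [scale, hs]
  have := Int.log_zpow (R := ℝ) (b := 2) one_lt_two (-j)
  push_cast at this
  rw [this]

lemma IsDyadic.vol_eq {Q : Cube n} (hQ : Q.IsDyadic) :
    Q.vol = (2 : ℝ) ^ ((n : ℝ) * (Q.scale : ℝ)) := by
  rw [vol, hQ.side_eq, mul_comm, Real.rpow_mul two_pos.le, Real.rpow_intCast, Real.rpow_natCast]

lemma IsDyadic.exists_corner {Q : Cube n} (hQ : Q.IsDyadic) :
    ∃ m : Fin n → ℤ, ∀ i, Q.corner i = (m i : ℝ) * (2 : ℝ) ^ Q.scale := by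
  have h := hQ.side_eq
  obtain ⟨j, m, hs, hm⟩ := hQ
  refine ⟨m, fun i => ?_⟩
  rw [hm i, ← h, hs]

lemma eq_of_corner_eq_of_side_eq {P Q : Cube n} (h : P.corner = Q.corner)
    (h' : P.side = Q.side) : P = Q := by
  cases P; cases Q; simp_all

lemma countable_setOf_isDyadic : {Q : Cube n | Q.IsDyadic}.Countable := by
  refine (Set.countable_range fun z : ℤ × (Fin n → ℤ) =>
    (⟨fun i => (z.2 i : ℝ) * (2 : ℝ) ^ (-z.1), (2 : ℝ) ^ (-z.1), by positivity⟩ : Cube n)).mono ?_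
  rintro Q ⟨j, m, hs, hm⟩
  exact ⟨(j, m), (eq_of_corner_eq_of_side_eq (funext hm) hs).symm⟩

lemma Icc_corner_of_inter_nonempty {P Q : Cube n} (hP : P.IsDyadic) (hQ : Q.IsDyadic)
    (hle : P.scale ≤ Q.scale) (hne : (P.halfOpen ∩ Q.halfOpen).Nonempty) (i : Fin n) :
    Q.corner i ≤ P.corner i ∧ P.corner i + P.side ≤ Q.corner i + Q.side := by
  obtain ⟨x, hxP, hxQ⟩ := hne
  obtain ⟨m, hm⟩ := hP.exists_corner
  obtain ⟨l, hl⟩ := hQ.exists_corner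
  obtain ⟨k, hk⟩ := Int.le.dest hle
  have hpos : (0 : ℝ) < 2 ^ P.scale := by positivity
  have hs : Q.side = ((2 ^ k : ℤ) : ℝ) * 2 ^ P.scale := by
    rw [hQ.side_eq, ← hk, zpow_add₀ two_ne_zero, mul_comm]
    simp
  obtain ⟨h1, h2⟩ := mem_halfOpen.1 hxP i
  obtain ⟨h3, h4⟩ := mem_halfOpen.1 hxQ i
  rw [hl, ← hQ.side_eq, hs] at h3 h4 ⊢
  rw [hm] at h1 h2 ⊢
  rw [hP.side_eq] at h2 ⊢
  set t : ℝ := 2 ^ P.scale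
  have a1 : (l i * 2 ^ k : ℤ) < m i + 1 := by
    have : (((l i * 2 ^ k : ℤ) : ℝ)) < ((m i + 1 : ℤ) : ℝ) := by
      refine lt_of_mul_lt_mul_right ?_ hpos.le
      push_cast at h3 ⊢
      nlinarith
    exact_mod_cast this
  have a2 : m i < (l i + 1) * 2 ^ k := by
    have : ((m i : ℤ) : ℝ) < (((l i + 1) * 2 ^ k : ℤ) : ℝ) := by
      refine lt_of_mul_lt_mul_right ?_ hpos.le
      push_cast at h4 ⊢
      nlinarith
    exact_mod_cast this
  have b1 : ((l i * 2 ^ k : ℤ) : ℝ) ≤ m i := by exact_mod_cast Int.lt_add_one_iff.1 a1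
  have b2 : ((m i + 1 : ℤ) : ℝ) ≤ (((l i + 1) * 2 ^ k : ℤ) : ℝ) := by
    exact_mod_cast Int.add_one_le_iff.2 a2
  have c1 := mul_le_mul_of_nonneg_right b1 hpos.le
  have c2 := mul_le_mul_of_nonneg_right b2 hpos.le
  push_cast at c1 c2 ⊢
  constructor <;> nlinarith

lemma isNestedFamily_halfOpen {S : Finset (Cube n)} (hS : ∀ Q ∈ S, Q.IsDyadic) :
    IsNestedFamily S halfOpen scale where
  subset P hP Q hQ hle hne x hx := by
    refine mem_halfOpen.2 fun i => ?_
    have h := mem_halfOpen.1 hx i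
    have h' := Icc_corner_of_inter_nonempty (hS P hP) (hS Q hQ) hle hne i
    exact ⟨h'.1.trans h.1, h.2.trans_le h'.2⟩
  inj P hP Q hQ hne heq := by
    refine eq_of_corner_eq_of_side_eq (funext fun i => le_antisymm ?_ ?_) ?_
    · exact (Icc_corner_of_inter_nonempty (hS Q hQ) (hS P hP) heq.ge
        (by rwa [inter_comm]) i).1
    · exact (Icc_corner_of_inter_nonempty (hS P hP) (hS Q hQ) heq.le hne i).1
    · rw [(hS P hP).side_eq, (hS Q hQ).side_eq, heq]
  nonempty P _ := P.halfOpen_nonempty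

end Cube

lemma lintegral_mul_rpow_le_ApqChar {n : ℕ} (p q : ℝ) {β : ℝ} (hβ : β = q / (p / (p - 1)))
    (hβ0 : 0 < β) (w : (Fin n → ℝ) → ℝ) (Q : Cube n) :
    (∫⁻ x in Q.carrier, ENNReal.ofReal (w x) ^ q) *
        (∫⁻ x in Q.carrier, ENNReal.ofReal (w x) ^ (-(p / (p - 1)))) ^ β ≤
      ApqChar p q w * ENNReal.ofReal Q.vol ^ (1 + β) := by
  have hV0 : ENNReal.ofReal Q.vol ≠ 0 := (ENNReal.ofReal_pos.2 Q.vol_pos).ne'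
  have hV : ENNReal.ofReal Q.vol ≠ ∞ := ENNReal.ofReal_ne_top
  have h : _ ≤ ApqChar p q w := le_iSup (fun Q : Cube n =>
    ((ENNReal.ofReal Q.vol)⁻¹ * ∫⁻ x in Q.carrier, (ENNReal.ofReal (w x)) ^ q) *
      ((ENNReal.ofReal Q.vol)⁻¹ *
          ∫⁻ x in Q.carrier, (ENNReal.ofReal (w x)) ^ (-(p / (p - 1)))) ^ (q / (p / (p - 1)))) Q
  rw [← hβ, ENNReal.mul_rpow_of_nonneg _ _ hβ0.le] at h
  refine le_trans (le_of_eq ?_) (mul_le_mul_left h _)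
  set a := ∫⁻ x in Q.carrier, ENNReal.ofReal (w x) ^ q
  set b := (∫⁻ x in Q.carrier, ENNReal.ofReal (w x) ^ (-(p / (p - 1)))) ^ β
  rw [ENNReal.rpow_add _ _ hV0 hV, ENNReal.rpow_one, ENNReal.inv_rpow]
  set V := ENNReal.ofReal Q.vol
  have hVβ0 : V ^ β ≠ 0 := by simp [ENNReal.rpow_eq_zero_iff, hV0, hV]
  have hVβ : V ^ β ≠ ∞ := ENNReal.rpow_ne_top_of_nonneg hβ0.le hV
  calc a * b = (V⁻¹ * V) * ((V ^ β)⁻¹ * V ^ β) * (a * b) := by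
        rw [ENNReal.inv_mul_cancel hV0 hV, ENNReal.inv_mul_cancel hVβ0 hVβ, one_mul, one_mul]
    _ = V⁻¹ * a * ((V ^ β)⁻¹ * b) * (V * V ^ β) := by ring

/-- Hölder's inequality for a weight against its dual weight. -/
lemma measure_rpow_le_lintegral_mul {X : Type*} [MeasurableSpace X] (μ : Measure X) {q β s : ℝ}
    (hβ0 : 0 < β) (hs : q = β * s) {g : X → ℝ≥0∞} (hg : Measurable g)
    (hg0 : ∀ᵐ x ∂μ, g x ≠ 0) (hgt : ∀ x, g x ≠ ∞) (E : Set X) :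
    μ E ^ (1 + β) ≤ (∫⁻ x in E, g x ^ q ∂μ) * (∫⁻ x in E, g x ^ (-s) ∂μ) ^ β := by
  have h1 : (1 + β).HolderConjugate ((1 + β) / β) := by
    rw [Real.holderConjugate_iff]
    refine ⟨by linarith, ?_⟩
    field_simp
  have h := ENNReal.lintegral_mul_le_Lp_mul_Lq (μ.restrict E) h1
    (f := fun x => g x ^ (q / (1 + β))) (g := fun x => g x ^ (-(q / (1 + β))))
    (by fun_prop) (by fun_prop)
  have hE : μ E = ∫⁻ x in E, ((fun x => g x ^ (q / (1 + β))) * fun x => g x ^ (-(q / (1 + β)))) x ∂μ := by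
    rw [← setLIntegral_one]
    refine lintegral_congr_ae ?_
    filter_upwards [ae_restrict_of_ae hg0] with x hx
    simp only [Pi.mul_apply]
    rw [← ENNReal.rpow_add _ _ hx (hgt x)]
    simp
  have e1 : ∀ x, (g x ^ (q / (1 + β))) ^ (1 + β) = g x ^ q := fun x => by
    rw [← ENNReal.rpow_mul]; congr 1; field_simp
  have e2 : ∀ x, (g x ^ (-(q / (1 + β)))) ^ ((1 + β) / β) = g x ^ (-s) := fun x => by
    rw [← ENNReal.rpow_mul]; congr 1; rw [hs]; field_simp
  rw [← hE] at h
  simp only [e1, e2] at h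
  calc μ E ^ (1 + β) ≤ _ := ENNReal.rpow_le_rpow h (by linarith)
    _ = _ := by
      rw [ENNReal.mul_rpow_of_nonneg _ _ (by linarith), ← ENNReal.rpow_mul, ← ENNReal.rpow_mul]
      congr 1
      · rw [one_div_mul_cancel (by linarith), ENNReal.rpow_one]
      · congr 1; field_simp

/-- The cube centred at the origin with side length `2 * (N + 1)`. -/
def Cube.centered (n N : ℕ) : Cube n where
  corner _ := -(N + 1)
  side := 2 * (N + 1)
  side_pos := by positivity

lemma Cube.iUnion_carrier_centered (n : ℕ) :
    ⋃ N, (Cube.centered n N).carrier = Set.univ := by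
  refine Set.eq_univ_of_forall fun x => ?_
  obtain ⟨N, hN⟩ := exists_nat_ge ‖x‖
  refine Set.mem_iUnion.2 ⟨N, fun i => ?_⟩
  have h := abs_le.1 ((norm_le_pi_norm x i).trans hN)
  simp only [Cube.centered]
  constructor <;> linarith [h.1, h.2]

lemma Cube.carrier_centered_mono (n : ℕ) :
    Monotone fun N => (Cube.centered n N).carrier := by
  intro N M h x hx i
  have h' : (N : ℝ) ≤ M := by exact_mod_cast h
  have := hx i
  simp only [Cube.centered] at this ⊢
  constructor <;> linarith [this.1, this.2]

/-- A weight with finite characteristic which is not a.e. zero is a.e. positive. -/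
lemma ae_ne_zero_of_ApqChar_lt_top {n : ℕ} {p q : ℝ} (hp : 1 < p) (hq : 0 < q)
    {w : (Fin n → ℝ) → ℝ} (hw : Measurable w) (hA : ApqChar p q w < ∞)
    (hne : ¬ ∀ᵐ x, ENNReal.ofReal (w x) = 0) : ∀ᵐ x, ENNReal.ofReal (w x) ≠ 0 := by
  have hs : 0 < p / (p - 1) := div_pos (by linarith) (by linarith)
  have hβ0 : 0 < q / (p / (p - 1)) := div_pos hq hs
  have hex : ∃ N₀, ∀ N ≥ N₀,
      ∫⁻ x in (Cube.centered n N).carrier, ENNReal.ofReal (w x) ^ q ≠ 0 := by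
    by_contra! hcon
    refine hne ?_
    have h : ∀ N₀, ∀ᵐ x ∂volume.restrict (Cube.centered n N₀).carrier,
        ENNReal.ofReal (w x) = 0 := by
      intro N₀
      obtain ⟨N, hN, h0⟩ := hcon N₀
      rw [lintegral_eq_zero_iff (by fun_prop)] at h0
      refine ae_restrict_of_ae_restrict_of_subset (Cube.carrier_centered_mono n hN) ?_
      filter_upwards [h0] with x hx
      simpa [ENNReal.rpow_eq_zero_iff, hq, hq.not_gt] using hx
    rw [← ae_restrict_iUnion_iff, Cube.iUnion_carrier_centered, Measure.restrict_univ] at h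
    exact h
  obtain ⟨N₀, hN₀⟩ := hex
  have h : ∀ M, ∀ᵐ x ∂volume.restrict (Cube.centered n M).carrier,
      ENNReal.ofReal (w x) ≠ 0 := by
    intro M
    refine ae_restrict_of_ae_restrict_of_subset
      (Cube.carrier_centered_mono n (le_max_left M N₀)) ?_
    set Q := Cube.centered n (max M N₀)
    have h1 := lintegral_mul_rpow_le_ApqChar p q rfl hβ0 w Q
    have h2 : ApqChar p q w * ENNReal.ofReal Q.vol ^ (1 + q / (p / (p - 1))) < ∞ :=
      ENNReal.mul_lt_top hA (ENNReal.rpow_lt_top_of_nonneg (by linarith) ENNReal.ofReal_ne_top)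
    have h3 : ∫⁻ x in Q.carrier, ENNReal.ofReal (w x) ^ (-(p / (p - 1))) ≠ ∞ := by
      intro htop
      rw [htop, ENNReal.top_rpow_of_pos hβ0, ENNReal.mul_top (hN₀ _ (le_max_right _ _))] at h1
      exact absurd (h1.trans_lt h2) (lt_irrefl _)
    filter_upwards [ae_lt_top (by fun_prop) h3] with x hx hx0
    rw [hx0, ENNReal.zero_rpow_of_neg (by linarith)] at hx
    exact lt_irrefl _ hx
  rw [← ae_restrict_iUnion_iff, Cube.iUnion_carrier_centered, Measure.restrict_univ] at h
  exact h

/-- The weighted estimate for the square function over finitely many dyadic cubes. -/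
lemma lintegral_finset_carrier_le {n : ℕ} (hn : 1 ≤ n) {p q α η e : ℝ} (hp : 1 < p)
    (hpq : p < q) (hscale : 1 / q + (1 - 1 / p) = α) (hη : 0 < η)
    (he1 : 1 + (p / (p - 1)) / q ≤ e) (he2 : 1 + q / 2 * max (1 - 2 / p) 0 ≤ e) :
    ∃ C : ℝ, 0 < C ∧ ∀ S : Finset (Cube n), (∀ Q ∈ S, Q.IsDyadic) →
      IsSparse η (S : Set (Cube n)) →
      ∀ w : (Fin n → ℝ) → ℝ, Measurable w → ApqChar p q w < ∞ →
      (∀ᵐ x, ENNReal.ofReal (w x) ≠ 0) → ∀ f : (Fin n → ℝ) → ℝ, Measurable f →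
      ∫⁻ x, (∑ P ∈ S, P.carrier.indicator (fun _ =>
          (ENNReal.ofReal P.vol ^ (-α) * ∫⁻ y in P.carrier, ENNReal.ofReal (f y)) ^ (2 : ℝ)) x) ^
            (q / 2) * ENNReal.ofReal (w x) ^ q ≤
        ENNReal.ofReal C * ApqChar p q w ^ e *
          (∫⁻ x, ENNReal.ofReal (f x) ^ p * ENNReal.ofReal (w x) ^ p) ^ (q / p) := by
  have hp0 : 0 < p := by linarith
  have hq0 : 0 < q := by linarith
  have hp1 : 0 < p - 1 := by linarith
  set s : ℝ := p / (p - 1) with hs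
  have hs0 : 0 < s := by positivity
  obtain ⟨β, hβ⟩ : ∃ β, β = q / s := ⟨_, rfl⟩
  have hβ0 : 0 < β := hβ ▸ by positivity
  have hβq : β = q - q / p := by rw [hβ, hs]; field_simp
  have hαβ : α * q = 1 + β := by rw [← hscale, hβq]; field_simp
  have he1' : 1 + 1 / β ≤ e := by rwa [hβ, one_div_div]
  have hqs : q = β * s := by rw [hβ]; field_simp
  obtain ⟨C, hC, h⟩ := lintegral_square_function_le (ι := Cube n) (X := Fin n → ℝ) (d := n)
    hp hpq hβ0 hαβ (by exact_mod_cast hn) hη hβq he1' he2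
  refine ⟨C, hC, ?_⟩
  rintro S hS ⟨E, hEm, hEs, hEd, hEv⟩ w hw hA hw0 f hf
  set g : (Fin n → ℝ) → ℝ≥0∞ := fun x => ENNReal.ofReal (w x) with hg
  have hgm : Measurable g := by fun_prop
  have hgt : ∀ x, g x ≠ ∞ := fun x => ENNReal.ofReal_ne_top
  set W : Measure (Fin n → ℝ) := volume.withDensity fun x => g x ^ q with hW
  set σ : Measure (Fin n → ℝ) := volume.withDensity fun x => g x ^ (-s) with hσ
  have hWc : W ≪ volume := withDensity_absolutelyContinuous _ _
  have hσc : σ ≪ volume := withDensity_absolutelyContinuous _ _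
  have hae : ∀ P : Cube n, P.halfOpen =ᵐ[volume] P.carrier := fun P => P.halfOpen_ae_eq_carrier
  have hvol0 : ∀ P : Cube n, ENNReal.ofReal P.vol ≠ 0 := fun P =>
    (ENNReal.ofReal_pos.2 P.vol_pos).ne'
  have hWE : ∀ F : Set (Fin n → ℝ), MeasurableSet F → W F = ∫⁻ x in F, g x ^ q := fun F hF =>
    withDensity_apply _ hF
  have hσE : ∀ F : Set (Fin n → ℝ), MeasurableSet F → σ F = ∫⁻ x in F, g x ^ (-s) := fun F hF =>
    withDensity_apply _ hF
  have hupp : ∀ P : Cube n, W P.halfOpen * σ P.halfOpen ^ β ≤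
      ApqChar p q w * ENNReal.ofReal P.vol ^ (1 + β) := by
    intro P
    rw [measure_congr (hWc.ae_eq (hae P)), measure_congr (hσc.ae_eq (hae P)),
      hWE _ P.measurableSet_carrier, hσE _ P.measurableSet_carrier]
    exact lintegral_mul_rpow_le_ApqChar p q hβ hβ0 w P
  have hlow : ∀ F : Set (Fin n → ℝ), MeasurableSet F →
      volume F ^ (1 + β) ≤ W F * σ F ^ β := by
    intro F hF
    rw [hWE _ hF, hσE _ hF]
    exact measure_rpow_le_lintegral_mul volume hβ0 hqs hgm hw0 hgt F
  have hvolD : ∀ P : Cube n, volume P.halfOpen = ENNReal.ofReal P.vol := fun P => by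
    rw [measure_congr (hae P), P.volume_carrier]
  have hlowD : ∀ P : Cube n, 0 < W P.halfOpen * σ P.halfOpen ^ β := fun P => by
    refine lt_of_lt_of_le ?_ (hlow _ P.measurableSet_halfOpen)
    rw [hvolD]
    exact ENNReal.rpow_pos (pos_iff_ne_zero.2 (hvol0 P)) ENNReal.ofReal_ne_top
  have huppt : ∀ P : Cube n, W P.halfOpen * σ P.halfOpen ^ β < ∞ := fun P =>
    (hupp P).trans_lt (ENNReal.mul_lt_top hA
      (ENNReal.rpow_lt_top_of_nonneg (by linarith) ENNReal.ofReal_ne_top))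
  have hW0 : ∀ P : Cube n, W P.halfOpen ≠ 0 := fun P h0 => by
    simpa [h0] using hlowD P
  have hσ0 : ∀ P : Cube n, σ P.halfOpen ≠ 0 := fun P h0 => by
    simpa [h0, hβ0] using hlowD P
  have hWt : ∀ P : Cube n, W P.halfOpen ≠ ∞ := fun P h0 => by
    have := huppt P
    rw [h0, ENNReal.top_mul (by simp [ENNReal.rpow_eq_zero_iff, hσ0 P, hβ0.not_gt])] at this
    exact lt_irrefl _ this
  have hσt : ∀ P : Cube n, σ P.halfOpen ≠ ∞ := fun P h0 => by
    have := huppt P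
    rw [h0, ENNReal.top_rpow_of_pos hβ0, ENNReal.mul_top (hW0 P)] at this
    exact lt_irrefl _ this
  have hAone : 1 ≤ (ApqChar p q w).toReal := by
    have P := Cube.centered n 0
    have h1 := (hlow _ P.measurableSet_halfOpen).trans (hupp P)
    rw [hvolD] at h1
    have h2 : (ENNReal.ofReal P.vol) ^ (1 + β) ≠ 0 := by
      simp [ENNReal.rpow_eq_zero_iff, hvol0 P, (by linarith : ¬ (1 + β < 0))]
    have h3 : (ENNReal.ofReal P.vol) ^ (1 + β) ≠ ∞ :=
      ENNReal.rpow_ne_top_of_nonneg (by linarith) ENNReal.ofReal_ne_top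
    have h4 : 1 ≤ ApqChar p q w := by
      rw [← ENNReal.mul_le_mul_iff_left h2 h3, one_mul]
      exact h1
    simpa using ENNReal.toReal_mono hA.ne h4
  have hAeq : ENNReal.ofReal (ApqChar p q w).toReal = ApqChar p q w :=
    ENNReal.ofReal_toReal hA.ne
  set u : (Fin n → ℝ) → ℝ≥0∞ := fun x => ENNReal.ofReal (f x) * g x ^ s with hu
  have hum : Measurable u := by fun_prop
  have hmain := h σ W S Cube.halfOpen (fun P => E P ∩ P.halfOpen) Cube.scale u
    (ApqChar p q w).toReal (Cube.isNestedFamily_halfOpen hS)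
    (fun P _ => P.measurableSet_halfOpen)
    (fun P hP => (hEm P hP).inter P.measurableSet_halfOpen)
    (fun P _ => inter_subset_right)
    (fun P hP Q hQ hne => (hEd hP hQ hne).mono inter_subset_left inter_subset_left)
    (fun P _ => hσ0 P) (fun P _ => hσt P) (fun P _ => hW0 P) (fun P _ => hWt P)
    (fun P hP => by
      refine le_trans ?_ (hlow _ ((hEm P hP).inter P.measurableSet_halfOpen))
      refine ENNReal.rpow_le_rpow ?_ (by linarith)
      rw [← (hS P hP).vol_eq]
      refine (hEv P hP).trans (le_of_eq (measure_congr ?_))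
      have := (ae_eq_refl (E P)).inter (hae P)
      rw [inter_eq_self_of_subset_left (hEs P hP)] at this
      exact this.symm)
    (fun P hP => by
      rw [hAeq, ← (hS P hP).vol_eq]
      exact hupp P)
    hAone hum
  rw [hAeq] at hmain
  have hcarrier : ∀ P : Cube n, ∫⁻ y in P.halfOpen, u y ∂σ =
      ∫⁻ y in P.carrier, ENNReal.ofReal (f y) := by
    intro P
    rw [hσ, setLIntegral_withDensity_eq_setLIntegral_mul _ (by fun_prop) hum
      P.measurableSet_halfOpen, setLIntegral_congr (hae P)]
    refine lintegral_congr_ae ?_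
    filter_upwards [ae_restrict_of_ae hw0] with x hx
    simp only [Pi.mul_apply, hu]
    rw [mul_left_comm, ← ENNReal.rpow_add _ _ hx (hgt x)]
    simp
  have hU : ∫⁻ x, u x ^ p ∂σ = ∫⁻ x, ENNReal.ofReal (f x) ^ p * ENNReal.ofReal (w x) ^ p := by
    rw [hσ, lintegral_withDensity_eq_lintegral_mul _ (by fun_prop) (by fun_prop)]
    refine lintegral_congr_ae ?_
    filter_upwards [hw0] with x hx
    simp only [Pi.mul_apply, hu]
    rw [ENNReal.mul_rpow_of_nonneg _ _ hp0.le, ← ENNReal.rpow_mul, mul_left_comm,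
      ← ENNReal.rpow_add _ _ hx (hgt x)]
    congr 2
    rw [hs]; field_simp; ring
  rw [hU] at hmain
  refine le_trans (le_of_eq ?_) hmain
  have hSm : Measurable fun x => (∑ P ∈ S, P.halfOpen.indicator (fun _ =>
          (ENNReal.ofReal (2 ^ ((n : ℝ) * (P.scale : ℝ))) ^ (-α) * ∫⁻ y in P.halfOpen, u y ∂σ) ^
            (2 : ℝ)) x) ^ (q / 2) :=
    (Finset.measurable_fun_sum _ fun P _ =>
      measurable_const.indicator P.measurableSet_halfOpen).pow_const _
  rw [hW, lintegral_withDensity_eq_lintegral_mul _ (by fun_prop) hSm]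
  refine lintegral_congr_ae ?_
  have hall : ∀ᵐ x, ∀ P ∈ S, (x ∈ P.halfOpen ↔ x ∈ P.carrier) := by
    rw [Finset.eventually_all]
    intro P _
    filter_upwards [hae P] with x hx
    exact iff_of_eq hx
  filter_upwards [hall] with x hx
  simp only [Pi.mul_apply]
  rw [mul_comm]
  congr 2
  refine Finset.sum_congr rfl fun P hP => ?_
  rw [hcarrier, ← (hS P hP).vol_eq]
  by_cases hxP : x ∈ P.carrier
  · rw [indicator_of_mem hxP, indicator_of_mem ((hx P hP).2 hxP)]
  · rw [indicator_of_notMem hxP, indicator_of_notMem (mt (hx P hP).1 hxP)]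

lemma lintegral_cubeSum_rpow_le {n : ℕ} {r : ℝ} (hr : 0 ≤ r) {S : Set (Cube n)}
    (hS : S.Countable) (a : Cube n → ℝ≥0∞) {v : (Fin n → ℝ) → ℝ≥0∞} (hv : Measurable v)
    {B : ℝ≥0∞}
    (h : ∀ T : Finset (Cube n), (T : Set (Cube n)) ⊆ S →
      ∫⁻ x, (∑ P ∈ T, P.carrier.indicator (fun _ => a P) x) ^ r * v x ≤ B) :
    ∫⁻ x, cubeSum S a x ^ r * v x ≤ B := by
  classical
  rcases hr.eq_or_lt with rfl | hr0
  · simpa using h ∅ (by simp)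
  have : Countable S := hS.to_subtype
  have hrw : ∀ x, cubeSum S a x ^ r * v x =
      ⨆ T : Finset S, (∑ P ∈ T, P.1.carrier.indicator (fun _ => a P.1) x) ^ r * v x := by
    intro x
    rw [cubeSum, ENNReal.tsum_eq_iSup_sum, ← ENNReal.iSup_mul]
    congr 1
    exact (ENNReal.orderIsoRpow r hr0).map_iSup _
  simp only [hrw]
  rw [lintegral_iSup_directed]
  · refine iSup_le fun T => ?_
    have hT := h (T.map (Function.Embedding.subtype _)) (by simp)
    simpa using hT
  · intro T
    refine AEMeasurable.mul (AEMeasurable.pow_const (Measurable.aemeasurable ?_) _) hv.aemeasurable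
    exact Finset.measurable_fun_sum _ fun P _ =>
      measurable_const.indicator P.1.measurableSet_carrier
  · refine Monotone.directed_le fun T T' hTT' x => ?_
    exact mul_le_mul_left (ENNReal.rpow_le_rpow
      (Finset.sum_le_sum_of_subset hTT') hr) _

lemma IsSparse.mono {n : ℕ} {η : ℝ} {S T : Set (Cube n)} (h : IsSparse η S) (hT : T ⊆ S) :
    IsSparse η T := by
  obtain ⟨E, h1, h2, h3, h4⟩ := h
  exact ⟨E, fun Q hQ => h1 Q (hT hQ), fun Q hQ => h2 Q (hT hQ), h3.mono hT,
    fun Q hQ => h4 Q (hT hQ)⟩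

lemma eNorm_sparseOp_eq {n : ℕ} {q : ℝ} (hq : 0 < q) (α : ℝ) (S : Set (Cube n))
    {w : (Fin n → ℝ) → ℝ} (hw : ∀ x, 0 ≤ w x) (f : (Fin n → ℝ) → ℝ) :
    eNorm q (fun x => w x ^ q) (sparseOp S 2 α f) =
      (∫⁻ x, cubeSum S (fun Q =>
        ((ENNReal.ofReal Q.vol) ^ (-α) * ∫⁻ y in Q.carrier, ENNReal.ofReal (f y)) ^ (2 : ℝ)) x ^
          (q / 2) * ENNReal.ofReal (w x) ^ q) ^ (1 / q) := by
  unfold eNorm sparseOp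
  congr 1
  refine lintegral_congr fun x => ?_
  rw [← ENNReal.rpow_mul, ENNReal.ofReal_rpow_of_nonneg (hw x) hq.le]
  congr 2
  ring

lemma lintegral_rpow_le_wNorm {n : ℕ} {p : ℝ} (hp : 0 < p) {w : (Fin n → ℝ) → ℝ}
    (hw : ∀ x, 0 ≤ w x) (f : (Fin n → ℝ) → ℝ) :
    (∫⁻ x, ENNReal.ofReal (f x) ^ p * ENNReal.ofReal (w x) ^ p) ^ (1 / p) ≤
      wNorm p (fun x => w x ^ p) f := by
  refine ENNReal.rpow_le_rpow (lintegral_mono fun x => ?_) (by positivity)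
  simp only
  rw [← ENNReal.ofReal_rpow_of_nonneg (hw x) hp.le,
    ← ENNReal.ofReal_rpow_of_nonneg (abs_nonneg _) hp.le]
  gcongr
  exact le_abs_self _

lemma exists_eNorm_sparseOp_le_of_measurable {n : ℕ} (hn : 1 ≤ n) {p q α η : ℝ}
    (hα1 : α < 1) (hp : 1 < p) (hpq : p ≤ q) (hscale : 1 / q + (1 - 1 / p) = α) (hη : 0 < η) :
    ∃ C : ℝ, 0 < C ∧
      ∀ S : Set (Cube n), (∀ Q ∈ S, Q.IsDyadic) → IsSparse η S →
      ∀ w : (Fin n → ℝ) → ℝ, Measurable w → (∀ x, 0 ≤ w x) → ApqChar p q w < ∞ →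
      ∀ f : (Fin n → ℝ) → ℝ, Measurable f →
        eNorm q (fun x => w x ^ q) (sparseOp S 2 α f) ≤
          ENNReal.ofReal C *
            ApqChar p q w ^ max ((p / (p - 1)) / q * α) (α - 1 / 2) *
            wNorm p (fun x => w x ^ p) f := by
  have hp0 : 0 < p := by linarith
  have hq0 : 0 < q := by linarith
  have hp1 : 0 < p - 1 := by linarith
  have hpq' : p < q := by
    refine lt_of_le_of_ne hpq fun h => ?_
    rw [← h] at hscale
    linarith
  set κ := max ((p / (p - 1)) / q * α) (α - 1 / 2) with hκ
  have k1 : q * ((p / (p - 1)) / q * α) ≤ q * κ := mul_le_mul_of_nonneg_left (le_max_left _ _) hq0.le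
  have k2 : q * (α - 1 / 2) ≤ q * κ := mul_le_mul_of_nonneg_left (le_max_right _ _) hq0.le
  have e1 : q * ((p / (p - 1)) / q * α) = 1 + (p / (p - 1)) / q := by
    rw [← hscale]; field_simp; ring
  have e2 : q * (α - 1 / 2) = 1 + q / 2 * (1 - 2 / p) := by
    rw [← hscale]; field_simp; ring
  have he1 : 1 + (p / (p - 1)) / q ≤ q * κ := e1 ▸ k1
  have he2 : 1 + q / 2 * max (1 - 2 / p) 0 ≤ q * κ := by
    rcases max_cases (1 - 2 / p) 0 with ⟨h, -⟩ | ⟨h, -⟩ <;> rw [h]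
    · exact e2 ▸ k2
    · have : 0 < (p / (p - 1)) / q := by positivity
      linarith
  obtain ⟨C, hC, h⟩ := lintegral_finset_carrier_le hn hp hpq' hscale hη he1 he2
  refine ⟨C ^ (1 / q), by positivity, fun S hS hsp w hw hwn hA f hf => ?_⟩
  rw [eNorm_sparseOp_eq hq0 α S hwn f]
  by_cases hz : ∀ᵐ x, ENNReal.ofReal (w x) = 0
  · have h0 : ∫⁻ x, cubeSum S (fun Q =>
        ((ENNReal.ofReal Q.vol) ^ (-α) * ∫⁻ y in Q.carrier, ENNReal.ofReal (f y)) ^ (2 : ℝ)) x ^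
          (q / 2) * ENNReal.ofReal (w x) ^ q = 0 := by
      rw [← lintegral_zero (μ := (volume : Measure (Fin n → ℝ)))]
      refine lintegral_congr_ae ?_
      filter_upwards [hz] with x hx
      rw [hx, ENNReal.zero_rpow_of_pos hq0, mul_zero]
    rw [h0, ENNReal.zero_rpow_of_pos (by positivity)]
    exact zero_le
  have hw0 := ae_ne_zero_of_ApqChar_lt_top hp hq0 hw hA hz
  have hfin := lintegral_cubeSum_rpow_le (r := q / 2) (by positivity)
    (Cube.countable_setOf_isDyadic.mono hS)
    (fun Q => ((ENNReal.ofReal Q.vol) ^ (-α) * ∫⁻ y in Q.carrier, ENNReal.ofReal (f y)) ^ (2 : ℝ))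
    (v := fun x => ENNReal.ofReal (w x) ^ q) (by fun_prop)
    (fun T hT => h T (fun Q hQ => hS Q (hT hQ)) (hsp.mono hT) w hw hA hw0 f hf)
  refine (ENNReal.rpow_le_rpow hfin (by positivity)).trans ?_
  have hq' : (0 : ℝ) ≤ 1 / q := by positivity
  rw [ENNReal.mul_rpow_of_nonneg _ _ hq', ENNReal.mul_rpow_of_nonneg _ _ hq',
    ← ENNReal.rpow_mul, ← ENNReal.rpow_mul, ENNReal.ofReal_rpow_of_pos hC,
    show q * κ * (1 / q) = κ by field_simp, show q / p * (1 / q) = 1 / p by field_simp]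
  exact mul_le_mul_right (lintegral_rpow_le_wNorm hp0 hwn f) _

/-- pure `A_{pq}` estimate for the fractional square function
(`r = 2`, `1/q + 1/p' = α`): `‖A^{2,α}_S‖_{L^p_{ω^p} → L^q_{ω^q}} ≲ [ω]_{A_{pq}}^{max(p'α/q, α-1/2)}`. -/
theorem stmt14 (n : ℕ) (hn : 1 ≤ n) (p q α η : ℝ)
    (hα : 0 < α) (hα1 : α < 1) (hp : 1 < p) (hpq : p ≤ q)
    (hscale : 1 / q + (1 - 1 / p) = α) (hη : 0 < η) (hη1 : η ≤ 1) :
    ∃ C : ℝ, 0 < C ∧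
      ∀ S : Set (Cube n), (∀ Q ∈ S, Q.IsDyadic) → IsSparse η S →
      ∀ ω : (Fin n → ℝ) → ℝ, IsWeight ω → ApqChar p q ω < ∞ →
      ∀ f : (Fin n → ℝ) → ℝ, Measurable f → wNorm p (fun x => ω x ^ p) f < ∞ →
        eNorm q (fun x => ω x ^ q) (sparseOp S 2 α f) ≤
          ENNReal.ofReal C *
            ApqChar p q ω ^ max ((p / (p - 1)) / q * α) (α - 1 / 2) *
            wNorm p (fun x => ω x ^ p) f := by
  obtain ⟨C, hC, h⟩ := exists_eNorm_sparseOp_le_of_measurable hn hα1 hp hpq hscale hη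
  refine ⟨C, hC, fun S hS hsp ω hω hA f hf _ => ?_⟩
  obtain ⟨w, hw, hwω⟩ := hω.1.aestronglyMeasurable.aemeasurable
  have hwω' : ω =ᵐ[volume] fun x => max (w x) 0 := by
    filter_upwards [hwω] with x hx
    rw [← hx, max_eq_left (hω.2 x)]
  have hApq : ApqChar p q ω = ApqChar p q fun x => max (w x) 0 := by
    unfold ApqChar
    refine iSup_congr fun Q => ?_
    have hr (r : ℝ) : ∫⁻ x in Q.carrier, ENNReal.ofReal (ω x) ^ r =
        ∫⁻ x in Q.carrier, ENNReal.ofReal (max (w x) 0) ^ r := by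
      refine lintegral_congr_ae ?_
      filter_upwards [ae_restrict_of_ae hwω'] with x hx
      rw [hx]
    rw [hr, hr]
  have hE : eNorm q (fun x => ω x ^ q) (sparseOp S 2 α f) =
      eNorm q (fun x => max (w x) 0 ^ q) (sparseOp S 2 α f) := by
    unfold eNorm
    refine congrArg (· ^ (1 / q)) (lintegral_congr_ae ?_)
    filter_upwards [hwω'] with x hx
    rw [hx]
  have hN : wNorm p (fun x => ω x ^ p) f = wNorm p (fun x => max (w x) 0 ^ p) f := by
    unfold wNorm
    refine congrArg (· ^ (1 / p)) (lintegral_congr_ae ?_)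
    filter_upwards [hwω'] with x hx
    rw [hx]
  rw [hE, hN, hApq]
  exact h S hS hsp _ (hw.max measurable_const) (fun x => le_max_right _ _) (hApq ▸ hA) f hf
end
end

section
/- Let α ∈ (0,1) and 1 < p ≤ q < ∞ with 1/q + 1/p' = α. For ε ∈ (0,1) let ω_ε(x) := |x|^{(1−ε)/p'} on ℝ and f(x) := |x|^{ε−1} 1_{[0,1]}(x). Then, with constants depending only on p, q, α: [ω_ε]_{A_{pq}} ≃ ε^{−q/p'} and ‖f‖_{L^p_{ω_ε^p}} ≃ ε^{−1/p}. -/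
open MeasureTheory ENNReal Set

noncomputable section

/-- The power weight `ω_ε(x) = |x|^{(1-ε)/p'}` on ℝ. -/
def omEps (p ε : ℝ) : (Fin 1 → ℝ) → ℝ := fun x => |x 0| ^ ((1 - ε) / (p / (p - 1)))

/-- The test function `f(x) = |x|^{ε-1} 1_{[0,1]}(x)` on ℝ. -/
def fEps (ε : ℝ) : (Fin 1 → ℝ) → ℝ :=
  Set.indicator {x : Fin 1 → ℝ | 0 ≤ x 0 ∧ x 0 ≤ 1} (fun x => |x 0| ^ (ε - 1))

theorem setLIntegral_carrier (Q : Cube 1) (g : ℝ → ℝ≥0∞) :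
    ∫⁻ x in Q.carrier, g (x 0) =
      ∫⁻ y in Icc (Q.corner 0) (Q.corner 0 + Q.side), g y := by
  have hmp := volume_preserving_funUnique (Fin 1) ℝ
  have h := hmp.setLIntegral_comp_preimage_emb
    (MeasurableEquiv.funUnique (Fin 1) ℝ).measurableEmbedding g
    (Icc (Q.corner 0) (Q.corner 0 + Q.side))
  rw [← h]
  have hset : Q.carrier =
      (MeasurableEquiv.funUnique (Fin 1) ℝ) ⁻¹' Icc (Q.corner 0) (Q.corner 0 + Q.side) := by
    ext x
    simp [Cube.carrier, Fin.forall_fin_one, MeasurableEquiv.funUnique]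
  rw [hset]
  rfl

theorem lintegral_Icc_abs_rpow {r M : ℝ} (hr : -1 < r) (hM : 0 ≤ M) :
    ∫⁻ y in Icc 0 M, ENNReal.ofReal (|y| ^ r) = ENNReal.ofReal (M ^ (r + 1) / (r + 1)) := by
  have hcongr : ∫⁻ y in Icc 0 M, ENNReal.ofReal (|y| ^ r) =
      ∫⁻ y in Ioc 0 M, ENNReal.ofReal (y ^ r) := by
    rw [setLIntegral_congr (Ioc_ae_eq_Icc (a := (0 : ℝ)) (b := M)).symm]
    exact setLIntegral_congr_fun measurableSet_Ioc fun y hy => by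
      simp only [abs_of_pos hy.1]
  have hint : IntegrableOn (fun y : ℝ => y ^ r) (Ioc 0 M) :=
    (intervalIntegrable_iff_integrableOn_Ioc_of_le hM).1
      (intervalIntegral.intervalIntegrable_rpow' hr)
  rw [hcongr, ← ofReal_integral_eq_lintegral_ofReal hint
    ((ae_restrict_mem measurableSet_Ioc).mono fun y hy => Real.rpow_nonneg hy.1.le r),
    ← intervalIntegral.integral_of_le hM, integral_rpow (Or.inl hr),
    Real.zero_rpow (by linarith), sub_zero]

theorem lintegral_Icc_neg_abs_rpow_le {r M : ℝ} (hr : -1 < r) (hM : 0 ≤ M) :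
    ∫⁻ y in Icc (-M) M, ENNReal.ofReal (|y| ^ r) ≤
      ENNReal.ofReal (2 * (M ^ (r + 1) / (r + 1))) := by
  have hneg : ∫⁻ y in Icc (-M) 0, ENNReal.ofReal (|y| ^ r) =
      ∫⁻ y in Icc 0 M, ENNReal.ofReal (|y| ^ r) := by
    have h := (Measure.measurePreserving_neg (volume : Measure ℝ)).setLIntegral_comp_preimage_emb
      (MeasurableEquiv.neg ℝ).measurableEmbedding
      (fun y => ENNReal.ofReal (|y| ^ r)) (Icc 0 M)
    rw [← h]
    simp
  have hpos : 0 ≤ M ^ (r + 1) / (r + 1) :=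
    div_nonneg (Real.rpow_nonneg hM _) (by linarith)
  rw [← Icc_union_Icc_eq_Icc (by linarith : -M ≤ 0) hM]
  refine (lintegral_union_le _ _ _).trans ?_
  rw [hneg, lintegral_Icc_abs_rpow hr hM, ← ENNReal.ofReal_add hpos hpos, two_mul]

theorem average_abs_rpow_le_of_nonneg {r M t s : ℝ} (hr : 0 ≤ r) (hs : 0 < s)
    (ht : |t| ≤ M) (hts : |t + s| ≤ M) :
    (ENNReal.ofReal s)⁻¹ * ∫⁻ y in Icc t (t + s), ENNReal.ofReal (|y| ^ r) ≤
      ENNReal.ofReal (M ^ r) := by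
  have hbound : ∀ y ∈ Icc t (t + s), ENNReal.ofReal (|y| ^ r) ≤ ENNReal.ofReal (M ^ r) := by
    intro y hy
    have : |y| ≤ M :=
      abs_le.2 ⟨by linarith [hy.1, (abs_le.1 ht).1], by linarith [hy.2, (abs_le.1 hts).2]⟩
    gcongr
  have h := setLIntegral_mono' measurableSet_Icc hbound (μ := volume)
  rw [setLIntegral_const, Real.volume_Icc, add_sub_cancel_left] at h
  calc _ ≤ (ENNReal.ofReal s)⁻¹ * (ENNReal.ofReal (M ^ r) * ENNReal.ofReal s) := by gcongr
    _ = ENNReal.ofReal (M ^ r) := by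
      rw [mul_left_comm, ENNReal.inv_mul_cancel (by simpa using hs) ENNReal.ofReal_ne_top, mul_one]

theorem average_abs_rpow_le_of_neg {ε M t s : ℝ} (hε : 0 < ε) (hε1 : ε < 1) (hs : 0 < s)
    (hM : 0 < M) (ht : |t| ≤ M) (hts : |t + s| ≤ M) (hmax : M ≤ |t| ∨ M ≤ |t + s|) :
    (ENNReal.ofReal s)⁻¹ * ∫⁻ y in Icc t (t + s), ENNReal.ofReal (|y| ^ (ε - 1)) ≤
      ENNReal.ofReal (4 * M ^ (ε - 1) / ε) := by
  have hMr : 0 < M ^ (ε - 1) := Real.rpow_pos_of_pos hM _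
  suffices h : ∫⁻ y in Icc t (t + s), ENNReal.ofReal (|y| ^ (ε - 1)) ≤
      ENNReal.ofReal (4 * M ^ (ε - 1) / ε * s) by
    calc _ ≤ (ENNReal.ofReal s)⁻¹ * ENNReal.ofReal (4 * M ^ (ε - 1) / ε * s) := by gcongr
      _ = ENNReal.ofReal (4 * M ^ (ε - 1) / ε) := by
        rw [ENNReal.ofReal_mul (by positivity), mul_left_comm,
          ENNReal.inv_mul_cancel (by simpa using hs) ENNReal.ofReal_ne_top, mul_one]
  rcases le_or_gt (M / 2) s with hsM | hsM
  · have hsub : Icc t (t + s) ⊆ Icc (-M) M :=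
      Icc_subset_Icc (abs_le.1 ht).1 (abs_le.1 hts).2
    refine (lintegral_mono_set hsub).trans
      ((lintegral_Icc_neg_abs_rpow_le (by linarith) hM.le).trans ?_)
    apply ENNReal.ofReal_le_ofReal
    have hpow : M ^ (ε - 1 + 1) = M ^ (ε - 1) * M := by
      rw [Real.rpow_add hM, Real.rpow_one]
    rw [hpow, sub_add_cancel]
    calc 2 * (M ^ (ε - 1) * M / ε) = 4 * M ^ (ε - 1) / ε * (M / 2) := by ring
      _ ≤ _ := by gcongr
  · have hbound : ∀ y ∈ Icc t (t + s),
        ENNReal.ofReal (|y| ^ (ε - 1)) ≤ ENNReal.ofReal (4 * M ^ (ε - 1) / ε) := by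
      intro y hy
      have hy2 : M / 2 ≤ |y| := by
        rcases hmax with h | h
        · have := abs_sub_abs_le_abs_sub t y
          have h2 : |t - y| ≤ s := abs_le.2 ⟨by linarith [hy.2], by linarith [hy.1]⟩
          linarith
        · have := abs_sub_abs_le_abs_sub (t + s) y
          have h2 : |t + s - y| ≤ s := abs_le.2 ⟨by linarith [hy.2], by linarith [hy.1]⟩
          linarith
      apply ENNReal.ofReal_le_ofReal
      have h2 : (2 : ℝ)⁻¹ ^ (ε - 1) ≤ 4 := by
        rw [Real.inv_rpow (by norm_num), ← Real.rpow_neg (by norm_num)]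
        calc (2 : ℝ) ^ (-(ε - 1)) ≤ 2 ^ (2 : ℝ) :=
              Real.rpow_le_rpow_of_exponent_le (by norm_num) (by linarith)
          _ = 4 := by norm_num
      calc |y| ^ (ε - 1) ≤ (M / 2) ^ (ε - 1) :=
            Real.rpow_le_rpow_of_nonpos (by positivity) hy2 (by linarith)
        _ = 2⁻¹ ^ (ε - 1) * M ^ (ε - 1) := by
            rw [div_eq_mul_inv, Real.mul_rpow hM.le (by norm_num), mul_comm]
        _ ≤ 4 * M ^ (ε - 1) := by gcongr
        _ ≤ 4 * M ^ (ε - 1) / ε := le_div_self (by positivity) hε hε1.le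
    have h := setLIntegral_mono' measurableSet_Icc hbound (μ := volume)
    rwa [setLIntegral_const, Real.volume_Icc, add_sub_cancel_left,
      ← ENNReal.ofReal_mul (by positivity)] at h

/-- The `A_{pq}` functional of `omEps p ε` on a cube, as integrals of powers over an interval. -/
theorem apq_omEps_cube_eq {p q ε : ℝ} (hp : 1 < p) (hq : 0 < q) (Q : Cube 1) :
    ((ENNReal.ofReal Q.vol)⁻¹ *
        ∫⁻ x in Q.carrier, (ENNReal.ofReal (omEps p ε x)) ^ q) *
      ((ENNReal.ofReal Q.vol)⁻¹ *
          ∫⁻ x in Q.carrier, (ENNReal.ofReal (omEps p ε x)) ^ (-(p / (p - 1)))) ^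
        (q / (p / (p - 1))) =
    ((ENNReal.ofReal Q.side)⁻¹ * ∫⁻ y in Icc (Q.corner 0) (Q.corner 0 + Q.side),
        ENNReal.ofReal (|y| ^ ((1 - ε) * (q / (p / (p - 1)))))) *
      ((ENNReal.ofReal Q.side)⁻¹ * ∫⁻ y in Icc (Q.corner 0) (Q.corner 0 + Q.side),
        ENNReal.ofReal (|y| ^ (ε - 1))) ^ (q / (p / (p - 1))) := by
  have hP : p / (p - 1) ≠ 0 := (div_pos (by linarith) (by linarith)).ne'
  have h₁ : ∫⁻ x in Q.carrier, (ENNReal.ofReal (omEps p ε x)) ^ q =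
      ∫⁻ y in Icc (Q.corner 0) (Q.corner 0 + Q.side),
        ENNReal.ofReal (|y| ^ ((1 - ε) * (q / (p / (p - 1))))) := by
    rw [← setLIntegral_carrier Q fun y =>
      ENNReal.ofReal (|y| ^ ((1 - ε) * (q / (p / (p - 1)))))]
    refine lintegral_congr fun x => ?_
    rw [omEps, ENNReal.ofReal_rpow_of_nonneg (by positivity) hq.le,
      ← Real.rpow_mul (abs_nonneg _)]
    congr 2
    ring
  have h₂ : ∫⁻ x in Q.carrier, (ENNReal.ofReal (omEps p ε x)) ^ (-(p / (p - 1))) =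
      ∫⁻ y in Icc (Q.corner 0) (Q.corner 0 + Q.side), ENNReal.ofReal (|y| ^ (ε - 1)) := by
    have h := setLIntegral_carrier Q fun y =>
      (ENNReal.ofReal (|y| ^ ((1 - ε) / (p / (p - 1))))) ^ (-(p / (p - 1)))
    simp only [omEps]
    rw [h]
    refine lintegral_congr_ae (ae_restrict_of_ae ?_)
    filter_upwards [Measure.ae_ne volume (0 : ℝ)] with y hy
    have hy' : 0 < |y| := abs_pos.2 hy
    rw [ENNReal.ofReal_rpow_of_pos (Real.rpow_pos_of_pos hy' _), ← Real.rpow_mul hy'.le]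
    congr 2
    rw [mul_neg, div_mul_cancel₀ _ hP]
    ring
  rw [h₁, h₂, Cube.vol, pow_one]

theorem le_ApqChar_omEps {p q ε : ℝ} (hp : 1 < p) (hq : 0 < q) (hε : 0 < ε) (hε1 : ε < 1) :
    ENNReal.ofReal (1 / (1 + q / (p / (p - 1))) * ε ^ (-(q / (p / (p - 1))))) ≤
      ApqChar p q (omEps p ε) := by
  have hA : 0 < q / (p / (p - 1)) := div_pos hq (div_pos (by linarith) (by linarith))
  refine le_trans ?_ (le_iSup _ (⟨0, 1, one_pos⟩ : Cube 1))
  rw [apq_omEps_cube_eq hp hq]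
  set A := q / (p / (p - 1)) with hA_def
  have hr : 0 ≤ (1 - ε) * A := mul_nonneg (by linarith) hA.le
  simp only [Pi.zero_apply, zero_add, ENNReal.ofReal_one, inv_one, one_mul]
  rw [lintegral_Icc_abs_rpow (by linarith) zero_le_one,
    lintegral_Icc_abs_rpow (by linarith) zero_le_one, Real.one_rpow, Real.one_rpow,
    ENNReal.ofReal_rpow_of_nonneg (by rw [sub_add_cancel]; positivity) hA.le,
    ← ENNReal.ofReal_mul (by positivity)]
  apply ENNReal.ofReal_le_ofReal
  rw [sub_add_cancel, one_div ε, Real.inv_rpow hε.le, Real.rpow_neg hε.le]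
  have hle : (1 - ε) * A + 1 ≤ 1 + A := by nlinarith
  gcongr

theorem ApqChar_omEps_le {p q ε : ℝ} (hp : 1 < p) (hq : 0 < q) (hε : 0 < ε) (hε1 : ε < 1) :
    ApqChar p q (omEps p ε) ≤
      ENNReal.ofReal (4 ^ (q / (p / (p - 1))) * ε ^ (-(q / (p / (p - 1))))) := by
  have hA : 0 < q / (p / (p - 1)) := div_pos hq (div_pos (by linarith) (by linarith))
  refine iSup_le fun Q => ?_
  rw [apq_omEps_cube_eq hp hq]
  set A := q / (p / (p - 1)) with hA_def
  set M := max |Q.corner 0| |Q.corner 0 + Q.side| with hM_def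
  have hs := Q.side_pos
  have ht : |Q.corner 0| ≤ M := le_max_left _ _
  have hts : |Q.corner 0 + Q.side| ≤ M := le_max_right _ _
  have hM : 0 < M := by
    have h₁ := (abs_le.1 ht).1
    have h₂ := (abs_le.1 hts).2
    linarith
  have hMr : 0 < M ^ (ε - 1) := Real.rpow_pos_of_pos hM _
  refine (mul_le_mul' (average_abs_rpow_le_of_nonneg (mul_nonneg (by linarith) hA.le) hs ht hts)
    (ENNReal.rpow_le_rpow (average_abs_rpow_le_of_neg hε hε1 hs hM ht hts
      (le_max_iff.1 le_rfl)) hA.le)).trans ?_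
  rw [ENNReal.ofReal_rpow_of_nonneg (by positivity) hA.le,
    ← ENNReal.ofReal_mul (by positivity)]
  apply ENNReal.ofReal_le_ofReal
  rw [Real.div_rpow (by positivity) hε.le, Real.mul_rpow (by norm_num) hMr.le,
    ← Real.rpow_mul hM.le, Real.rpow_neg hε.le, mul_div_assoc', mul_left_comm,
    ← Real.rpow_add hM, show (1 - ε) * A + (ε - 1) * A = 0 by ring, Real.rpow_zero, mul_one,
    div_eq_mul_inv]

theorem wNorm_fEps {p ε : ℝ} (hp : 1 < p) (hε : 0 < ε) :
    wNorm p (fun x => omEps p ε x ^ p) (fEps ε) = ENNReal.ofReal (ε ^ (-(1 / p))) := by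
  have hp0 : 0 < p := by linarith
  have hp1 : p - 1 ≠ 0 := by linarith
  have hset : {x : Fin 1 → ℝ | 0 ≤ x 0 ∧ x 0 ≤ 1} = (⟨0, 1, one_pos⟩ : Cube 1).carrier := by
    ext x
    simp [Cube.carrier]
  have hmeas : MeasurableSet {x : Fin 1 → ℝ | 0 ≤ x 0 ∧ x 0 ≤ 1} :=
    (measurable_pi_apply (0 : Fin 1)) measurableSet_Icc
  have hfun : ∀ x : Fin 1 → ℝ,
      x 0 ≠ 0 → ENNReal.ofReal (|fEps ε x| ^ p) * ENNReal.ofReal (omEps p ε x ^ p) =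
        {x : Fin 1 → ℝ | 0 ≤ x 0 ∧ x 0 ≤ 1}.indicator
          (fun x => ENNReal.ofReal (|x 0| ^ (ε - 1))) x := by
    intro x hx
    have hx' : 0 < |x 0| := abs_pos.2 hx
    by_cases hmem : x ∈ {x : Fin 1 → ℝ | 0 ≤ x 0 ∧ x 0 ≤ 1}
    · rw [fEps, indicator_of_mem hmem, indicator_of_mem hmem, omEps,
        ← ENNReal.ofReal_mul (by positivity), abs_of_pos (Real.rpow_pos_of_pos hx' _),
        ← Real.rpow_mul hx'.le, ← Real.rpow_mul hx'.le, ← Real.rpow_add hx']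
      congr 2
      field_simp
      ring
    · rw [fEps, indicator_of_notMem hmem, indicator_of_notMem hmem, abs_zero,
        Real.zero_rpow hp0.ne', ENNReal.ofReal_zero, zero_mul]
  have hne : ∀ᵐ x : Fin 1 → ℝ, x 0 ≠ 0 :=
    (volume_preserving_funUnique (Fin 1) ℝ).quasiMeasurePreserving.ae
      (Measure.ae_ne volume (0 : ℝ))
  rw [wNorm, lintegral_congr_ae (hne.mono hfun), lintegral_indicator hmeas, hset,
    setLIntegral_carrier _ fun y => ENNReal.ofReal (|y| ^ (ε - 1))]
  simp only [Pi.zero_apply, zero_add]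
  rw [lintegral_Icc_abs_rpow (by linarith) zero_le_one, Real.one_rpow, sub_add_cancel,
    ENNReal.ofReal_rpow_of_nonneg (by positivity) (by positivity), one_div ε,
    Real.inv_rpow hε.le, Real.rpow_neg hε.le]

/-- with `ω_ε(x) = |x|^{(1-ε)/p'}` and `f = |x|^{ε-1} 1_{[0,1]}` one has
`[ω_ε]_{A_{pq}} ≃ ε^{-q/p'}` and `‖f‖_{L^p_{ω_ε^p}} ≃ ε^{-1/p}`, with comparison constants
depending only on `p`, `q`, `α`. -/
theorem stmt16 (p q α : ℝ) (hα : 0 < α) (hα1 : α < 1) (hp : 1 < p) (hpq : p ≤ q)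
    (hscale : 1 / q + (1 - 1 / p) = α) :
    ∃ c C : ℝ, 0 < c ∧ 0 < C ∧ ∀ ε : ℝ, 0 < ε → ε < 1 →
      (ENNReal.ofReal (c * ε ^ (-(q / (p / (p - 1))))) ≤ ApqChar p q (omEps p ε) ∧
        ApqChar p q (omEps p ε) ≤ ENNReal.ofReal (C * ε ^ (-(q / (p / (p - 1)))))) ∧
      (ENNReal.ofReal (c * ε ^ (-(1 / p))) ≤
          wNorm p (fun x => omEps p ε x ^ p) (fEps ε) ∧
        wNorm p (fun x => omEps p ε x ^ p) (fEps ε) ≤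
          ENNReal.ofReal (C * ε ^ (-(1 / p)))) := by
  have hq : 0 < q := by linarith
  have hA : 0 < q / (p / (p - 1)) := div_pos hq (div_pos (by linarith) (by linarith))
  refine ⟨1 / (1 + q / (p / (p - 1))), 4 ^ (q / (p / (p - 1))), by positivity, by positivity,
    fun ε hε hε1 => ⟨⟨le_ApqChar_omEps hp hq hε hε1, ApqChar_omEps_le hp hq hε hε1⟩, ?_, ?_⟩⟩
  · rw [wNorm_fEps hp hε]
    apply ENNReal.ofReal_le_ofReal
    refine mul_le_of_le_one_left (by positivity) ?_
    rw [div_le_one (by positivity)]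
    linarith
  · rw [wNorm_fEps hp hε]
    apply ENNReal.ofReal_le_ofReal
    exact le_mul_of_one_le_left (by positivity)
      (Real.one_le_rpow (by norm_num) hA.le)
end
end

section
/- Let α ∈ (0,1) and 1 < p ≤ q < ∞ with 1/q + 1/p' = α, and let 𝒮 := {[0,2^{−k}] : k ∈ ℕ₀}. For ε ∈ (0,1) let ω_ε(x) := |x|^{(1−ε)/p'} on ℝ and f(x) := |x|^{ε−1} 1_{[0,1]}(x). Then there is a constant c > 0 depending only on p, q, α such that ‖A^{2,α}_𝒮 f‖_{L^q_{ω_ε^q}} ≥ c · ε^{−1−1/q}; in fact, already the pointwise lower bound A^{2,α}_𝒮 f(x) ≥ c' |x|^{−α} ε^{−1} |x|^{ε} holds for x ∈ (0,1], and ∫_ℝ (A^{2,α}_𝒮 f)^q ω_ε^q ≥ c'' ε^{−1−q}. -/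
open MeasureTheory ENNReal Set

noncomputable section

/-- The sparse family `𝒮 = {[0, 2^{-k}] : k ∈ ℕ₀}` of intervals in ℝ. -/
def Sfrac : Set (Cube 1) :=
  {Q | ∃ k : ℕ, Q.corner = 0 ∧ Q.side = (2 : ℝ) ^ (-(k : ℤ))}

/-- Integrating a function of the only coordinate of a point of `Fin 1 → ℝ`. -/
theorem setLIntegral_fin_one (A : Set ℝ) (F : ℝ → ℝ≥0∞) :
    ∫⁻ x in {x : Fin 1 → ℝ | x 0 ∈ A}, F (x 0) = ∫⁻ t in A, F t :=
  (volume_preserving_funUnique (Fin 1) ℝ).setLIntegral_comp_preimage_emb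
    (MeasurableEquiv.funUnique (Fin 1) ℝ).measurableEmbedding F A

theorem lintegral_Ioc_zero_rpow {r s : ℝ} (hr : -1 < r) (hs : 0 < s) :
    ∫⁻ t in Ioc 0 s, ENNReal.ofReal (t ^ r) = ENNReal.ofReal (s ^ (r + 1) / (r + 1)) := by
  have hint : IntegrableOn (fun t : ℝ => t ^ r) (Ioc 0 s) :=
    (intervalIntegrable_iff_integrableOn_Ioc_of_le hs.le).1
      (intervalIntegral.intervalIntegrable_rpow' hr)
  rw [← ofReal_integral_eq_lintegral_ofReal hint, ← intervalIntegral.integral_of_le hs.le,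
    integral_rpow (Or.inl hr), Real.zero_rpow (by linarith), sub_zero]
  filter_upwards [ae_restrict_mem measurableSet_Ioc] with t ht
  exact Real.rpow_nonneg ht.1.le r

/-- A sparse operator dominates each of its averages. -/
theorem le_sparseOp {n : ℕ} {S : Set (Cube n)} {r : ℝ} (hr : 0 < r) (α : ℝ)
    (f : (Fin n → ℝ) → ℝ) {x : Fin n → ℝ} {Q : Cube n} (hQ : Q ∈ S) (hx : x ∈ Q.carrier) :
    (ENNReal.ofReal Q.vol) ^ (-α) * ∫⁻ y in Q.carrier, ENNReal.ofReal (f y) ≤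
      sparseOp S r α f x := by
  unfold sparseOp cubeSum
  rw [one_div, ENNReal.le_rpow_inv_iff hr]
  refine le_trans ?_ (ENNReal.le_tsum (⟨Q, hQ⟩ : S))
  simp [indicator_of_mem hx]

theorem exists_zpow_neg_nat_mem_Ico {t : ℝ} (h0 : 0 < t) (h1 : t ≤ 1) :
    ∃ k : ℕ, t ≤ (2 : ℝ) ^ (-(k : ℤ)) ∧ (2 : ℝ) ^ (-(k : ℤ)) ≤ 2 * t := by
  obtain ⟨k, hk, hk'⟩ := exists_nat_pow_near_of_lt_one h0 h1
    (by norm_num : (0 : ℝ) < 1 / 2) (by norm_num)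
  refine ⟨k, ?_, ?_⟩ <;> rw [zpow_neg, zpow_natCast, ← inv_pow, ← one_div]
  · exact hk'
  · rw [pow_succ] at hk
    linarith

theorem le_lintegral_fEps {ε : ℝ} (hε : 0 < ε) {Q : Cube 1} (hc : Q.corner = 0)
    (hs : Q.side ≤ 1) :
    ENNReal.ofReal (Q.side ^ ε / ε) ≤ ∫⁻ y in Q.carrier, ENNReal.ofReal (fEps ε y) := by
  have hI := lintegral_Ioc_zero_rpow (r := ε - 1) (by linarith) Q.side_pos
  rw [sub_add_cancel] at hI
  rw [← hI, ← setLIntegral_fin_one (Ioc 0 Q.side) fun t => ENNReal.ofReal (t ^ (ε - 1))]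
  have hsub : {x : Fin 1 → ℝ | x 0 ∈ Ioc 0 Q.side} ⊆ Q.carrier := by
    intro x hx i
    rw [Subsingleton.elim i 0, hc]
    simpa using ⟨hx.1.le, hx.2⟩
  refine le_trans (setLIntegral_mono' (measurableSet_Ioc.preimage (measurable_pi_apply 0)) ?_)
    (lintegral_mono_set hsub)
  intro x hx
  have hx1 : x 0 ≤ 1 := hx.2.trans hs
  rw [fEps, indicator_of_mem (show x ∈ {x : Fin 1 → ℝ | 0 ≤ x 0 ∧ x 0 ≤ 1} from
    ⟨hx.1.le, hx1⟩), abs_of_pos hx.1]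

theorem le_sparseOp_fEps {α ε : ℝ} (hα : 0 < α) (hε : 0 < ε) {x : Fin 1 → ℝ}
    (hx0 : 0 < x 0) (hx1 : x 0 ≤ 1) :
    ENNReal.ofReal (2 ^ (-α) * (x 0) ^ (-α) * ε⁻¹ * (x 0) ^ ε) ≤
      sparseOp Sfrac 2 α (fEps ε) x := by
  obtain ⟨k, hk, hk'⟩ := exists_zpow_neg_nat_mem_Ico hx0 hx1
  set s : ℝ := (2 : ℝ) ^ (-(k : ℤ)) with hs
  have hs0 : 0 < s := by positivity
  have hs1 : s ≤ 1 := zpow_le_one_of_nonpos₀ (by norm_num) (by simp)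
  let Q : Cube 1 := ⟨0, s, hs0⟩
  have hxQ : x ∈ Q.carrier := by
    intro i
    rw [Subsingleton.elim i 0]
    simpa [Q] using ⟨hx0.le, hk⟩
  refine le_trans ?_ (le_sparseOp two_pos α (fEps ε) (S := Sfrac) (Q := Q) ⟨k, rfl, rfl⟩ hxQ)
  refine le_trans ?_ (mul_le_mul_right (le_lintegral_fEps hε (Q := Q) rfl hs1) _)
  have hvol : Q.vol = s := pow_one s
  rw [hvol, ENNReal.ofReal_rpow_of_pos hs0, ← ENNReal.ofReal_mul (by positivity)]
  refine ENNReal.ofReal_le_ofReal ?_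
  have h1 : (2 : ℝ) ^ (-α) * (x 0) ^ (-α) ≤ s ^ (-α) := by
    rw [← Real.mul_rpow two_pos.le hx0.le]
    exact Real.rpow_le_rpow_of_nonpos hs0 hk' (by linarith)
  have h2 : (x 0) ^ ε ≤ s ^ ε := Real.rpow_le_rpow hx0.le hk hε.le
  calc 2 ^ (-α) * (x 0) ^ (-α) * ε⁻¹ * (x 0) ^ ε
      = (2 ^ (-α) * (x 0) ^ (-α)) * ((x 0) ^ ε / ε) := by ring
    _ ≤ s ^ (-α) * (s ^ ε / ε) := by gcongr

theorem le_lintegral_sparseOp_fEps {p q α ε : ℝ} (hα : 0 < α) (hp : 0 < p) (hq : 0 < q)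
    (hscale : 1 / q + (1 - 1 / p) = α) (hε : 0 < ε) :
    ENNReal.ofReal (((2 : ℝ) ^ (-α)) ^ q * (p / q) * ε ^ (-(1 + q))) ≤
      ∫⁻ x, sparseOp Sfrac 2 α (fEps ε) x ^ q * ENNReal.ofReal (omEps p ε x ^ q) := by
  have hr : -1 < -1 + ε * q / p := by
    have : 0 < ε * q / p := by positivity
    linarith
  have hI := lintegral_Ioc_zero_rpow hr one_pos
  have hC : 0 ≤ ((2 : ℝ) ^ (-α) * ε⁻¹) ^ q := by positivity
  calc ENNReal.ofReal (((2 : ℝ) ^ (-α)) ^ q * (p / q) * ε ^ (-(1 + q)))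
      = ∫⁻ t in Ioc (0 : ℝ) 1, ENNReal.ofReal (((2 : ℝ) ^ (-α) * ε⁻¹) ^ q) *
          ENNReal.ofReal (t ^ (-1 + ε * q / p)) := by
        rw [lintegral_const_mul' _ _ ENNReal.ofReal_ne_top, hI, ← ENNReal.ofReal_mul hC]
        congr 1
        rw [Real.one_rpow, neg_add_cancel_comm, Real.mul_rpow (by positivity) (by positivity),
          Real.inv_rpow hε.le, neg_add, Real.rpow_add hε, Real.rpow_neg_one, Real.rpow_neg hε.le]
        field_simp
    _ = ∫⁻ x in {x : Fin 1 → ℝ | x 0 ∈ Ioc (0 : ℝ) 1},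
          ENNReal.ofReal (((2 : ℝ) ^ (-α) * ε⁻¹) ^ q) *
            ENNReal.ofReal ((x 0) ^ (-1 + ε * q / p)) :=
        (setLIntegral_fin_one _ fun t => ENNReal.ofReal (((2 : ℝ) ^ (-α) * ε⁻¹) ^ q) *
            ENNReal.ofReal (t ^ (-1 + ε * q / p))).symm
    _ ≤ ∫⁻ x in {x : Fin 1 → ℝ | x 0 ∈ Ioc (0 : ℝ) 1},
          sparseOp Sfrac 2 α (fEps ε) x ^ q * ENNReal.ofReal (omEps p ε x ^ q) := by
        refine setLIntegral_mono' (measurableSet_Ioc.preimage (measurable_pi_apply 0)) ?_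
        intro x hx
        have hx0 : 0 < x 0 := hx.1
        refine le_trans (le_of_eq ?_) (mul_le_mul_left
          (ENNReal.rpow_le_rpow (le_sparseOp_fEps hα hε hx0 hx.2) hq.le) _)
        rw [ENNReal.ofReal_rpow_of_nonneg (by positivity) hq.le, ← ENNReal.ofReal_mul hC,
          ← ENNReal.ofReal_mul (by positivity)]
        congr 1
        have hexp : -1 + ε * q / p = -α * q + ε * q + (1 - ε) / (p / (p - 1)) * q := by
          rw [← hscale]
          field_simp
          ring
        rw [omEps, abs_of_pos hx0, hexp, Real.rpow_add hx0, Real.rpow_add hx0,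
          Real.rpow_mul hx0.le, Real.rpow_mul hx0.le, Real.rpow_mul hx0.le,
          show (2 : ℝ) ^ (-α) * (x 0) ^ (-α) * ε⁻¹ * (x 0) ^ ε =
            ((2 : ℝ) ^ (-α) * ε⁻¹) * (x 0) ^ (-α) * (x 0) ^ ε by ring,
          Real.mul_rpow (x := (2 : ℝ) ^ (-α) * ε⁻¹ * (x 0) ^ (-α)) (by positivity) (by positivity),
          Real.mul_rpow (x := (2 : ℝ) ^ (-α) * ε⁻¹) (by positivity) (by positivity)]
        ring
    _ ≤ _ := setLIntegral_le_lintegral _ _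

/-- lower bounds for the fractional square function on the test pair:
pointwise `A^{2,α}_𝒮 f(x) ≳ |x|^{-α} ε^{-1} |x|^ε` on `(0,1]`,
`∫ (A^{2,α}_𝒮 f)^q ω_ε^q ≳ ε^{-1-q}`, and `‖A^{2,α}_𝒮 f‖_{L^q_{ω_ε^q}} ≳ ε^{-1-1/q}`. -/
theorem stmt17 (p q α : ℝ) (hα : 0 < α) (hα1 : α < 1) (hp : 1 < p) (hpq : p ≤ q)
    (hscale : 1 / q + (1 - 1 / p) = α) :
    ∃ c c' c'' : ℝ, 0 < c ∧ 0 < c' ∧ 0 < c'' ∧ ∀ ε : ℝ, 0 < ε → ε < 1 →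
      (∀ x : Fin 1 → ℝ, 0 < x 0 → x 0 ≤ 1 →
        ENNReal.ofReal (c' * (x 0) ^ (-α) * ε⁻¹ * (x 0) ^ ε) ≤ sparseOp Sfrac 2 α (fEps ε) x) ∧
      (ENNReal.ofReal (c'' * ε ^ (-(1 + q))) ≤
        ∫⁻ x, sparseOp Sfrac 2 α (fEps ε) x ^ q * ENNReal.ofReal (omEps p ε x ^ q)) ∧
      (ENNReal.ofReal (c * ε ^ (-(1 + 1 / q))) ≤
        eNorm q (fun x => omEps p ε x ^ q) (sparseOp Sfrac 2 α (fEps ε))) := by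
  have hp0 : 0 < p := by linarith
  have hq0 : 0 < q := by linarith
  have hc : 0 < ((2 : ℝ) ^ (-α)) ^ q * (p / q) := by positivity
  refine ⟨(((2 : ℝ) ^ (-α)) ^ q * (p / q)) ^ (1 / q), 2 ^ (-α),
    ((2 : ℝ) ^ (-α)) ^ q * (p / q), by positivity, by positivity, hc, fun ε hε _ => ?_⟩
  have hint := le_lintegral_sparseOp_fEps hα hp0 hq0 hscale hε
  refine ⟨fun x => le_sparseOp_fEps hα hε, hint, ?_⟩
  refine le_trans (le_of_eq ?_) (ENNReal.rpow_le_rpow hint (by positivity : 0 ≤ 1 / q))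
  rw [ENNReal.ofReal_rpow_of_nonneg (by positivity) (by positivity),
    Real.mul_rpow hc.le (by positivity), ← Real.rpow_mul hε.le]
  congr 3
  field_simp
  ring
end
end
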